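/- Let T_ℓ : C_ℓ → C_ℓ be the action of the decorated SMART machine on cyclic tapes of length ℓ, and let T_ℓ↾d₀ denote the permutation of C_ℓ that applies T_ℓ to those configurations whose head has duck component d₀ and fixes all other configurations. There exists a constant K > 0 such that for every ℓ ≥ 2 and every n ∈ ℕ, the permutation (T_ℓ↾d₀)^n belongs to G_ℓ with word norm at most K·ℓ⁴. -/

import Mathlib

/-- The word norm of `g` with respect to the generating set `F`:
the least `n` such that `g` is a product of `n` elements of `F ∪ F⁻¹`. -/
noncomputable def wordNorm {G : Type*} [Group G] (F : Set G) (g : G) : ℕ :=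
  sInf {n : ℕ | ∃ w : List G, w.length = n ∧ (∀ x ∈ w, x ∈ F ∨ x⁻¹ ∈ F) ∧ w.prod = g}
/-! ### Turing machine symbols and local step functions -/

/-- Tape/head symbols: a plain tape letter, or a head `(q, a)` on top of letter `a`. -/
abbrev TSym (Q Γ : Type) : Type := Γ ⊕ (Q × Γ)

/-- The tape letter carried by a cell (under the head if the cell carries the head). -/
def tapeLetter {Q Γ : Type} : TSym Q Γ → Γ
  | Sum.inl a => a
  | Sum.inr (_, a) => a

/-- A complete deterministic machine is given by a head-step function: at `(q, a)` it either
rewrites the head in place (`.inl (q', b)`, a matching transition), or moves in direction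
`δ ∈ {+1, -1}` into state `q'` (`.inr (δ, q')`, a move transition). -/
abbrev HeadStep (Q Γ : Type) : Type := Q → Γ → ((Q × Γ) ⊕ (ℤ × Q))

/-- If the symbol `s` carries a head about to move in direction `d`, the state in which the
head arrives; `none` otherwise. -/
def arrivesAs {Q Γ : Type} (δ : HeadStep Q Γ) (s : TSym Q Γ) (d : ℤ) : Option Q :=
  match s with
  | Sum.inl _ => none
  | Sum.inr (q, a) =>
    match δ q a with
    | Sum.inl _ => none
    | Sum.inr (d', q') => if d' = d then some q' else none

/-- The local rule of the moving-head dynamics: the new symbol of a cell, given the symbols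
`l, c, r` of its left neighbour, itself, and its right neighbour. -/
def localStep {Q Γ : Type} (δ : HeadStep Q Γ) (l c r : TSym Q Γ) : TSym Q Γ :=
  match c with
  | Sum.inr (q, a) =>
    (match δ q a with
     | Sum.inl qb => Sum.inr qb
     | Sum.inr _ => Sum.inl a)
  | Sum.inl a =>
    (match arrivesAs δ l 1 with
     | some q' => Sum.inr (q', a)
     | none =>
       match arrivesAs δ r (-1) with
       | some q' => Sum.inr (q', a)
       | none => Sum.inl a)

/-- The moving-head action of a complete deterministic machine on bi-infinite tapes. -/
def stepZ {Q Γ : Type} (δ : HeadStep Q Γ) (x : ℤ → TSym Q Γ) : ℤ → TSym Q Γ :=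
  fun i => localStep δ (x (i - 1)) (x i) (x (i + 1))

/-- The action of a complete deterministic machine on cyclic tapes of length `ℓ`. -/
def stepC {Q Γ : Type} (δ : HeadStep Q Γ) (ℓ : ℕ) (w : ZMod ℓ → TSym Q Γ) :
    ZMod ℓ → TSym Q Γ :=
  fun i => localStep δ (w (i - 1)) (w i) (w (i + 1))

/-- A configuration has at most one head. -/
def AtMostOneHeadZ {Q Γ : Type} (x : ℤ → TSym Q Γ) : Prop :=
  ∀ i j : ℤ, (x i).isRight = true → (x j).isRight = true → i = j

/-- A cyclic configuration has at most one head. -/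
def AtMostOneHeadC {Q Γ : Type} {ℓ : ℕ} (w : ZMod ℓ → TSym Q Γ) : Prop :=
  ∀ i j : ZMod ℓ, (w i).isRight = true → (w j).isRight = true → i = j

/-! ### The SMART machine -/

/-- The four arrows `▶, ◀, ▷, ◁` (filled right/left, hollow right/left). -/
inductive Arrow : Type
  | rf  -- ▶ (filled right)
  | lf  -- ◀ (filled left)
  | rh  -- ▷ (hollow right)
  | lh  -- ◁ (hollow left)
deriving DecidableEq

/-- The SMART state set `Q̊`: an arrow with a subscript in `{1,2}`; the subscript `b`
is represented by the `Fin 2` value `b - 1`. -/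
abbrev SQ : Type := Arrow × Fin 2

/-- The SMART tape alphabet `{0,1,2}`. -/
abbrev Letter : Type := Fin 3

/-- The head-step function of the SMART machine.  States `q₂` (second component `1`) are
move states; states `q₁` (second component `0`) are matching states. -/
def smartStep : HeadStep SQ Letter := fun q a =>
  if q.2 = 1 then
    match q.1 with
    | .rf => Sum.inr (1, (.rf, 0))   -- (▶₂, +1, ▶₁)
    | .lf => Sum.inr (-1, (.lf, 0))  -- (◀₂, −1, ◀₁)
    | .rh => Sum.inr (1, (.rh, 0))   -- (▷₂, +1, ▷₁)
    | .lh => Sum.inr (-1, (.lh, 0))  -- (◁₂, −1, ◁₁)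
  else
    match q.1 with
    | .rf => Sum.inl (if a = 0 then ((.lf, 1), 1) else if a = 1 then ((.lh, 1), 1) else ((.lh, 1), 2))
    | .lf => Sum.inl (if a = 0 then ((.rf, 1), 1) else if a = 1 then ((.rh, 1), 1) else ((.rh, 1), 2))
    | .rh => Sum.inl (if a = 0 then ((.rf, 1), 2) else if a = 1 then ((.rf, 1), 0) else ((.lh, 1), 0))
    | .lh => Sum.inl (if a = 0 then ((.lf, 1), 2) else if a = 1 then ((.lf, 1), 0) else ((.rh, 1), 0))

/-! ### The decorated SMART machine -/

/-- The state set of the decorated SMART machine: a SMART state together with a *duck*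
`d ∈ {d₀, d₁}` (as `Fin 2`, `0 ↦ d₀`) and a *ghost* `x ∈ {0,…,5}` (as `Fin 6`). -/
abbrev DQ : Type := SQ × Fin 2 × Fin 6

/-- The head-step function of the decorated SMART machine: it acts as SMART on the
`Q̊`-component and carries the duck and ghost unchanged. -/
def decStep : HeadStep DQ Letter := fun q a =>
  match smartStep q.1 a with
  | Sum.inl (q', b) => Sum.inl ((q', q.2), b)
  | Sum.inr (d, q') => Sum.inr (d, (q', q.2))

/-! ### The group `G_ℓ` of Turing machine instructions on cyclic tapes -/

/-- Cyclic configurations of length `ℓ` with at most one head. -/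
abbrev CConf (Q Γ : Type) (ℓ : ℕ) : Type :=
  {w : ZMod ℓ → TSym Q Γ // AtMostOneHeadC w}

/-- The pointwise action on symbols of a permutation `g` of head symbols. -/
def gateApply {Q Γ : Type} (g : Equiv.Perm (Q × Γ)) : TSym Q Γ → TSym Q Γ
  | Sum.inl a => Sum.inl a
  | Sum.inr h => Sum.inr (g h)

/-- `π` is the unary gate `π_g`: it applies `g` to the head symbol (if a head is present)
and fixes all other cells. -/
def IsUnaryGate {Q Γ : Type} {ℓ : ℕ} (g : Equiv.Perm (Q × Γ))
    (π : Equiv.Perm (CConf Q Γ ℓ)) : Prop :=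
  ∀ w : CConf Q Γ ℓ, ∀ i : ZMod ℓ, (π w).1 i = gateApply g (w.1 i)

/-- `π` is the state-dependent right move `ρ_q`: it moves a head in state `q` one position
to the right (mod `ℓ`), leaving its tape letter behind and picking up the next cell's
letter, and fixes configurations whose head is not in state `q`. -/
def IsMoveGate {Q Γ : Type} [DecidableEq Q] {ℓ : ℕ} (q : Q)
    (π : Equiv.Perm (CConf Q Γ ℓ)) : Prop :=
  ∀ w : CConf Q Γ ℓ,
    ((∀ i a, w.1 i ≠ Sum.inr (q, a)) → π w = w) ∧
    (∀ i a, w.1 i = Sum.inr (q, a) →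
      ∀ j : ZMod ℓ, (π w).1 j =
        if j = i + 1 then Sum.inr (q, tapeLetter (w.1 (i + 1)))
        else if j = i then Sum.inl a
        else w.1 j)

/-- The generating set of the group `G_ℓ` of Turing machine instructions: all unary gates
`π_g` and all state-dependent moves `ρ_q`. -/
def TMGens (Q Γ : Type) [DecidableEq Q] (ℓ : ℕ) : Set (Equiv.Perm (CConf Q Γ ℓ)) :=
  {π | (∃ g, IsUnaryGate g π) ∨ (∃ q, IsMoveGate q π)}

/-! ### The two-step dynamics on cyclic words read from the head -/

/-- The rewriting done by SMART at a head in a matching state. -/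
def smartRule : Arrow → Letter → Arrow × Letter
  | .rf, 0 => (.lf, 1)
  | .rf, 1 => (.lh, 1)
  | .rf, 2 => (.lh, 2)
  | .lf, 0 => (.rf, 1)
  | .lf, 1 => (.rh, 1)
  | .lf, 2 => (.rh, 2)
  | .rh, 0 => (.rf, 2)
  | .rh, 1 => (.rf, 0)
  | .rh, 2 => (.lh, 0)
  | .lh, 0 => (.lf, 2)
  | .lh, 1 => (.lf, 0)
  | .lh, 2 => (.rh, 0)

/-- Whether an arrow points to the right. -/
def Arrow.isRt : Arrow → Bool
  | .rf => true
  | .rh => true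
  | .lf => false
  | .lh => false

/-- Cyclic right rotation of a word: the last letter becomes the first one. -/
def rotR {α : Type} : List α → List α
  | [] => []
  | a :: t => (a :: t).getLast (by simp) :: (a :: t).dropLast

@[simp] lemma rotR_concat {α : Type} (u : List α) (z : α) : rotR (u ++ [z]) = z :: u := by
  cases u with
  | nil => rfl
  | cons a t =>
    have h : (a :: (t ++ [z])).dropLast = a :: t := List.dropLast_concat (l₁ := a :: t)
    simp [rotR, h]

@[simp] lemma rotR_singleton {α : Type} (z : α) : rotR [z] = [z] := rfl

@[simp] lemma rotR_cons_concat {α : Type} (b : α) (u : List α) (z : α) :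
    rotR (b :: (u ++ [z])) = z :: b :: u := rotR_concat (b :: u) z

@[simp] lemma rotR_cons_append_pair {α : Type} (b : α) (u : List α) (y z : α) :
    rotR (b :: (u ++ [y, z])) = z :: b :: (u ++ [y]) := by
  simpa using rotR_concat (b :: (u ++ [y])) z

@[simp] lemma rotR_pair {α : Type} (b z : α) : rotR [b, z] = [z, b] := rfl

/-- A head state, the cyclic word read rightwards from the head, and the head position. -/
abbrev WConf (ℓ : ℕ) : Type := Arrow × List Letter × ZMod ℓ

/-- Two steps of SMART, from a matching state to a matching state. -/
def smartTwo {ℓ : ℕ} : WConf ℓ → WConf ℓ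
  | (s, [], p) => (s, [], p)
  | (s, a :: t, p) =>
    if (smartRule s a).1.isRt then ((smartRule s a).1, t ++ [(smartRule s a).2], p + 1)
    else ((smartRule s a).1, rotR ((smartRule s a).2 :: t), p - 1)

/-- The self-similarity of SMART: it inserts one cell into the cyclic word. -/
def inflate {ℓ : ℕ} : WConf ℓ → WConf ℓ
  | (.rf, v, p) => (.rf, v ++ [0], p + 1)
  | (.rh, v, p) => (.rf, v ++ [2], p + 1)
  | (.lf, [], p) => (.lh, [1], p + 1)
  | (.lf, a :: t, p) => (.lh, 1 :: (t ++ [a]), p + 1)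
  | (.lh, [], p) => (.lh, [0], p + 1)
  | (.lh, a :: t, p) => (.lh, 0 :: (t ++ [a]), p + 1)

/-- The number of steps that simulate one step after `k` inflations. -/
def dur (k : ℕ) : Arrow → Letter → ℕ
  | .rf, 1 => 1
  | .rf, 2 => 1
  | .lf, 0 => 2 * 3 ^ k - 1
  | .lh, 2 => 2 * 3 ^ k - 1
  | _, _ => 3 ^ k

lemma dur_zero (s : Arrow) (a : Letter) : dur 0 s a = 1 := by
  cases s <;> fin_cases a <;> rfl

lemma inflate_smartTwo {ℓ : ℕ} (s : Arrow) (a : Letter) (t : List Letter) (p : ZMod ℓ) :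
    inflate (smartTwo (s, a :: t, p)) = smartTwo^[dur 1 s a] (inflate (s, a :: t, p)) := by
  rcases List.eq_nil_or_concat t with rfl | ⟨u, z, rfl⟩ <;>
  cases s <;> fin_cases a <;>
  simp [inflate, smartTwo, smartRule, Arrow.isRt, dur, Function.iterate_succ_apply]

/-- The duration under `k` inflations of the first `n` steps from a configuration. -/
def durSum {ℓ : ℕ} (k : ℕ) : ℕ → WConf ℓ → ℕ
  | 0, _ => 0
  | n + 1, (s, [], p) => durSum k n (s, [], p)
  | n + 1, (s, a :: t, p) => dur k s a + durSum k n (smartTwo (s, a :: t, p))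

lemma durSum_inflate {ℓ : ℕ} (k : ℕ) (s : Arrow) (a : Letter) (t : List Letter) (p : ZMod ℓ) :
    durSum k (dur 1 s a) (inflate (s, a :: t, p)) = dur (k + 1) s a := by
  have : 0 < 3 ^ k := by positivity
  have h3 : 3 ^ (k + 1) = 3 * 3 ^ k := by ring
  rcases List.eq_nil_or_concat t with rfl | ⟨u, z, rfl⟩ <;>
  cases s <;> fin_cases a <;>
  simp [inflate, smartTwo, smartRule, Arrow.isRt, dur, durSum] <;> omega

lemma inflate_iterate_smartTwo_iterate_of {ℓ : ℕ} {k : ℕ}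
    (h : ∀ (s : Arrow) (a : Letter) (t : List Letter) (p : ZMod ℓ),
      inflate^[k] (smartTwo (s, a :: t, p)) = smartTwo^[dur k s a] (inflate^[k] (s, a :: t, p)))
    (n : ℕ) (w : WConf ℓ) :
    inflate^[k] (smartTwo^[n] w) = smartTwo^[durSum k n w] (inflate^[k] w) := by
  induction n generalizing w with
  | zero => rfl
  | succ n ih =>
    obtain ⟨s, v, p⟩ := w
    cases v with
    | nil => rw [Function.iterate_succ_apply]; exact ih _
    | cons a t =>
      rw [Function.iterate_succ_apply, ih, h, durSum, ← Function.iterate_add_apply, add_comm]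

lemma inflate_iterate_smartTwo {ℓ : ℕ} (k : ℕ) (s : Arrow) (a : Letter) (t : List Letter)
    (p : ZMod ℓ) :
    inflate^[k] (smartTwo (s, a :: t, p)) = smartTwo^[dur k s a] (inflate^[k] (s, a :: t, p)) := by
  induction k generalizing s a t p with
  | zero => simp [dur_zero]
  | succ k ih =>
    rw [Function.iterate_succ_apply, inflate_smartTwo, inflate_iterate_smartTwo_iterate_of ih,
      durSum_inflate, Function.iterate_succ_apply]

/-- `k` inflations intertwine `n` steps with `durSum k n` steps. -/
lemma inflate_iterate_smartTwo_iterate {ℓ : ℕ} (k n : ℕ) (w : WConf ℓ) :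
    inflate^[k] (smartTwo^[n] w) = smartTwo^[durSum k n w] (inflate^[k] w) :=
  inflate_iterate_smartTwo_iterate_of (inflate_iterate_smartTwo k) n w

lemma smartTwo_iterate_inflate {ℓ : ℕ} {k : ℕ} (m n e : ℕ) (w w' : WConf ℓ)
    (hw : smartTwo^[m] w = w') (he : e = n + durSum k m w) :
    smartTwo^[e] (inflate^[k] w) = smartTwo^[n] (inflate^[k] w') := by
  rw [he, Function.iterate_add_apply, ← hw, inflate_iterate_smartTwo_iterate]

/-- The displacement of an arrow. -/
def Arrow.dir {ℓ : ℕ} (s : Arrow) : ZMod ℓ := if s.isRt then 1 else -1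

/-- On an inflated empty word, the head makes a full turn in `3 ^ k` steps. -/
lemma smartTwo_iterate_inflate_nil {ℓ : ℕ} (k : ℕ) (s : Arrow) (p : ZMod ℓ) :
    smartTwo^[3 ^ (k + 1)] (inflate^[k + 1] (s, [], p)) = inflate^[k + 1] (s, [], p + s.dir) := by
  have h3 : 3 ^ (k + 1) = 3 * 3 ^ k := by ring
  have : 0 < 3 ^ k := by positivity
  rw [Function.iterate_succ_apply, Function.iterate_succ_apply]
  refine smartTwo_iterate_inflate 3 0 _ _ _ ?_ ?_
  · cases s <;> simp [inflate, smartTwo, smartRule, Arrow.isRt, Arrow.dir]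
  · cases s <;> simp [inflate, smartTwo, smartRule, Arrow.isRt, durSum, dur] <;> omega

/-- The head in state `▶` moves to the cell following the next nonzero letter,
cyclically. -/
def jump {ℓ : ℕ} (a : Letter) (t : List Letter) (p : ZMod ℓ) : WConf ℓ :=
  (.rf, t.dropWhile (· = 0) ++ a :: t.takeWhile (· = 0),
    p + (t.takeWhile (· = 0)).length + 1)

/-- The configuration denoted by a partially decoded one: `k` digits of a counter with value `n`
have been separated from the word `a :: t`. -/
def sem {ℓ : ℕ} (k n : ℕ) (s : Arrow) (a : Letter) (t : List Letter) (p : ZMod ℓ) : WConf ℓ :=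
  match s, a with
  | .rf, 1 => if n = 3 ^ k - 1 then inflate^[k] (jump 1 t p)
    else smartTwo^[3 ^ k + n] (inflate^[k] (.lf, 0 :: t, p))
  | .rf, 2 => if n = 0 then inflate^[k] (jump 2 t p)
    else smartTwo^[n - 1] (inflate^[k] (.lh, 2 :: t, p))
  | .lh, 2 => smartTwo^[3 ^ k + n - 1] (inflate^[k] (.lh, 2 :: t, p))
  | s, a => smartTwo^[n] (inflate^[k] (s, a :: t, p))

/-- A variant of `sem` adapted to one more level of decoding. -/
def semPre {ℓ : ℕ} (k n : ℕ) (s : Arrow) (a : Letter) (t : List Letter) (p : ZMod ℓ) : WConf ℓ :=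
  match s, a with
  | .rf, 1 => smartTwo^[3 ^ k - 1 + n] (inflate^[k] (.lf, 0 :: t, p))
  | .lf, 0 => if n = 3 ^ k - 1 then inflate^[k] (jump 1 t p)
    else smartTwo^[n] (inflate^[k] (.lf, 0 :: t, p))
  | .rf, 2 => smartTwo^[n] (inflate^[k] (.lh, 2 :: t, p))
  | .lh, 2 => if n = 0 then inflate^[k] (jump 2 t p)
    else smartTwo^[3 ^ k - 1 + n] (inflate^[k] (.lh, 2 :: t, p))
  | s, a => smartTwo^[n] (inflate^[k] (s, a :: t, p))

/-- Exchange of head symbols at extreme counter values. -/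
def exch (top bot : Prop) [Decidable top] [Decidable bot] (s : Arrow) (a : Letter) :
    Arrow × Letter :=
  match s, a with
  | .lf, 0 => if top then (.rf, 1) else (.lf, 0)
  | .rf, 1 => if top then (.lf, 0) else (.rf, 1)
  | .lh, 2 => if bot then (.rf, 2) else (.lh, 2)
  | .rf, 2 => if bot then (.lh, 2) else (.rf, 2)
  | s, a => (s, a)

/-- The counter shift depending on the head symbol. -/
def shiftBy (N n : ℕ) : Arrow × Letter → ℕ
  | (.rf, 1) => (n + 1) % N
  | (.rf, 2) => (n + N - 1) % N
  | _ => n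

lemma letter_cases (a : Letter) : a = 0 ∨ a = 1 ∨ a = 2 := by
  revert a; decide

lemma semPre_exch {ℓ : ℕ} (k n : ℕ) (hn : n < 3 ^ (k + 1)) (s : Arrow) (a : Letter)
    (t : List Letter) (p : ZMod ℓ) :
    semPre (k + 1) (shiftBy (3 ^ (k + 1)) n (exch (n = 3 ^ (k + 1) - 1) (n = 0) s a))
      (exch (n = 3 ^ (k + 1) - 1) (n = 0) s a).1 (exch (n = 3 ^ (k + 1) - 1) (n = 0) s a).2 t p
      = sem (k + 1) n s a t p := by
  have h1 : 0 < 3 ^ k := by positivity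
  have h3 : 3 ^ (k + 1) = 3 * 3 ^ k := by ring
  have m1 : n ≠ 3 ^ (k + 1) - 1 → (n + 1) % 3 ^ (k + 1) = n + 1 :=
    fun h => Nat.mod_eq_of_lt (by omega)
  have m2 : n = 3 ^ (k + 1) - 1 → (n + 1) % 3 ^ (k + 1) = 0 := by
    rintro rfl; rw [Nat.sub_add_cancel (by omega), Nat.mod_self]
  have m3 : n ≠ 0 → (n + 3 ^ (k + 1) - 1) % 3 ^ (k + 1) = n - 1 := fun h => by
    rw [show n + 3 ^ (k + 1) - 1 = n - 1 + 3 ^ (k + 1) by omega, Nat.add_mod_right,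
      Nat.mod_eq_of_lt (by omega)]
  have m4 : n = 0 → (n + 3 ^ (k + 1) - 1) % 3 ^ (k + 1) = 3 ^ (k + 1) - 1 := by
    rintro rfl; rw [zero_add, Nat.mod_eq_of_lt (by omega)]
  generalize hN : 3 ^ (k + 1) = N at *
  cases s <;> rcases letter_cases a with rfl | rfl | rfl
  · simp [exch, shiftBy, sem, semPre]
  · by_cases h : n = N - 1
    · simp only [exch, shiftBy, sem, semPre, hN, h, ↓reduceIte, Fin.isValue]
    · simp only [exch, shiftBy, sem, semPre, hN, h, if_false, m1 h, Fin.isValue]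
      simp only [show N - 1 + (n + 1) = N + n by omega]
  · by_cases h : n = 0
    · simp only [exch, shiftBy, sem, semPre, h, ↓reduceIte, Fin.isValue]
    · simp only [exch, shiftBy, sem, semPre, h, if_false, m3 h, Fin.isValue]
  · by_cases h : n = N - 1
    · have := m2 h
      simp only [exch, shiftBy, sem, semPre, hN, if_pos h, this, Fin.isValue, add_zero]
      rw [h]
    · simp only [exch, shiftBy, sem, semPre, hN, if_neg h, Fin.isValue]
  · simp [exch, shiftBy, sem, semPre]
  · simp [exch, shiftBy, sem, semPre]
  · simp [exch, shiftBy, sem, semPre]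
  · simp [exch, shiftBy, sem, semPre]
  · simp [exch, shiftBy, sem, semPre]
  · simp [exch, shiftBy, sem, semPre]
  · simp [exch, shiftBy, sem, semPre]
  · by_cases h : n = 0
    · have := m4 h
      simp only [exch, shiftBy, sem, semPre, hN, if_pos h, this, Fin.isValue]
      rw [h, add_zero]
    · simp only [exch, shiftBy, sem, semPre, hN, if_neg h, Fin.isValue]
      simp only [show N - 1 + n = N + n - 1 by omega]

/-- One level of decoding: head state, letter at the front, leading digit are turned into
a state, two letters, and whether the head is on the second one. -/
def decode : Arrow → Letter → Letter → Arrow × Letter × Letter × Bool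
  | .rf, 0, 0 => (.rf, 0, 0, true)
  | .rf, 0, 1 => (.lf, 0, 1, false)
  | .rf, 0, 2 => (.rf, 1, 1, false)
  | .rf, 1, 0 => (.rf, 1, 0, true)
  | .rf, 1, 1 => (.lf, 1, 1, false)
  | .rf, 1, 2 => (.rh, 1, 1, true)
  | .rf, 2, 0 => (.lh, 2, 0, true)
  | .rf, 2, 1 => (.lf, 2, 2, false)
  | .rf, 2, 2 => (.rh, 2, 2, true)
  | .rh, 0, 0 => (.rf, 2, 0, true)
  | .rh, 0, 1 => (.lf, 2, 1, false)
  | .rh, 0, 2 => (.rh, 2, 1, true)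
  | .rh, 1, 0 => (.rf, 2, 1, false)
  | .rh, 1, 1 => (.lh, 2, 1, false)
  | .rh, 1, 2 => (.rh, 0, 1, true)
  | .rh, 2, 0 => (.rf, 2, 2, false)
  | .rh, 2, 1 => (.lh, 2, 2, false)
  | .rh, 2, 2 => (.rh, 0, 2, true)
  | .lf, 0, 0 => (.lh, 0, 1, true)
  | .lf, 0, 1 => (.lf, 0, 0, false)
  | .lf, 0, 2 => (.rf, 1, 0, false)
  | .lf, 1, 0 => (.lh, 1, 1, true)
  | .lf, 1, 1 => (.lf, 1, 0, false)
  | .lf, 1, 2 => (.rh, 1, 0, true)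
  | .lf, 2, 0 => (.lh, 2, 1, true)
  | .lf, 2, 1 => (.lf, 2, 0, false)
  | .lf, 2, 2 => (.rh, 2, 0, true)
  | .lh, 0, 0 => (.lh, 0, 0, true)
  | .lh, 0, 1 => (.lf, 0, 2, false)
  | .lh, 0, 2 => (.rf, 1, 2, false)
  | .lh, 1, 0 => (.lh, 1, 0, true)
  | .lh, 1, 1 => (.lf, 1, 2, false)
  | .lh, 1, 2 => (.rh, 1, 2, true)
  | .lh, 2, 0 => (.rf, 2, 0, false)
  | .lh, 2, 1 => (.lh, 2, 0, false)
  | .lh, 2, 2 => (.rh, 0, 0, true)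

/-- `sem` of a decoded configuration. -/
def semDecoded {ℓ : ℕ} (k n : ℕ) (t : List Letter) (p : ZMod ℓ) :
    Arrow × Letter × Letter × Bool → WConf ℓ
  | (s, a, b, true) => sem k n s b (t ++ [a]) (p + 1)
  | (s, a, b, false) => sem k n s a (b :: t) p

lemma inflate_jump {ℓ : ℕ} (a : Letter) (t : List Letter) (p : ZMod ℓ) :
    inflate (jump a t p) = jump a (0 :: t) p := by
  have h : t.takeWhile (· = 0) = List.replicate (t.takeWhile (· = 0)).length 0 :=
    List.eq_replicate_of_mem fun b hb => by simpa using List.mem_takeWhile_imp hb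
  have h' : t.takeWhile (· = 0) ++ [0] = 0 :: t.takeWhile (· = 0) := by
    rw [h, ← List.replicate_succ', List.replicate_succ]
  simp [jump, inflate, h']
  ring

lemma semPre_eq_semDecoded {ℓ : ℕ} (k n : ℕ) (hn : n < 3 ^ k) (s : Arrow) (a d : Letter)
    (t : List Letter) (p : ZMod ℓ) :
    semPre (k + 1) (n + 3 ^ k * d) s a t p = semDecoded k n t p (decode s a d) := by
  have h0 : 0 < 3 ^ k := by positivity
  have h3 : 3 ^ (k + 1) = 3 * 3 ^ k := by ring
  have key : ∀ (m n e : ℕ) (w w' : WConf ℓ), smartTwo^[m] w = w' → e = n + durSum k m w →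
    smartTwo^[e] (inflate^[k] w) = smartTwo^[n] (inflate^[k] w') := smartTwo_iterate_inflate
  have key' : ∀ (m e : ℕ) (w w' : WConf ℓ), smartTwo^[m] w = w' → e = durSum k m w →
      smartTwo^[e] (inflate^[k] w) = inflate^[k] w' := fun m e w w' h h' =>
    smartTwo_iterate_inflate m 0 e w w' h (by simpa using h')
  generalize hN : 3 ^ k = N at *
  cases s <;> fin_cases a <;> fin_cases d <;>
  simp [decode, semDecoded, sem, semPre, hN, h3, inflate_jump] <;>
  (try simp only [inflate]) <;>
  (try split_ifs) <;>
  first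
  | rfl
  | (exfalso; omega)
  | (refine key 1 _ _ _ _ ?_ ?_
     · simp [smartTwo, smartRule, Arrow.isRt, jump]
     · simp [smartTwo, smartRule, Arrow.isRt, durSum, dur, hN] <;> omega)
  | (refine key 2 _ _ _ _ ?_ ?_
     · simp [smartTwo, smartRule, Arrow.isRt, jump]
     · simp [smartTwo, smartRule, Arrow.isRt, durSum, dur, hN] <;> omega)
  | (refine key 3 _ _ _ _ ?_ ?_
     · simp [smartTwo, smartRule, Arrow.isRt, jump]
     · simp [smartTwo, smartRule, Arrow.isRt, durSum, dur, hN] <;> omega)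
  | (refine key' 0 _ _ _ ?_ ?_
     · simp [smartTwo, smartRule, Arrow.isRt, jump]
     · simp [smartTwo, smartRule, Arrow.isRt, durSum, dur, hN] <;> omega)
  | (refine key' 2 _ _ _ ?_ ?_
     · simp [smartTwo, smartRule, Arrow.isRt, jump]
     · simp [smartTwo, smartRule, Arrow.isRt, durSum, dur, hN] <;> omega)
  | (refine key 4 _ _ _ _ ?_ ?_
     · simp [smartTwo, smartRule, Arrow.isRt, jump]
     · simp [smartTwo, smartRule, Arrow.isRt, durSum, dur, hN] <;> omega)

/-- The last level of decoding, where no letter is left: state, letter, and whether the head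
is displaced. -/
def decodeLast : Arrow → Letter → Arrow × Letter × Bool
  | .rf, 0 => (.rf, 0, true)
  | .rf, 1 => (.lf, 1, false)
  | .rf, 2 => (.rh, 1, true)
  | .rh, 0 => (.rf, 2, false)
  | .rh, 1 => (.lh, 2, false)
  | .rh, 2 => (.rh, 0, true)
  | .lf, 0 => (.lh, 1, true)
  | .lf, 1 => (.lf, 0, false)
  | .lf, 2 => (.rf, 1, false)
  | .lh, 0 => (.lh, 0, true)
  | .lh, 1 => (.lf, 2, false)
  | .lh, 2 => (.rh, 2, true)

lemma smartTwo_iterate_inflate_eq_sem {ℓ : ℕ} (k n : ℕ) (hn : n < 3 ^ k) (s : Arrow)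
    (d : Letter) (p : ZMod ℓ) :
    smartTwo^[n + 3 ^ k * d] (inflate^[k + 1] (s, [], p)) =
      sem k n (decodeLast s d).1 (decodeLast s d).2.1 []
        (if (decodeLast s d).2.2 then p + 1 else p) := by
  have h0 : 0 < 3 ^ k := by positivity
  have key : ∀ (m n e : ℕ) (w w' : WConf ℓ), smartTwo^[m] w = w' → e = n + durSum k m w →
    smartTwo^[e] (inflate^[k] w) = smartTwo^[n] (inflate^[k] w') := smartTwo_iterate_inflate
  have key' : ∀ (m e : ℕ) (w w' : WConf ℓ), smartTwo^[m] w = w' → e = durSum k m w →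
      smartTwo^[e] (inflate^[k] w) = inflate^[k] w' := fun m e w w' h h' =>
    smartTwo_iterate_inflate m 0 e w w' h (by simpa using h')
  generalize hN : 3 ^ k = N at *
  cases s <;> fin_cases d <;>
  simp [decodeLast, sem, hN] <;>
  (try simp only [inflate]) <;>
  (try split_ifs) <;>
  first
  | rfl
  | (exfalso; omega)
  | (refine key 1 _ _ _ _ ?_ ?_
     · simp [smartTwo, smartRule, Arrow.isRt]
     · simp [smartTwo, smartRule, Arrow.isRt, durSum, dur, hN] <;> omega)
  | (refine key 2 _ _ _ _ ?_ ?_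
     · simp [smartTwo, smartRule, Arrow.isRt]
     · simp [smartTwo, smartRule, Arrow.isRt, durSum, dur, hN] <;> omega)
  | (refine key' 0 _ _ _ ?_ ?_
     · simp [jump]
     · simp [durSum] <;> omega)
  | (refine key' 2 _ _ _ ?_ ?_
     · simp [smartTwo, smartRule, Arrow.isRt, jump]
     · simp [smartTwo, smartRule, Arrow.isRt, durSum, dur, hN] <;> omega)

/-! ### Word length bounds -/

/-- `f` is a product of at most `n` elements of `F ∪ F⁻¹`. -/
def Cost {G : Type*} [Group G] (F : Set G) (f : G) (n : ℕ) : Prop :=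
  ∃ w : List G, w.length ≤ n ∧ (∀ x ∈ w, x ∈ F ∨ x⁻¹ ∈ F) ∧ w.prod = f

namespace Cost

variable {G : Type*} [Group G] {F : Set G} {f g : G} {m n : ℕ}

lemma mono (h : Cost F f m) (hmn : m ≤ n) : Cost F f n := by
  obtain ⟨w, h1, h2⟩ := h
  exact ⟨w, h1.trans hmn, h2⟩

lemma one : Cost F 1 0 := ⟨[], by simp⟩

lemma of_mem (h : f ∈ F) : Cost F f 1 := ⟨[f], by simp [h]⟩

lemma mul (hf : Cost F f m) (hg : Cost F g n) : Cost F (f * g) (m + n) := by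
  obtain ⟨w, h1, h2, h3⟩ := hf
  obtain ⟨v, k1, k2, k3⟩ := hg
  refine ⟨w ++ v, by simp; omega, fun x hx => ?_, by simp [h3, k3]⟩
  rcases List.mem_append.1 hx with h | h
  exacts [h2 x h, k2 x h]

lemma inv (hf : Cost F f m) : Cost F f⁻¹ m := by
  obtain ⟨w, h1, h2, h3⟩ := hf
  refine ⟨(w.map (·⁻¹)).reverse, by simpa using h1, fun x hx => ?_, ?_⟩
  · have hx' : x⁻¹ ∈ w := by simpa using hx
    simpa [or_comm] using h2 _ hx'
  · rw [← h3, List.prod_inv_reverse]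

lemma pow (hf : Cost F f m) (n : ℕ) : Cost F (f ^ n) (n * m) := by
  induction n with
  | zero => simpa using one
  | succ n ih => rw [pow_succ, Nat.succ_mul]; exact ih.mul hf

lemma conj (hg : Cost F g n) (hf : Cost F f m) : Cost F (g * f * g⁻¹) (m + 2 * n) :=
  ((hg.mul hf).mul hg.inv).mono (by omega)

lemma commutator (hf : Cost F f m) (hg : Cost F g n) : Cost F (f * g * f⁻¹ * g⁻¹) (2 * m + 2 * n) :=
  (((hf.mul hg).mul hf.inv).mul hg.inv).mono (by omega)

lemma mem_closure (hf : Cost F f m) : f ∈ Subgroup.closure F := by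
  obtain ⟨w, -, h2, rfl⟩ := hf
  refine Subgroup.list_prod_mem _ fun x hx => ?_
  rcases h2 x hx with h | h
  · exact Subgroup.subset_closure h
  · exact inv_mem_iff.1 (Subgroup.subset_closure h)

lemma wordNorm_le (hf : Cost F f m) : wordNorm F f ≤ m := by
  obtain ⟨w, h1, h2⟩ := hf
  refine le_trans (Nat.sInf_le ?_) h1
  exact ⟨w, rfl, h2⟩

end Cost

/-! ### Configurations seen from the head -/

/-- A head state, the tape relative to the head, and the head position. -/
abbrev Conf (Q : Type) (ℓ : ℕ) : Type := Q × (ZMod ℓ → Letter) × ZMod ℓ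

open Classical in
/-- Change of the state depending on the tape. -/
noncomputable def ctl {Q : Type} {ℓ : ℕ} (D : Set (ZMod ℓ → Letter)) :
    Equiv.Perm Q →* Equiv.Perm (Conf Q ℓ) :=
  MonoidHom.toHomPerm
    { toFun := fun σ x => if x.2.1 ∈ D then (σ x.1, x.2) else x
      map_one' := by funext x; simp; rfl
      map_mul' := fun σ τ => by
        funext x
        change _ = (fun x : Conf Q ℓ => if x.2.1 ∈ D then (σ x.1, x.2) else x)
          (if x.2.1 ∈ D then (τ x.1, x.2) else x)
        by_cases h : x.2.1 ∈ D <;> simp [h] }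

open Classical in
lemma ctl_apply {Q : Type} {ℓ : ℕ} (D : Set (ZMod ℓ → Letter)) (σ : Equiv.Perm Q) (x : Conf Q ℓ) :
    ctl D σ x = if x.2.1 ∈ D then (σ x.1, x.2) else x := rfl

/-- The action of a permutation of the head symbols. -/
def uni {Q : Type} {ℓ : ℕ} : Equiv.Perm (Q × Letter) →* Equiv.Perm (Conf Q ℓ) :=
  MonoidHom.toHomPerm
    { toFun := fun g x =>
        ((g (x.1, x.2.1 0)).1, Function.update x.2.1 0 (g (x.1, x.2.1 0)).2, x.2.2)
      map_one' := by funext x; simp; rfl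
      map_mul' := fun σ τ => by
        funext x
        change _ = (fun x : Conf Q ℓ =>
          ((σ (x.1, x.2.1 0)).1, Function.update x.2.1 0 (σ (x.1, x.2.1 0)).2, x.2.2))
          ((τ (x.1, x.2.1 0)).1, Function.update x.2.1 0 (τ (x.1, x.2.1 0)).2, x.2.2)
        simp }

lemma uni_apply {Q : Type} {ℓ : ℕ} (g : Equiv.Perm (Q × Letter)) (x : Conf Q ℓ) :
    uni g x = ((g (x.1, x.2.1 0)).1, Function.update x.2.1 0 (g (x.1, x.2.1 0)).2, x.2.2) := rfl

/-- Right moves of the heads whose state is in `F`. -/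
def mvs {Q : Type} {ℓ : ℕ} (F : Q → Bool) : Equiv.Perm (Conf Q ℓ) where
  toFun x := if F x.1 then (x.1, fun i => x.2.1 (i + 1), x.2.2 + 1) else x
  invFun x := if F x.1 then (x.1, fun i => x.2.1 (i - 1), x.2.2 - 1) else x
  left_inv x := by by_cases h : F x.1 <;> simp [h]
  right_inv x := by by_cases h : F x.1 <;> simp [h]

lemma mvs_apply {Q : Type} {ℓ : ℕ} (F : Q → Bool) (x : Conf Q ℓ) :
    mvs F x = if F x.1 then (x.1, fun i => x.2.1 (i + 1), x.2.2 + 1) else x := rfl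

lemma mvs_inv_apply {Q : Type} {ℓ : ℕ} (F : Q → Bool) (x : Conf Q ℓ) :
    (mvs F)⁻¹ x = if F x.1 then (x.1, fun i => x.2.1 (i - 1), x.2.2 - 1) else x := rfl

lemma mvs_pow_apply {Q : Type} {ℓ : ℕ} (F : Q → Bool) (n : ℕ) (x : Conf Q ℓ) :
    (mvs F ^ n) x = if F x.1 then (x.1, fun i => x.2.1 (i + n), x.2.2 + n) else x := by
  induction n with
  | zero => simp
  | succ n ih =>
    rw [pow_succ', Equiv.Perm.mul_apply, ih, mvs_apply]
    by_cases h : F x.1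
    · simp only [h, if_true]
      push_cast
      simp only [add_assoc, add_comm (1 : ZMod ℓ)]
    · simp [h]

lemma mvs_pow_inv_apply {Q : Type} {ℓ : ℕ} (F : Q → Bool) (n : ℕ) (x : Conf Q ℓ) :
    (mvs F ^ n)⁻¹ x = if F x.1 then (x.1, fun i => x.2.1 (i - n), x.2.2 - n) else x := by
  rw [Equiv.Perm.inv_eq_iff_eq, mvs_pow_apply]
  by_cases h : F x.1 <;> simp [h]

lemma mvs_or {Q : Type} {ℓ : ℕ} (F F' : Q → Bool) (h : ∀ q, F q → F' q = false) :
    mvs (ℓ := ℓ) (fun q => F q || F' q) = mvs F * mvs F' := by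
  ext1 x
  rw [Equiv.Perm.mul_apply, mvs_apply, mvs_apply, mvs_apply]
  cases h1 : F x.1 <;> cases h2 : F' x.1 <;> simp_all

/-! ### The link with cyclic configurations -/

/-- The cyclic configuration described by a relative one. -/
def Conf.toC {ℓ : ℕ} : Conf DQ ℓ ↪ CConf DQ Letter ℓ where
  toFun x := ⟨fun i => if i = x.2.2 then Sum.inr (x.1, x.2.1 0) else Sum.inl (x.2.1 (i - x.2.2)), by
    intro i j hi hj
    by_cases h : i = x.2.2 <;> by_cases h' : j = x.2.2 <;> simp_all⟩
  inj' x y h := by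
    obtain ⟨q, r, p⟩ := x
    obtain ⟨q', r', p'⟩ := y
    have h := congrArg Subtype.val h
    have hp := congrFun h p
    have hpp : p = p' := by by_contra hne; simp [hne] at hp
    subst hpp
    have hq : q = q' ∧ r 0 = r' 0 := by simpa using hp
    refine Prod.ext hq.1 (Prod.ext (funext fun i => ?_) rfl)
    by_cases hi : i = 0
    · rw [hi]; exact hq.2
    · simpa [hi] using congrFun h (p + i)

lemma Conf.toC_apply {ℓ : ℕ} (x : Conf DQ ℓ) (i : ZMod ℓ) :
    (Conf.toC x).1 i =
      if i = x.2.2 then Sum.inr (x.1, x.2.1 0) else Sum.inl (x.2.1 (i - x.2.2)) := rfl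

lemma Conf.toC_eq_of_apply_eq_inr {ℓ : ℕ} (w : CConf DQ Letter ℓ) (i : ZMod ℓ) (q : DQ) (a : Letter)
    (h : w.1 i = Sum.inr (q, a)) :
    Conf.toC (q, fun j => tapeLetter (w.1 (i + j)), i) = w := by
  apply Subtype.ext
  funext j
  rw [Conf.toC_apply]
  by_cases hj : j = i
  · subst hj; simp [h, tapeLetter]
  · rcases hw : w.1 j with b | b
    · simp [hj, hw, tapeLetter]
    · exact absurd (w.2 j i (by simp [hw]) (by simp [h])) hj

/-- The action of permutations of relative configurations on cyclic configurations. -/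
noncomputable def liftC {ℓ : ℕ} : Equiv.Perm (Conf DQ ℓ) →* Equiv.Perm (CConf DQ Letter ℓ) :=
  Equiv.Perm.viaEmbeddingHom Conf.toC

lemma liftC_toC {ℓ : ℕ} (f : Equiv.Perm (Conf DQ ℓ)) (x : Conf DQ ℓ) :
    liftC f (Conf.toC x) = Conf.toC (f x) :=
  Equiv.Perm.viaEmbedding_apply f Conf.toC x

lemma liftC_of_forall_ne {ℓ : ℕ} (f : Equiv.Perm (Conf DQ ℓ)) (w : CConf DQ Letter ℓ)
    (h : ∀ i y, w.1 i ≠ Sum.inr y) : liftC f w = w := by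
  refine Equiv.Perm.viaEmbedding_apply_of_notMem f Conf.toC w ?_
  rintro ⟨x, rfl⟩
  exact h x.2.2 (x.1, x.2.1 0) (by simp [Conf.toC_apply])

lemma headless_or_toC {ℓ : ℕ} (w : CConf DQ Letter ℓ) :
    (∀ i y, w.1 i ≠ Sum.inr y) ∨ ∃ x, w = Conf.toC x := by
  by_cases h : ∀ i y, w.1 i ≠ Sum.inr y
  · exact Or.inl h
  · push Not at h
    obtain ⟨i, y, hy⟩ := h
    exact Or.inr ⟨_, (Conf.toC_eq_of_apply_eq_inr w i y.1 y.2 hy).symm⟩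

lemma isUnaryGate_uni {ℓ : ℕ} (g : Equiv.Perm (DQ × Letter)) :
    IsUnaryGate (ℓ := ℓ) g (liftC (uni g)) := by
  intro w i
  rcases headless_or_toC w with h | ⟨x, rfl⟩
  · rw [liftC_of_forall_ne _ _ h]
    rcases hw : w.1 i with b | b
    · rfl
    · exact absurd hw (h i b)
  · rw [liftC_toC, Conf.toC_apply, Conf.toC_apply, uni_apply]
    by_cases hi : i = x.2.2
    · simp [hi, gateApply]
    · have : i - x.2.2 ≠ 0 := sub_ne_zero.2 hi
      simp [hi, gateApply, this]

lemma isMoveGate_mvs {ℓ : ℕ} [Fact (1 < ℓ)] (q : DQ) :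
    IsMoveGate (ℓ := ℓ) q (liftC (mvs fun q' => decide (q' = q))) := by
  intro w
  rcases headless_or_toC w with h | ⟨⟨q', r, p⟩, rfl⟩
  · exact ⟨fun _ => liftC_of_forall_ne _ _ h, fun i a hi => absurd hi (h i _)⟩
  · rw [liftC_toC, mvs_apply]
    refine ⟨fun h => ?_, fun i a hi j => ?_⟩
    · have : q' ≠ q := by
        rintro rfl
        exact h p (r 0) (by simp [Conf.toC_apply])
      simp [this]
    · rw [Conf.toC_apply] at hi
      by_cases hp : i = p
      · subst hp
        obtain ⟨rfl, rfl⟩ : q' = q ∧ r 0 = a := by simpa using hi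
        have h1 : ∀ k, j - (i + 1) + k = j - i + (k - 1) := fun k => by ring
        simp only [Conf.toC_apply, decide_true, if_true, h1]
        by_cases hj : j = i + 1
        · simp [hj, tapeLetter]
        · by_cases hj' : j = i <;> simp [hj, hj']
      · simp [hp] at hi

instance : Fintype Arrow := ⟨{.rf, .lf, .rh, .lh}, by intro s; cases s <;> decide⟩

/-! ### Elementary costs -/

/-- The permutations of relative configurations that induce generators. -/
def confGens (ℓ : ℕ) : Set (Equiv.Perm (Conf DQ ℓ)) := {f | liftC f ∈ TMGens DQ Letter ℓ}

lemma Cost.liftC {ℓ n : ℕ} {f : Equiv.Perm (Conf DQ ℓ)} (h : Cost (confGens ℓ) f n) :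
    Cost (TMGens DQ Letter ℓ) (liftC f) n := by
  obtain ⟨w, h1, h2, rfl⟩ := h
  refine ⟨w.map _root_.liftC, by simpa using h1, ?_, by rw [map_list_prod]⟩
  intro x hx
  obtain ⟨y, hy, rfl⟩ := List.mem_map.1 hx
  simpa [confGens] using h2 y hy

lemma cost_uni {ℓ : ℕ} (g : Equiv.Perm (DQ × Letter)) : Cost (confGens ℓ) (uni g) 1 :=
  Cost.of_mem (Or.inl ⟨g, isUnaryGate_uni g⟩)

lemma cost_mvs_mem {ℓ : ℕ} [Fact (1 < ℓ)] (l : List DQ) (hl : l.Nodup) :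
    Cost (confGens ℓ) (mvs fun q => decide (q ∈ l)) l.length := by
  induction l with
  | nil =>
    have : mvs (ℓ := ℓ) (fun q : DQ => decide (q ∈ [])) = 1 := by
      ext1 x; simp [mvs_apply]
    rw [this]; exact Cost.one
  | cons a l ih =>
    rw [List.nodup_cons] at hl
    have h : mvs (ℓ := ℓ) (fun q => decide (q ∈ a :: l)) =
        mvs (fun q => decide (q = a)) * mvs (fun q => decide (q ∈ l)) := by
      rw [← mvs_or]
      · simp
      · intro q hq
        have : q = a := by simpa using hq
        simp [this, hl.1]
    rw [h, List.length_cons, add_comm]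
    exact (Cost.of_mem (F := confGens ℓ) (Or.inr ⟨a, isMoveGate_mvs a⟩)).mul (ih hl.2)

lemma cost_mvs {ℓ : ℕ} [Fact (1 < ℓ)] (F : DQ → Bool) : Cost (confGens ℓ) (mvs F) 96 := by
  have h := cost_mvs_mem (ℓ := ℓ) (Finset.univ.filter fun q => F q = true).toList
    (Finset.nodup_toList _)
  have hF : (fun q => decide (q ∈ (Finset.univ.filter fun q => F q = true).toList)) = F := by
    funext q; simp
  rw [hF] at h
  refine h.mono ?_
  rw [Finset.length_toList]
  exact (Finset.card_le_univ _).trans (by decide)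

/-! ### Controlled state changes -/

section Controlled

variable {ℓ : ℕ} {Q : Type}

lemma ctl_univ (σ : Equiv.Perm Q) :
    ctl (ℓ := ℓ) Set.univ σ = uni (σ.prodCongr (Equiv.refl Letter)) := by
  ext1 x
  simp [ctl_apply, uni_apply]

lemma ctl_conj_univ (D : Set (ZMod ℓ → Letter)) (σ τ : Equiv.Perm Q) :
    ctl Set.univ τ * ctl D σ * (ctl Set.univ τ)⁻¹ = ctl D (τ * σ * τ⁻¹) := by
  rw [← map_inv]
  ext1 x
  simp only [Equiv.Perm.mul_apply, ctl_apply]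
  by_cases h : x.2.1 ∈ D <;> simp [h]

lemma ctl_commutator (D D' : Set (ZMod ℓ → Letter)) (σ τ : Equiv.Perm Q) :
    ctl D σ * ctl D' τ * (ctl D σ)⁻¹ * (ctl D' τ)⁻¹ = ctl (D ∩ D') (σ * τ * σ⁻¹ * τ⁻¹) := by
  rw [← map_inv, ← map_inv]
  ext1 x
  simp only [Equiv.Perm.mul_apply, ctl_apply]
  by_cases h : x.2.1 ∈ D <;> by_cases h' : x.2.1 ∈ D' <;> simp [h, h']

lemma ctl_shift (D : Set (ZMod ℓ → Letter)) (σ : Equiv.Perm Q) (j : ℕ) :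
    (mvs (fun _ => true) ^ j)⁻¹ * ctl D σ * mvs (fun _ => true) ^ j =
      ctl {r : ZMod ℓ → Letter | (fun i => r (i + j)) ∈ D} σ := by
  ext1 x
  simp only [Equiv.Perm.mul_apply, mvs_pow_apply, mvs_pow_inv_apply, ctl_apply]
  by_cases h : (fun i => x.2.1 (i + j)) ∈ D <;> simp [h]

lemma ctl_letter (c : Letter) (σ : Equiv.Perm Q) :
    ∃ g : Equiv.Perm (Q × Letter), ctl (ℓ := ℓ) {r | r 0 = c} σ = uni g := by
  refine ⟨⟨fun y => if y.2 = c then (σ y.1, y.2) else y,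
    fun y => if y.2 = c then (σ⁻¹ y.1, y.2) else y, ?_, ?_⟩, ?_⟩
  · rintro ⟨y, b⟩; by_cases h : b = c <;> simp [h]
  · rintro ⟨y, b⟩; by_cases h : b = c <;> simp [h]
  · ext1 x
    by_cases h : x.2.1 0 = c <;> simp [ctl_apply, uni_apply, h]
    rw [← h]; simp

end Controlled

/-- The action of ghost permutations on the states. -/
def ghost : Equiv.Perm (Fin 6) →* Equiv.Perm DQ :=
  MonoidHom.toHomPerm
    { toFun := fun g q => (q.1, q.2.1, g q.2.2)
      map_one' := rfl
      map_mul' := fun _ _ => rfl }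

lemma ghost_apply (g : Equiv.Perm (Fin 6)) (q : DQ) : ghost g q = (q.1, q.2.1, g q.2.2) := rfl

/-- A three-cycle of the ghost. -/
def ghostCycle : Equiv.Perm (Fin 6) := Equiv.swap 0 1 * Equiv.swap 1 2

lemma ghostCycle_eq :
    (Equiv.swap 2 3 * ghostCycle * (Equiv.swap 2 3)⁻¹) *
      ((Equiv.swap 1 2 * Equiv.swap 2 4) * ghostCycle * (Equiv.swap 1 2 * Equiv.swap 2 4)⁻¹) *
      (Equiv.swap 2 3 * ghostCycle * (Equiv.swap 2 3)⁻¹)⁻¹ *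
      ((Equiv.swap 1 2 * Equiv.swap 2 4) * ghostCycle * (Equiv.swap 1 2 * Equiv.swap 2 4)⁻¹)⁻¹
      = ghostCycle := by
  decide

lemma cost_ctl_univ {ℓ : ℕ} (σ : Equiv.Perm DQ) : Cost (confGens ℓ) (ctl Set.univ σ) 1 := by
  rw [ctl_univ]; exact cost_uni _

lemma cost_ctl_inter {ℓ m n : ℕ} {D D' : Set (ZMod ℓ → Letter)}
    (h : Cost (confGens ℓ) (ctl D (ghost ghostCycle)) m)
    (h' : Cost (confGens ℓ) (ctl D' (ghost ghostCycle)) n) :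
    Cost (confGens ℓ) (ctl (D ∩ D') (ghost ghostCycle)) (2 * m + 2 * n + 8) := by
  have h1 := (cost_ctl_univ (ℓ := ℓ) (ghost (Equiv.swap 2 3))).conj h
  have h2 := (cost_ctl_univ (ℓ := ℓ) (ghost (Equiv.swap 1 2 * Equiv.swap 2 4))).conj h'
  have h3 := h1.commutator h2
  rw [ctl_conj_univ, ctl_conj_univ, ctl_commutator] at h3
  simp only [← map_mul, ← map_inv] at h3
  rw [ghostCycle_eq] at h3
  exact h3.mono (by omega)

lemma cost_ctl_shift {ℓ m : ℕ} [Fact (1 < ℓ)] {D : Set (ZMod ℓ → Letter)} {σ : Equiv.Perm DQ}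
    (h : Cost (confGens ℓ) (ctl D σ) m) (j : ℕ) :
    Cost (confGens ℓ) (ctl {r : ZMod ℓ → Letter | (fun i => r (i + j)) ∈ D} σ) (m + 192 * j) := by
  rw [← ctl_shift]
  exact (((cost_mvs _).pow j).inv.mul h |>.mul ((cost_mvs _).pow j)).mono (by omega)

/-- The tapes whose cells with relative positions in `[a, b)` carry the letter `c`. -/
def cellsEq {ℓ : ℕ} (a b : ℕ) (c : Letter) : Set (ZMod ℓ → Letter) :=
  {r | ∀ i : ℕ, a ≤ i → i < b → r i = c}

lemma cellsEq_shift {ℓ : ℕ} (a b j : ℕ) (c : Letter) :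
    {r : ZMod ℓ → Letter | (fun i => r (i + j)) ∈ cellsEq a b c} =
      cellsEq (a + j) (b + j) c := by
  ext r
  constructor
  · intro h i hi hi'
    have := h (i - j) (by omega) (by omega)
    have hj : j ≤ i := by omega
    simpa [Nat.cast_sub hj] using this
  · intro h i hi hi'
    simpa using h (i + j) (by omega) (by omega)

lemma cellsEq_inter {ℓ : ℕ} {a b a' b' : ℕ} (h1 : a ≤ a') (h2 : a' ≤ b) (h3 : b ≤ b')
    (c : Letter) :
    (cellsEq a b c ∩ cellsEq a' b' c : Set (ZMod ℓ → Letter)) = cellsEq a b' c := by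
  ext r
  constructor
  · rintro ⟨h, h'⟩ i hi hi'
    by_cases hb : i < b
    · exact h i hi hb
    · exact h' i (by omega) hi'
  · intro h
    exact ⟨fun i _ _ => h i (by omega) (by omega), fun i _ _ => h i (by omega) (by omega)⟩

lemma cellsEq_of_le {ℓ : ℕ} {a b : ℕ} (h : b ≤ a) (c : Letter) :
    (cellsEq a b c : Set (ZMod ℓ → Letter)) = Set.univ := by
  ext r
  simp only [cellsEq, Set.mem_setOf_eq, Set.mem_univ, iff_true]
  intro i _ _
  omega

lemma cost_ctl_two_pow {ℓ : ℕ} [Fact (1 < ℓ)] (c : Letter) (n : ℕ) :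
    ∃ m, m + 196 * 2 ^ n ≤ 197 * 4 ^ n ∧
      Cost (confGens ℓ) (ctl (cellsEq 0 (2 ^ n) c) (ghost ghostCycle)) m := by
  induction n with
  | zero =>
    refine ⟨1, by norm_num, ?_⟩
    obtain ⟨g, hg⟩ := ctl_letter (ℓ := ℓ) c (ghost ghostCycle)
    have : (cellsEq 0 (2 ^ 0) c : Set (ZMod ℓ → Letter)) = {r | r 0 = c} := by
      ext r; simp [cellsEq]
    rw [this, hg]
    exact cost_uni g
  | succ n ih =>
    obtain ⟨m, hm, h⟩ := ih
    have h2 := cost_ctl_inter h (cost_ctl_shift h (2 ^ n))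
    rw [cellsEq_shift, cellsEq_inter (by omega) (by omega) (by omega)] at h2
    refine ⟨_, ?_, by rw [pow_succ, mul_two]; simpa using h2⟩
    have : 0 < 2 ^ n := by positivity
    rw [pow_succ, pow_succ]
    omega

lemma cost_ctl_cellsEq {ℓ : ℕ} [hℓ : Fact (1 < ℓ)] {a b : ℕ} (ha : a ≤ ℓ) (hb : b ≤ ℓ)
    (c : Letter) :
    Cost (confGens ℓ) (ctl (cellsEq a b c) (ghost ghostCycle)) (1400 * ℓ ^ 2) := by
  have hℓ := hℓ.1
  rcases Nat.lt_or_ge a b with hab | hab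
  · set m := b - a with hm
    have hm0 : m ≠ 0 := by omega
    set n := Nat.log 2 m
    have h1 : 2 ^ n ≤ m := Nat.pow_log_le_self 2 hm0
    have h2 : m < 2 ^ (n + 1) := Nat.lt_pow_succ_log_self (by norm_num) m
    obtain ⟨e, he, h⟩ := cost_ctl_two_pow (ℓ := ℓ) c n
    have h3 := cost_ctl_shift (cost_ctl_inter h (cost_ctl_shift h (m - 2 ^ n))) a
    have h4 : 2 ^ (n + 1) = 2 ^ n + 2 ^ n := by ring
    rw [cellsEq_shift, cellsEq_inter (by omega) (by omega) (by omega), cellsEq_shift] at h3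
    have e1 : 0 + a = a := by omega
    have e2 : 2 ^ n + (m - 2 ^ n) + a = b := by omega
    rw [e1, e2] at h3
    refine h3.mono ?_
    have h5 : 4 ^ n ≤ m ^ 2 := by
      rw [show 4 = 2 ^ 2 by norm_num, ← pow_mul, mul_comm, pow_mul]
      exact Nat.pow_le_pow_left h1 2
    have h6 : m ^ 2 ≤ ℓ ^ 2 := Nat.pow_le_pow_left (by omega) 2
    have h7 : 2 * ℓ ≤ ℓ ^ 2 := by nlinarith
    omega
  · rw [cellsEq_of_le hab]
    exact (cost_ctl_univ _).mono (by nlinarith)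

/-- The state changes whose controlled versions are as cheap as those of the ghost cycle. -/
def cheapStates : Subgroup (Equiv.Perm DQ) where
  carrier := {h | ∃ C : ℕ, ∀ (ℓ : ℕ) (D : Set (ZMod ℓ → Letter)) (n : ℕ),
    Cost (confGens ℓ) (ctl D (ghost ghostCycle)) n → Cost (confGens ℓ) (ctl D h) (C * (n + 1))}
  one_mem' := ⟨0, fun ℓ D n _ => by rw [map_one]; exact Cost.one.mono (Nat.zero_le _)⟩
  mul_mem' := by
    rintro f g ⟨C, hC⟩ ⟨C', hC'⟩
    refine ⟨C + C', fun ℓ D n h => ?_⟩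
    rw [map_mul, add_mul]
    exact (hC ℓ D n h).mul (hC' ℓ D n h)
  inv_mem' := by
    rintro f ⟨C, hC⟩
    refine ⟨C, fun ℓ D n h => ?_⟩
    rw [map_inv]
    exact (hC ℓ D n h).inv

instance : cheapStates.Normal where
  conj_mem := by
    rintro f ⟨C, hC⟩ g
    refine ⟨C + 2, fun ℓ D n h => ?_⟩
    rw [← ctl_conj_univ]
    exact ((cost_ctl_univ g).conj (hC ℓ D n h)).mono (by nlinarith)

lemma alternatingGroup_le_cheapStates : alternatingGroup DQ ≤ cheapStates := by
  refine Equiv.Perm.alternatingGroup_le_of_normal (by simp; decide) ?_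
  rw [Subgroup.nontrivial_iff_exists_ne_one]
  refine ⟨ghost ghostCycle, ⟨1, fun ℓ D n h => h.mono (by omega)⟩, fun h => ?_⟩
  have := DFunLike.congr_fun h ((Arrow.rf, 0), 0, 0)
  revert this
  decide

/-! ### The core: arrows in a matching state with duck zero -/

/-- The core permutations act on matching states with duck zero, for all ghosts. -/
def deco {α : Type} : Equiv.Perm (Arrow × α) →* Equiv.Perm (DQ × α) :=
  MonoidHom.toHomPerm
    { toFun := fun f x =>
        if x.1.1.2 = 0 ∧ x.1.2.1 = 0 then
          ((((f (x.1.1.1, x.2)).1, 0), 0, x.1.2.2), (f (x.1.1.1, x.2)).2)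
        else x
      map_one' := by
        funext x
        obtain ⟨⟨⟨s, i⟩, d, g⟩, y⟩ := x
        by_cases h : i = 0 ∧ d = 0
        · obtain ⟨rfl, rfl⟩ := h
          rfl
        · simp only [h, if_false]; rfl
      map_mul' := fun f g => by
        funext x
        change _ = (fun x : DQ × α => if x.1.1.2 = 0 ∧ x.1.2.1 = 0 then
          ((((f (x.1.1.1, x.2)).1, 0), 0, x.1.2.2), (f (x.1.1.1, x.2)).2) else x)
          (if x.1.1.2 = 0 ∧ x.1.2.1 = 0 then
          ((((g (x.1.1.1, x.2)).1, 0), 0, x.1.2.2), (g (x.1.1.1, x.2)).2) else x)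
        by_cases h : x.1.1.2 = 0 ∧ x.1.2.1 = 0 <;> simp [h] }

lemma deco_apply {α : Type} (f : Equiv.Perm (Arrow × α)) (x : DQ × α) :
    deco f x = if x.1.1.2 = 0 ∧ x.1.2.1 = 0 then
          ((((f (x.1.1.1, x.2)).1, 0), 0, x.1.2.2), (f (x.1.1.1, x.2)).2)
        else x := rfl

/-- The action of permutations of the arrows on the states with ghost in `g`. -/
def decoState (g : Fin 6 → Bool) : Equiv.Perm Arrow →* Equiv.Perm DQ :=
  MonoidHom.toHomPerm
    { toFun := fun σ q =>
        if q.1.2 = 0 ∧ q.2.1 = 0 ∧ g q.2.2 then ((σ q.1.1, 0), 0, q.2.2) else q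
      map_one' := by
        funext q
        obtain ⟨⟨s, i⟩, d, x⟩ := q
        by_cases h : i = 0 ∧ d = 0 ∧ g x
        · obtain ⟨rfl, rfl, hx⟩ := h
          simp only [hx, and_self, if_true]; rfl
        · simp only [h, if_false]; rfl
      map_mul' := fun σ τ => by
        funext q
        change _ = (fun q : DQ => if q.1.2 = 0 ∧ q.2.1 = 0 ∧ g q.2.2 then
            ((σ q.1.1, 0), 0, q.2.2) else q)
          (if q.1.2 = 0 ∧ q.2.1 = 0 ∧ g q.2.2 then ((τ q.1.1, 0), 0, q.2.2) else q)
        by_cases h : q.1.2 = 0 ∧ q.2.1 = 0 ∧ g q.2.2 <;> simp [h] }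

lemma decoState_apply (g : Fin 6 → Bool) (σ : Equiv.Perm Arrow) (q : DQ) :
    decoState g σ q =
      if q.1.2 = 0 ∧ q.2.1 = 0 ∧ g q.2.2 then ((σ q.1.1, 0), 0, q.2.2) else q := rfl

lemma decoState_mem_cheapStates (σ : Equiv.Perm Arrow) :
    decoState (fun _ => true) σ ∈ cheapStates := by
  apply alternatingGroup_le_cheapStates
  have hγ : Function.Involutive (fun x : Fin 6 => x + 3) := by
    intro x; revert x; decide
  have h : decoState (fun _ => true) σ = decoState (fun x => decide (x < 3)) σ *
      (ghost ((hγ.toPerm _)) * decoState (fun x => decide (x < 3)) σ *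
        (ghost ((hγ.toPerm _)))⁻¹) := by
    rw [← map_inv]
    ext1 q
    obtain ⟨⟨s, i⟩, d, x⟩ := q
    have e1 : (hγ.toPerm _)⁻¹ x = x + 3 := rfl
    have e2 : ∀ y, (hγ.toPerm _) y = y + 3 := fun _ => rfl
    have e3 : x + 3 + 3 = x := hγ x
    have e4 : x + 3 < 3 ↔ ¬ x < 3 := by clear * -; revert x; decide
    by_cases h : i = 0 ∧ d = 0
    · obtain ⟨rfl, rfl⟩ := h
      by_cases hx : x < 3 <;>
        simp [decoState_apply, ghost_apply, Equiv.Perm.mul_apply, e1, e2, e3, e4, hx, -map_inv]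
    · have h' : ∀ P, ¬ (i = 0 ∧ d = 0 ∧ P) := fun P hP => h ⟨hP.1, hP.2.1⟩
      simp [decoState_apply, ghost_apply, Equiv.Perm.mul_apply, e1, e2, e3, h', -map_inv]
      exact fun hi hd => absurd ⟨hi, hd⟩ h
  rw [Equiv.Perm.mem_alternatingGroup, h]
  simp only [map_mul, map_inv]
  rw [mul_comm (Equiv.Perm.sign (ghost _)), mul_inv_cancel_right, Int.units_mul_self]

lemma deco_ctl {ℓ : ℕ} (D : Set (ZMod ℓ → Letter)) (σ : Equiv.Perm Arrow) :
    deco (ctl D σ) = ctl D (decoState (fun _ => true) σ) := by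
  ext1 x
  obtain ⟨⟨⟨s, i⟩, d, g⟩, y⟩ := x
  by_cases h : y.1 ∈ D <;> by_cases h' : i = 0 ∧ d = 0 <;>
    simp [deco_apply, ctl_apply, decoState_apply, h, h']

lemma deco_uni {ℓ : ℕ} (g : Equiv.Perm (Arrow × Letter)) :
    deco (uni (ℓ := ℓ) g) = uni (deco g) := by
  ext1 x
  obtain ⟨⟨⟨s, i⟩, d, g⟩, y⟩ := x
  by_cases h' : i = 0 ∧ d = 0 <;> simp [deco_apply, uni_apply, h']

lemma deco_mvs {ℓ : ℕ} (F : Arrow → Bool) :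
    deco (mvs (ℓ := ℓ) F) = mvs (fun q => decide (q.1.2 = 0) && decide (q.2.1 = 0) && F q.1.1) := by
  ext1 x
  obtain ⟨⟨⟨s, i⟩, d, g⟩, y⟩ := x
  by_cases h' : i = 0 ∧ d = 0
  · obtain ⟨rfl, rfl⟩ := h'
    by_cases h : F s <;> simp [deco_apply, mvs_apply, h]
  · simp [deco_apply, mvs_apply, h']

/-- Cost of a permutation of the core. -/
def CoreCost {ℓ : ℕ} (f : Equiv.Perm (Conf Arrow ℓ)) (n : ℕ) : Prop :=
  Cost (confGens ℓ) (deco f) n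

namespace CoreCost

variable {ℓ m n : ℕ} {f g : Equiv.Perm (Conf Arrow ℓ)}

lemma mono (h : CoreCost f m) (hmn : m ≤ n) : CoreCost f n := Cost.mono h hmn

lemma one : CoreCost (1 : Equiv.Perm (Conf Arrow ℓ)) 0 := by
  unfold CoreCost
  rw [map_one]
  exact Cost.one

lemma mul (hf : CoreCost f m) (hg : CoreCost g n) : CoreCost (f * g) (m + n) := by
  unfold CoreCost
  rw [map_mul]
  exact Cost.mul hf hg

lemma inv (hf : CoreCost f m) : CoreCost f⁻¹ m := by
  unfold CoreCost
  rw [map_inv]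
  exact Cost.inv hf

lemma pow (hf : CoreCost f m) (n : ℕ) : CoreCost (f ^ n) (n * m) := by
  unfold CoreCost
  rw [map_pow]
  exact Cost.pow hf n

lemma conj (hg : CoreCost g n) (hf : CoreCost f m) : CoreCost (g * f * g⁻¹) (m + 2 * n) :=
  ((hg.mul hf).mul hg.inv).mono (by omega)

lemma uni (g : Equiv.Perm (Arrow × Letter)) : CoreCost (ℓ := ℓ) (uni g) 1 := by
  unfold CoreCost
  rw [deco_uni]
  exact cost_uni _

lemma mvs [Fact (1 < ℓ)] (F : Arrow → Bool) : CoreCost (ℓ := ℓ) (mvs F) 96 := by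
  unfold CoreCost
  rw [deco_mvs]
  exact cost_mvs _

end CoreCost

lemma exists_coreCost_ctl : ∃ C : ℕ, ∀ (σ : Equiv.Perm Arrow) (ℓ : ℕ)
    (D : Set (ZMod ℓ → Letter)) (n : ℕ), Cost (confGens ℓ) (ctl D (ghost ghostCycle)) n →
    CoreCost (ctl D σ) (C * (n + 1)) := by
  choose C hC using decoState_mem_cheapStates
  refine ⟨∑ σ, C σ, fun σ ℓ D n h => ?_⟩
  unfold CoreCost
  rw [deco_ctl]
  exact (hC σ ℓ D n h).mono
    (Nat.mul_le_mul_right _ (Finset.single_le_sum (fun _ _ => Nat.zero_le _) (Finset.mem_univ σ)))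

/-! ### Controlled gates on a window of the tape -/

/-- A readable and writable part of the tape. -/
structure Window (ℓ : ℕ) (β : Type) where
  /-- Reading the window. -/
  get : (ZMod ℓ → Letter) → β
  /-- Writing the window. -/
  put : β → (ZMod ℓ → Letter) → ZMod ℓ → Letter
  get_put : ∀ b r, get (put b r) = b
  put_get : ∀ r, put (get r) r = r
  put_put : ∀ b b' r, put b (put b' r) = put b r

/-- The condition `D` does not depend on the content of the window. -/
def Window.Indep {ℓ : ℕ} {β : Type} (W : Window ℓ β) (D : Set (ZMod ℓ → Letter)) : Prop :=
  ∀ b r, r ∈ D → W.put b r ∈ D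

lemma Window.Indep.iff {ℓ : ℕ} {β : Type} {W : Window ℓ β} {D : Set (ZMod ℓ → Letter)}
    (hD : W.Indep D) (b : β) (r : ZMod ℓ → Letter) : W.put b r ∈ D ↔ r ∈ D := by
  refine ⟨fun h => ?_, hD b r⟩
  have := hD (W.get r) _ h
  rwa [W.put_put, W.put_get] at this

open Classical in
/-- The action on the head state and the window, controlled by the rest of the tape. -/
noncomputable def gate {ℓ : ℕ} {β : Type} (W : Window ℓ β) (D : Set (ZMod ℓ → Letter))
    (hD : W.Indep D) : Equiv.Perm (Arrow × β) →* Equiv.Perm (Conf Arrow ℓ) :=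
  MonoidHom.toHomPerm
    { toFun := fun h x =>
        if x.2.1 ∈ D then
          ((h (x.1, W.get x.2.1)).1, W.put (h (x.1, W.get x.2.1)).2 x.2.1, x.2.2)
        else x
      map_one' := by funext x; simp [W.put_get]; rfl
      map_mul' := fun f g => by
        funext x
        change _ = (fun x : Conf Arrow ℓ => if x.2.1 ∈ D then
          ((f (x.1, W.get x.2.1)).1, W.put (f (x.1, W.get x.2.1)).2 x.2.1, x.2.2) else x)
          (if x.2.1 ∈ D then
          ((g (x.1, W.get x.2.1)).1, W.put (g (x.1, W.get x.2.1)).2 x.2.1, x.2.2) else x)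
        by_cases h : x.2.1 ∈ D <;> simp [h, W.get_put, W.put_put, hD.iff] }

open Classical in
lemma gate_apply {ℓ : ℕ} {β : Type} (W : Window ℓ β) (D : Set (ZMod ℓ → Letter))
    (hD : W.Indep D) (h : Equiv.Perm (Arrow × β)) (x : Conf Arrow ℓ) :
    gate W D hD h x = if x.2.1 ∈ D then
          ((h (x.1, W.get x.2.1)).1, W.put (h (x.1, W.get x.2.1)).2 x.2.1, x.2.2)
        else x := rfl

lemma Window.indep_univ {ℓ : ℕ} {β : Type} (W : Window ℓ β) : W.Indep Set.univ :=
  fun _ _ _ => Set.mem_univ _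

/-- State-dependent translations. -/
def fibTrans {β : Type} [AddCommGroup β] (z : Arrow → β) : Equiv.Perm (Arrow × β) where
  toFun y := (y.1, y.2 - z y.1)
  invFun y := (y.1, y.2 + z y.1)
  left_inv y := by simp
  right_inv y := by simp

lemma fibTrans_apply {β : Type} [AddCommGroup β] (z : Arrow → β) (y : Arrow × β) :
    fibTrans z y = (y.1, y.2 - z y.1) := rfl

lemma gate_conj {ℓ : ℕ} {β : Type} (W : Window ℓ β) (D : Set (ZMod ℓ → Letter))
    (hD : W.Indep D) (θ : Equiv.Perm (Arrow × β)) (h : Equiv.Perm (Arrow × β)) :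
    (gate W Set.univ W.indep_univ θ)⁻¹ * gate W D hD h * gate W Set.univ W.indep_univ θ =
      gate W D hD (θ⁻¹ * h * θ) := by
  rw [← map_inv]
  ext1 x
  simp only [Equiv.Perm.mul_apply, gate_apply]
  by_cases hx : x.2.1 ∈ D <;> simp [hx, W.get_put, W.put_put, hD.iff, W.put_get]

lemma gate_swap_zero {ℓ : ℕ} {β : Type} [DecidableEq β] [AddCommGroup β] (W : Window ℓ β)
    (D : Set (ZMod ℓ → Letter)) (hD : W.Indep D) (s s' : Arrow) :
    gate W D hD (Equiv.swap (s, 0) (s', 0)) = ctl (D ∩ {r | W.get r = 0}) (Equiv.swap s s') := by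
  ext1 x
  obtain ⟨q, r, p⟩ := x
  simp only [gate_apply, ctl_apply]
  by_cases h0 : W.get r = 0
  · have : Equiv.swap (s, (0 : β)) (s', 0) (q, 0) = (Equiv.swap s s' q, 0) := by
      simp only [Equiv.swap_apply_def, Prod.mk.injEq, and_true]
      split_ifs <;> rfl
    have hp : W.put 0 r = r := by rw [← h0, W.put_get]
    by_cases hx : r ∈ D <;> simp [hx, h0, this, hp]
  · have : Equiv.swap (s, (0 : β)) (s', 0) (q, W.get r) = (q, W.get r) :=
      Equiv.swap_apply_of_ne_of_ne (by simp [h0]) (by simp [h0])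
    simp [h0, this, W.put_get]

/-- The bounds on elementary gates that bound all the gates on a window. -/
def Window.CheapOn {ℓ : ℕ} {β : Type} [AddCommGroup β] (W : Window ℓ β)
    (D : Set (ZMod ℓ → Letter)) (N : ℕ) : Prop :=
  (∀ σ, CoreCost (ctl (D ∩ {r | W.get r = 0}) σ) N) ∧
    ∀ z, CoreCost (gate W Set.univ W.indep_univ (fibTrans z)) N

/-- The permutations whose controlled gates have bounded relative cost. -/
def cheapGates (β : Type) [AddCommGroup β] : Subgroup (Equiv.Perm (Arrow × β)) where
  carrier := {h | ∃ C : ℕ, ∀ (ℓ : ℕ) (W : Window ℓ β) (D : Set (ZMod ℓ → Letter))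
    (hD : W.Indep D) (N : ℕ), W.CheapOn D N → CoreCost (gate W D hD h) (C * N)}
  one_mem' := ⟨0, fun ℓ W D hD N _ => by
    rw [map_one]; exact CoreCost.one.mono (Nat.zero_le _)⟩
  mul_mem' := by
    rintro f g ⟨C, hC⟩ ⟨C', hC'⟩
    refine ⟨C + C', fun ℓ W D hD N h => ?_⟩
    rw [map_mul, add_mul]
    exact (hC ℓ W D hD N h).mul (hC' ℓ W D hD N h)
  inv_mem' := by
    rintro f ⟨C, hC⟩
    refine ⟨C, fun ℓ W D hD N h => ?_⟩
    rw [map_inv]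
    exact (hC ℓ W D hD N h).inv

lemma swap_mem_cheapGates_of_ne {β : Type} [AddCommGroup β] [DecidableEq β]
    {s s' : Arrow} (hs : s ≠ s') (b b' : β) :
    Equiv.swap (s, b) (s', b') ∈ cheapGates β := by
  refine ⟨3, fun ℓ W D hD N h => ?_⟩
  set z : Arrow → β := fun t => if t = s then b else b' with hz
  have key : Equiv.swap (s, b) (s', b') =
      (fibTrans z)⁻¹ * Equiv.swap (s, 0) (s', 0) * fibTrans z := by
    have e1 : (fibTrans z) (s, b) = (s, 0) := by simp [fibTrans_apply, hz]
    have e2 : (fibTrans z) (s', b') = (s', 0) := by simp [fibTrans_apply, hz, hs.symm]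
    have h3 := Equiv.mul_swap_eq_swap_mul (fibTrans z) (s, b) (s', b')
    rw [e1, e2] at h3
    rw [mul_assoc, ← h3, inv_mul_cancel_left]
  rw [key, ← gate_conj, gate_swap_zero]
  exact (((h.2 z).inv.mul (h.1 _)).mul (h.2 z)).mono (by omega)

lemma cheapGates_eq_top (β : Type) [AddCommGroup β] [DecidableEq β] [Fintype β] :
    cheapGates β = ⊤ := by
  rw [eq_top_iff, ← Equiv.Perm.closure_isSwap, Subgroup.closure_le]
  rintro f ⟨⟨s, b⟩, ⟨s', b'⟩, hne, rfl⟩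
  by_cases hs : s = s'
  · subst hs
    obtain ⟨t, ht⟩ : ∃ t : Arrow, t ≠ s := by cases s <;> decide
    have hb : b ≠ b' := fun h => hne (by rw [h])
    have h3 := Equiv.swap_mul_swap_mul_swap (x := (s, b')) (y := (t, b)) (z := (s, b))
      (by simp [ht.symm]) (by simp [hb.symm])
    rw [← h3]
    exact mul_mem (mul_mem (swap_mem_cheapGates_of_ne ht _ _)
      (swap_mem_cheapGates_of_ne ht.symm _ _)) (swap_mem_cheapGates_of_ne ht _ _)
  · exact swap_mem_cheapGates_of_ne hs _ _

lemma exists_coreCost_gate (β : Type) [AddCommGroup β] [DecidableEq β] [Fintype β] :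
    ∃ C : ℕ, ∀ (h : Equiv.Perm (Arrow × β)) (ℓ : ℕ) (W : Window ℓ β)
      (D : Set (ZMod ℓ → Letter)) (hD : W.Indep D) (N : ℕ),
      W.CheapOn D N → CoreCost (gate W D hD h) (C * N) := by
  have hall : ∀ h : Equiv.Perm (Arrow × β), h ∈ cheapGates β := fun h => by
    rw [cheapGates_eq_top]; exact Subgroup.mem_top h
  choose C hC using hall
  refine ⟨∑ h, C h, fun h ℓ W D hD N hN => (hC h ℓ W D hD N hN).mono ?_⟩
  exact Nat.mul_le_mul_right _
    (Finset.single_le_sum (fun _ _ => Nat.zero_le _) (Finset.mem_univ h))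

/-! ### Gates on the head cell, and on the head cell and another cell -/

/-- The head cell. -/
def headWindow (ℓ : ℕ) : Window ℓ Letter where
  get r := r 0
  put b r := Function.update r 0 b
  get_put b r := by simp
  put_get r := by simp
  put_put b b' r := by simp

/-- The head cell and another cell. -/
def pairWindow {ℓ : ℕ} (i : ZMod ℓ) (hi : i ≠ 0) : Window ℓ (Letter × Letter) where
  get r := (r 0, r i)
  put b r := Function.update (Function.update r 0 b.1) i b.2
  get_put b r := by simp [hi.symm]
  put_get r := by simp
  put_put b b' r := by
    funext j
    by_cases h : j = i <;> by_cases h' : j = 0 <;> simp [Function.update_apply, h, h']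

lemma natCast_ne_zero_of_lt {ℓ k : ℕ} (h0 : 0 < k) (h : k < ℓ) : (k : ZMod ℓ) ≠ 0 := by
  rw [Ne, ZMod.natCast_eq_zero_iff]
  exact fun hd => absurd (Nat.le_of_dvd h0 hd) (by omega)

lemma natCast_inj_of_lt {ℓ k i : ℕ} (hk : k < ℓ) (hi : i < ℓ) :
    (k : ZMod ℓ) = (i : ZMod ℓ) ↔ k = i := by
  rw [ZMod.natCast_eq_natCast_iff, Nat.ModEq, Nat.mod_eq_of_lt hk, Nat.mod_eq_of_lt hi]

lemma headWindow_indep {ℓ a b : ℕ} (ha : 1 ≤ a) (hb : b ≤ ℓ) (c : Letter) :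
    (headWindow ℓ).Indep (cellsEq a b c) := by
  intro x r hr i hi hi'
  have := natCast_ne_zero_of_lt (ℓ := ℓ) (k := i) (by omega) (by omega)
  change Function.update r 0 x i = c
  rw [Function.update_of_ne this]
  exact hr i hi hi'

lemma pairWindow_indep {ℓ a b i : ℕ} (ha : 1 ≤ a) (hb : b ≤ i) (hi : i < ℓ) (c : Letter)
    (hi0 : (i : ZMod ℓ) ≠ 0) : (pairWindow (i : ZMod ℓ) hi0).Indep (cellsEq a b c) := by
  intro x r hr k hk hk'
  have h1 := natCast_ne_zero_of_lt (ℓ := ℓ) (k := k) (by omega) (by omega)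
  have h2 : (k : ZMod ℓ) ≠ i := by rw [Ne, natCast_inj_of_lt (by omega) hi]; omega
  change Function.update (Function.update r 0 x.1) i x.2 k = c
  rw [Function.update_of_ne h2, Function.update_of_ne h1]
  exact hr k hk hk'

open Classical in
/-- The action on the head cell, controlled by the cells in `[a, b)` carrying `c`. -/
noncomputable def gate1 {ℓ : ℕ} (a b : ℕ) (c : Letter) (h : Equiv.Perm (Arrow × Letter)) :
    Equiv.Perm (Conf Arrow ℓ) :=
  if H : 1 ≤ a ∧ b ≤ ℓ then gate (headWindow ℓ) (cellsEq a b c) (headWindow_indep H.1 H.2 c) h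
  else 1

open Classical in
/-- The action on the head cell and the cell at `i`, controlled by the cells in `[a, b)`
carrying `c`. -/
noncomputable def gate2 {ℓ : ℕ} (a b : ℕ) (c : Letter) (i : ℕ)
    (h : Equiv.Perm (Arrow × Letter × Letter)) : Equiv.Perm (Conf Arrow ℓ) :=
  if H : 1 ≤ a ∧ b ≤ i ∧ i < ℓ ∧ (i : ZMod ℓ) ≠ 0 then
    gate (pairWindow i H.2.2.2) (cellsEq a b c) (pairWindow_indep H.1 H.2.1 H.2.2.1 c H.2.2.2) h
  else 1

open Classical in
lemma gate1_apply {ℓ a b : ℕ} {c : Letter} {h : Equiv.Perm (Arrow × Letter)} (ha : 1 ≤ a)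
    (hb : b ≤ ℓ) (s : Arrow) (r : ZMod ℓ → Letter) (p : ZMod ℓ) :
    gate1 a b c h (s, r, p) = if r ∈ cellsEq a b c then
      ((h (s, r 0)).1, Function.update r 0 (h (s, r 0)).2, p) else (s, r, p) := by
  rw [gate1, dif_pos ⟨ha, hb⟩]
  rfl

open Classical in
lemma gate2_apply {ℓ a b i : ℕ} {c : Letter} {h : Equiv.Perm (Arrow × Letter × Letter)}
    (ha : 1 ≤ a) (hb : b ≤ i) (hi0 : 0 < i) (hi : i < ℓ) (s : Arrow) (r : ZMod ℓ → Letter)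
    (p : ZMod ℓ) :
    gate2 a b c i h (s, r, p) = if r ∈ cellsEq a b c then
      ((h (s, r 0, r i)).1, Function.update (Function.update r 0 (h (s, r 0, r i)).2.1) i
        (h (s, r 0, r i)).2.2, p) else (s, r, p) := by
  rw [gate2, dif_pos ⟨ha, hb, hi, natCast_ne_zero_of_lt hi0 hi⟩]
  rfl

lemma exists_coreCost_gate1 : ∃ C : ℕ, ∀ (ℓ : ℕ) [Fact (1 < ℓ)] (a b : ℕ) (c : Letter)
    (h : Equiv.Perm (Arrow × Letter)), a ≤ ℓ → CoreCost (ℓ := ℓ) (gate1 a b c h) (C * ℓ ^ 2) := by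
  obtain ⟨C₁, h₁⟩ := exists_coreCost_gate Letter
  obtain ⟨C₂, h₂⟩ := exists_coreCost_ctl
  refine ⟨C₁ * (6000 * C₂ + 1), fun ℓ hℓ a b c h ha => ?_⟩
  have hℓ1 := hℓ.1
  rw [gate1]
  split_ifs with H
  · rw [mul_assoc]
    refine h₁ h ℓ _ _ _ _ ⟨fun σ => ?_, fun z => ?_⟩
    · have e : {r : ZMod ℓ → Letter | (headWindow ℓ).get r = 0} = cellsEq 0 1 0 := by
        ext r; simp [cellsEq, headWindow]
      rw [e]
      refine (h₂ σ ℓ _ _ (cost_ctl_inter (cost_ctl_cellsEq ha H.2 c)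
        (cost_ctl_cellsEq (Nat.zero_le ℓ) (by omega) 0))).mono ?_
      nlinarith [Nat.zero_le C₂, mul_le_mul_right (a := C₂) (show 1 ≤ ℓ ^ 2 by nlinarith),
        Nat.zero_le (C₂ * ℓ ^ 2)]
    · have e : gate (headWindow ℓ) Set.univ (headWindow ℓ).indep_univ (fibTrans z) =
          uni (fibTrans z) := by
        ext1 x
        simp [gate_apply, uni_apply, headWindow]
      rw [e]
      exact (CoreCost.uni _).mono (by nlinarith)
  · exact CoreCost.one.mono (Nat.zero_le _)

lemma gate_pairWindow_fibTrans {ℓ : ℕ} (i : ℕ) (hi : (i : ZMod ℓ) ≠ 0)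
    (z : Arrow → Letter × Letter) :
    gate (pairWindow (i : ZMod ℓ) hi) Set.univ (Window.indep_univ _) (fibTrans z) =
      (mvs (fun _ => true) ^ i)⁻¹ * uni (fibTrans fun s => (z s).2) * mvs (fun _ => true) ^ i *
        uni (fibTrans fun s => (z s).1) := by
  ext1 x
  obtain ⟨s, r, p⟩ := x
  simp only [Equiv.Perm.mul_apply, gate_apply, uni_apply, mvs_pow_apply, mvs_pow_inv_apply,
    fibTrans_apply, pairWindow, Set.mem_univ, if_true]
  refine Prod.ext rfl (Prod.ext (funext fun j => ?_) (by simp))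
  by_cases hj : j = i
  · subst hj; simp [hi]
  · simp [Function.update_apply, hj, sub_eq_zero]

lemma exists_coreCost_gate2 : ∃ C : ℕ, ∀ (ℓ : ℕ) [Fact (1 < ℓ)] (a b : ℕ) (c : Letter) (i : ℕ)
    (h : Equiv.Perm (Arrow × Letter × Letter)), a ≤ ℓ →
    CoreCost (ℓ := ℓ) (gate2 a b c i h) (C * ℓ ^ 2) := by
  obtain ⟨C₁, h₁⟩ := exists_coreCost_gate (Letter × Letter)
  obtain ⟨C₂, h₂⟩ := exists_coreCost_ctl
  refine ⟨C₁ * (20000 * C₂ + 400), fun ℓ hℓ a b c i h ha => ?_⟩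
  have hℓ1 := hℓ.1
  rw [gate2]
  split_ifs with H
  · rw [mul_assoc]
    refine h₁ h ℓ _ _ _ _ ⟨fun σ => ?_, fun z => ?_⟩
    · have e : {r : ZMod ℓ → Letter | (pairWindow (i : ZMod ℓ) H.2.2.2).get r = 0} =
          cellsEq 0 1 0 ∩ cellsEq i (i + 1) 0 := by
        ext r
        simp only [cellsEq, pairWindow, Set.mem_ofPred_eq, Set.mem_inter_iff, Prod.mk_eq_zero]
        refine and_congr ⟨fun h k _ hk => ?_, fun h => by simpa using h 0 (by omega) (by omega)⟩
          ⟨fun h k hk hk' => ?_, fun h => h i (by omega) (by omega)⟩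
        · obtain rfl : k = 0 := by omega
          simpa using h
        · obtain rfl : k = i := by omega
          exact h
      rw [e]
      refine (h₂ σ ℓ _ _ (cost_ctl_inter (cost_ctl_cellsEq ha (by omega) c)
        (cost_ctl_inter (cost_ctl_cellsEq (Nat.zero_le ℓ) (by omega) 0)
          (cost_ctl_cellsEq (by omega) (by omega) 0)))).mono ?_
      nlinarith [Nat.zero_le C₂, mul_le_mul_right (a := C₂) (show 1 ≤ ℓ ^ 2 by nlinarith),
        Nat.zero_le (C₂ * ℓ ^ 2)]
    · rw [gate_pairWindow_fibTrans]
      have hm := (CoreCost.mvs (ℓ := ℓ) (fun _ => true)).pow i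
      refine (((hm.inv.mul (CoreCost.uni _)).mul hm).mul (CoreCost.uni _)).mono ?_
      nlinarith
  · exact CoreCost.one.mono (Nat.zero_le _)

/-! ### Configurations given by words -/

/-- The configuration with the given cyclic word, read rightwards from the head. -/
def conf {ℓ : ℕ} (s : Arrow) (R : List Letter) (p : ZMod ℓ) : Conf Arrow ℓ :=
  (s, fun i => R.getD i.val 0, p)

lemma conf_tape {ℓ : ℕ} (s : Arrow) (R : List Letter) (p : ZMod ℓ) {i : ℕ} (hi : i < ℓ) :
    (conf s R p).2.1 (i : ZMod ℓ) = R.getD i 0 := by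
  simp [conf, ZMod.val_natCast_of_lt hi]

lemma exists_natCast {ℓ : ℕ} [NeZero ℓ] (i : ZMod ℓ) : ∃ k < ℓ, (k : ZMod ℓ) = i :=
  ⟨i.val, ZMod.val_lt i, ZMod.natCast_zmod_val i⟩

lemma exists_conf {ℓ : ℕ} [NeZero ℓ] (x : Conf Arrow ℓ) :
    ∃ s R p, R.length = ℓ ∧ x = conf s R p := by
  obtain ⟨s, r, p⟩ := x
  refine ⟨s, (List.range ℓ).map (fun i : ℕ => r (i : ZMod ℓ)), p, by simp, Prod.ext rfl (Prod.ext ?_ rfl)⟩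
  funext i
  simp [conf, List.getD_eq_getElem?_getD, ZMod.val_lt]

lemma conf_mem_cellsEq {ℓ : ℕ} (s : Arrow) (R : List Letter) (p : ZMod ℓ) {a b : ℕ}
    (hb : b ≤ ℓ) (c : Letter) :
    (conf s R p).2.1 ∈ cellsEq a b c ↔ ∀ i, a ≤ i → i < b → R.getD i 0 = c := by
  refine forall_congr' fun i => forall_congr' fun _ => forall_congr' fun hi => ?_
  rw [conf_tape _ _ _ (by omega)]

lemma conf_update {ℓ : ℕ} [NeZero ℓ] (s : Arrow) (R : List Letter) (p : ZMod ℓ)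
    (hR : R.length = ℓ) {i : ℕ} (hi : i < ℓ) (b : Letter) :
    Function.update (conf s R p).2.1 i b = (conf s (R.set i b) p).2.1 := by
  funext j
  obtain ⟨k, hk, rfl⟩ := exists_natCast j
  rw [conf_tape _ _ _ hk, Function.update_apply, conf_tape _ _ _ hk]
  simp only [natCast_inj_of_lt hk hi, List.getD_eq_getElem?_getD, List.getElem?_set]
  by_cases h : k = i
  · simp [h, hR, hi]
  · simp [h, Ne.symm h]

lemma conf_update_zero {ℓ : ℕ} [NeZero ℓ] (s : Arrow) (a : Letter) (t : List Letter) (p : ZMod ℓ)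
    (hR : (a :: t).length = ℓ) (b : Letter) :
    Function.update (conf s (a :: t) p).2.1 0 b = (conf s (b :: t) p).2.1 := by
  have := conf_update s (a :: t) p hR (i := 0) (by simp at hR; omega) b
  simpa using this

lemma conf_head {ℓ : ℕ} [NeZero ℓ] (s : Arrow) (a : Letter) (t : List Letter) (p : ZMod ℓ) :
    (conf s (a :: t) p).2.1 0 = a := by
  simp [conf]

lemma mvs_conf_cons {ℓ : ℕ} [NeZero ℓ] (F : Arrow → Bool) (s : Arrow) (a : Letter)
    (t : List Letter) (p : ZMod ℓ) (hR : (a :: t).length = ℓ) (hs : F s = true) :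
    mvs F (conf s (a :: t) p) = conf s (t ++ [a]) (p + 1) := by
  rw [mvs_apply]
  have : F (conf s (a :: t) p).1 = true := hs
  rw [if_pos this]
  refine Prod.ext rfl (Prod.ext (funext fun j => ?_) rfl)
  obtain ⟨k, hk, rfl⟩ := exists_natCast j
  rw [conf_tape _ _ _ hk]
  simp only [List.length_cons] at hR
  by_cases h : k + 1 < ℓ
  · have e := conf_tape s (a :: t) p h
    push_cast at e
    change (conf s (a :: t) p).2.1 (k + 1) = _
    rw [e]
    simp [List.getD_eq_getElem?_getD, List.getElem?_append_left (show k < t.length by omega)]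
  · have hk' : k = t.length := by omega
    have e : (k : ZMod ℓ) + 1 = 0 := by
      have := ZMod.natCast_self ℓ
      rw [← hR] at this
      rw [← hR, hk']
      exact_mod_cast this
    change (conf s (a :: t) p).2.1 (k + 1) = _
    rw [e, conf_head, hk']
    simp

lemma mvs_conf_of_eq_false {ℓ : ℕ} (F : Arrow → Bool) (s : Arrow) (R : List Letter)
    (p : ZMod ℓ) (hs : F s = false) : mvs F (conf s R p) = conf s R p := by
  rw [mvs_apply]
  have : F (conf s R p).1 = false := hs
  simp [this]

lemma getD_append_eq_forall (w u v : List Letter) (c : Letter) :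
    (∀ i, w.length ≤ i → i < w.length + u.length → (w ++ (u ++ v)).getD i 0 = c) ↔
      ∀ z ∈ u, z = c := by
  constructor
  · intro h z hz
    obtain ⟨i, hi, rfl⟩ := List.getElem_of_mem hz
    have := h (w.length + i) (by omega) (by omega)
    rwa [List.getD_eq_getElem?_getD, List.getElem?_append_right (by omega), Nat.add_sub_cancel_left,
      List.getElem?_append_left hi, List.getElem?_eq_getElem hi, Option.getD_some] at this
  · intro h i hi hi'
    have hj : i - w.length < u.length := by omega
    rw [List.getD_eq_getElem?_getD, List.getElem?_append_right hi, List.getElem?_append_left hj,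
      List.getElem?_eq_getElem hj, Option.getD_some]
    exact h _ (List.getElem_mem hj)

lemma gate1_conf {ℓ : ℕ} [NeZero ℓ] {a b : ℕ} {c : Letter} {h : Equiv.Perm (Arrow × Letter)}
    (s : Arrow) (x : Letter) (w u v : List Letter) (p : ZMod ℓ)
    (hR : (x :: (w ++ (u ++ v))).length = ℓ) (ha : a = w.length + 1)
    (hb : b = w.length + u.length + 1) :
    gate1 a b c h (conf s (x :: (w ++ (u ++ v))) p) =
      if ∀ z ∈ u, z = c then conf (h (s, x)).1 ((h (s, x)).2 :: (w ++ (u ++ v))) p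
      else conf s (x :: (w ++ (u ++ v))) p := by
  have hbl : b ≤ ℓ := by simp at hR; omega
  have hc := conf_mem_cellsEq s (x :: (w ++ (u ++ v))) p (a := a) hbl c
  have hg := getD_append_eq_forall (x :: w) u v c
  rw [show (x :: w).length = a by simp [ha], show a + u.length = b by omega] at hg
  rw [List.cons_append] at hg
  rw [hg] at hc
  obtain ⟨r, hr⟩ : ∃ r, (conf s (x :: (w ++ (u ++ v))) p).2.1 = r := ⟨_, rfl⟩
  have hx : conf s (x :: (w ++ (u ++ v))) p = (s, r, p) := by rw [← hr]; rfl
  have h0 : r 0 = x := by rw [← hr, conf_head]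
  have hup := fun y => conf_update_zero s x _ p hR y
  rw [hr] at hc hup
  rw [hx, gate1_apply (by omega) hbl, h0]
  by_cases hall : ∀ z ∈ u, z = c
  · rw [if_pos (hc.2 hall), if_pos hall, hup]; rfl
  · rw [if_neg (fun h => hall (hc.1 h)), if_neg hall]

lemma gate1_univ_conf {ℓ : ℕ} [NeZero ℓ] {h : Equiv.Perm (Arrow × Letter)}
    (s : Arrow) (x : Letter) (t : List Letter) (p : ZMod ℓ) (hR : (x :: t).length = ℓ) :
    gate1 1 1 0 h (conf s (x :: t) p) = conf (h (s, x)).1 ((h (s, x)).2 :: t) p := by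
  have := gate1_conf (a := 1) (b := 1) (c := 0) (h := h) s x [] [] t p hR rfl rfl
  simpa using this

lemma gate2_conf {ℓ : ℕ} [NeZero ℓ] {a i : ℕ} {c : Letter}
    {h : Equiv.Perm (Arrow × Letter × Letter)}
    (s : Arrow) (x : Letter) (w u : List Letter) (y : Letter) (v : List Letter) (p : ZMod ℓ)
    (hR : (x :: (w ++ (u ++ y :: v))).length = ℓ) (ha : a = w.length + 1)
    (hi : i = w.length + u.length + 1) :
    gate2 a i c i h (conf s (x :: (w ++ (u ++ y :: v))) p) =
      if ∀ z ∈ u, z = c then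
        conf (h (s, x, y)).1 ((h (s, x, y)).2.1 :: (w ++ (u ++ (h (s, x, y)).2.2 :: v))) p
      else conf s (x :: (w ++ (u ++ y :: v))) p := by
  have hil : i < ℓ := by simp at hR; omega
  have hc := conf_mem_cellsEq s (x :: (w ++ (u ++ y :: v))) p (a := a) hil.le c
  have hg := getD_append_eq_forall (x :: w) u (y :: v) c
  rw [show (x :: w).length = a by simp [ha], show a + u.length = i by omega] at hg
  rw [List.cons_append] at hg
  rw [hg] at hc
  obtain ⟨r, hr⟩ : ∃ r, (conf s (x :: (w ++ (u ++ y :: v))) p).2.1 = r := ⟨_, rfl⟩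
  have hx : conf s (x :: (w ++ (u ++ y :: v))) p = (s, r, p) := by rw [← hr]; rfl
  have h0 : r 0 = x := by rw [← hr, conf_head]
  have hset : ∀ x' z : Letter, (x' :: (w ++ (u ++ y :: v))).set i z =
      x' :: (w ++ (u ++ z :: v)) := by
    intro x' z
    rw [hi, List.set_cons_succ, List.set_append_right _ _ (by omega),
      List.set_append_right _ _ (by omega)]
    simp
  have hy : r i = y := by
    rw [← hr, conf_tape _ _ _ hil, hi]
    simp [List.getD_eq_getElem?_getD]
  have hup : ∀ x' z, Function.update (Function.update r 0 x') i z =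
      (conf s (x' :: (w ++ (u ++ z :: v))) p).2.1 := by
    intro x' z
    rw [← hset x' z, ← conf_update s _ p (by simpa using hR) hil,
      ← conf_update_zero s x _ p hR x', hr]
  rw [hr] at hc
  rw [hx, gate2_apply (by omega) le_rfl (by omega) hil, h0, hy]
  by_cases hall : ∀ z ∈ u, z = c
  · rw [if_pos (hc.2 hall), if_pos hall, hup]; rfl
  · rw [if_neg (fun h => hall (hc.1 h)), if_neg hall]

lemma gate2_univ_conf {ℓ : ℕ} [NeZero ℓ] {i : ℕ} {h : Equiv.Perm (Arrow × Letter × Letter)}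
    (s : Arrow) (x : Letter) (u : List Letter) (y : Letter) (v : List Letter) (p : ZMod ℓ)
    (hR : (x :: (u ++ y :: v)).length = ℓ) (hi : i = u.length + 1) :
    gate2 i i 0 i h (conf s (x :: (u ++ y :: v)) p) =
      conf (h (s, x, y)).1 ((h (s, x, y)).2.1 :: (u ++ (h (s, x, y)).2.2 :: v)) p := by
  have := gate2_conf (a := i) (i := i) (c := 0) (h := h) s x u [] y v p hR hi (by simpa using hi)
  simpa using this

/-! ### Ternary digits -/

/-- The residue of a number modulo three. -/
def letterOf (n : ℕ) : Letter := Fin.ofNat 3 n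

lemma letterOf_val (n : ℕ) : (letterOf n).val = n % 3 := rfl

lemma letterOf_letter (d : Letter) : letterOf d = d := by
  revert d; decide

lemma letterOf_succ (n : ℕ) : letterOf (n + 1) = letterOf n + 1 := by
  apply Fin.ext
  rw [Fin.val_add, letterOf_val, letterOf_val]
  change (n + 1) % 3 = (n % 3 + 1) % 3
  omega

lemma letterOf_add_mul (n q : ℕ) : letterOf (n + 3 * q) = letterOf n := by
  apply Fin.ext
  rw [letterOf_val, letterOf_val]
  omega

lemma letterOf_eq_zero_iff (n : ℕ) : letterOf n = 0 ↔ 3 ∣ n := by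
  rw [Fin.ext_iff, letterOf_val]
  exact (Nat.dvd_iff_mod_eq_zero).symm

/-- The first `k` ternary digits of `n`, the least significant one first. -/
def digs : ℕ → ℕ → List Letter
  | 0, _ => []
  | k + 1, n => digs k n ++ [letterOf (n / 3 ^ k)]

@[simp] lemma length_digs (k n : ℕ) : (digs k n).length = k := by
  induction k with
  | zero => rfl
  | succ k ih => simp [digs, ih]

lemma digs_add (m k n : ℕ) : digs (m + k) n = digs m n ++ digs k (n / 3 ^ m) := by
  induction k with
  | zero => simp [digs]
  | succ k ih => rw [← add_assoc, digs, ih, digs, Nat.div_div_eq_div_mul, pow_add, List.append_assoc]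

lemma digs_add_mul (k n q : ℕ) : digs k (n + 3 ^ k * q) = digs k n := by
  induction k generalizing q with
  | zero => rfl
  | succ k ih =>
    have e : n + 3 ^ (k + 1) * q = n + 3 ^ k * (3 * q) := by ring
    rw [digs, digs, e, ih, Nat.add_mul_div_left _ _ (by positivity), letterOf_add_mul]

lemma digs_mod (k n : ℕ) : digs k (n % 3 ^ k) = digs k n := by
  conv_rhs => rw [← Nat.mod_add_div n (3 ^ k)]
  rw [digs_add_mul]

lemma exists_digs (l : List Letter) : ∃ n < 3 ^ l.length, l = digs l.length n := by
  induction l using List.reverseRecOn with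
  | nil => exact ⟨0, by simp, rfl⟩
  | append_singleton l d ih =>
    obtain ⟨n, hn, h⟩ := ih
    refine ⟨n + 3 ^ l.length * d.val, ?_, ?_⟩
    · have := d.isLt
      rw [List.length_append, List.length_singleton, pow_succ]
      nlinarith
    · rw [List.length_append, List.length_singleton, digs, digs_add_mul, ← h,
        Nat.add_mul_div_left _ _ (by positivity), Nat.div_eq_of_lt hn, zero_add, letterOf_letter]

lemma digs_eq_zero_iff (k n : ℕ) : (∀ z ∈ digs k n, z = 0) ↔ 3 ^ k ∣ n := by
  induction k with
  | zero => simp [digs]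
  | succ k ih =>
    simp only [digs, List.mem_append, List.mem_singleton, or_imp, forall_and, forall_eq, ih,
      letterOf_eq_zero_iff]
    constructor
    · rintro ⟨⟨q, rfl⟩, h⟩
      rw [Nat.mul_div_cancel_left _ (by positivity)] at h
      rw [pow_succ]
      exact Nat.mul_dvd_mul_left _ h
    · rintro ⟨q, rfl⟩
      refine ⟨⟨3 * q, by ring⟩, ?_⟩
      rw [pow_succ, mul_assoc, Nat.mul_div_cancel_left _ (by positivity)]
      exact Dvd.intro _ rfl

lemma letterOf_succ_div (k n : ℕ) :
    letterOf ((n + 1) / 3 ^ k) = letterOf (n / 3 ^ k) + if 3 ^ k ∣ n + 1 then 1 else 0 := by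
  rw [Nat.succ_div]
  split_ifs <;> simp [letterOf_succ]

lemma digs_eq_two_iff (k n : ℕ) : (∀ z ∈ digs k n, z = 2) ↔ 3 ^ k ∣ n + 1 := by
  induction k with
  | zero => simp [digs]
  | succ k ih =>
    rw [← digs_eq_zero_iff]
    simp only [digs, List.mem_append, List.mem_singleton, or_imp, forall_and, forall_eq, ih,
      digs_eq_zero_iff, letterOf_succ_div]
    refine and_congr_right fun h => ?_
    rw [if_pos h]
    generalize letterOf (n / 3 ^ k) = z
    revert z; decide

/-! ### Counters on the tape -/

/-- Addition of `δ` to the second letter. -/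
def addSecond (δ : Arrow → Letter → Letter) : Equiv.Perm (Arrow × Letter × Letter) where
  toFun y := (y.1, y.2.1, y.2.2 + δ y.1 y.2.1)
  invFun y := (y.1, y.2.1, y.2.2 - δ y.1 y.2.1)
  left_inv y := by simp
  right_inv y := by simp

/-- Addition of `δ` to the counter in the cells `[a, a + m)`. -/
noncomputable def incr {ℓ : ℕ} (δ : Arrow → Letter → Letter) (a : ℕ) :
    ℕ → Equiv.Perm (Conf Arrow ℓ)
  | 0 => 1
  | m + 1 => incr δ a m * gate2 a (a + m) 2 (a + m) (addSecond δ)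

lemma incr_conf {ℓ : ℕ} [NeZero ℓ] (δ : Arrow → Letter → Letter) {a m : ℕ} (s : Arrow)
    (x : Letter) (w : List Letter) (n : ℕ) (v : List Letter) (p : ZMod ℓ)
    (hR : (x :: (w ++ (digs m n ++ v))).length = ℓ) (ha : a = w.length + 1)
    (hδ : δ s x = 0 ∨ δ s x = 1) :
    incr δ a m (conf s (x :: (w ++ (digs m n ++ v))) p) =
      conf s (x :: (w ++ (digs m (n + (δ s x).val) ++ v))) p := by
  induction m generalizing v with
  | zero => rfl
  | succ m ih =>
    rw [incr, Equiv.Perm.mul_apply]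
    simp only [digs, List.append_assoc, List.cons_append, List.nil_append] at hR ⊢
    rw [gate2_conf s x w (digs m n) _ v p hR ha (by simp; omega)]
    simp only [digs_eq_two_iff]
    have e : ∀ z, addSecond δ (s, x, z) = (s, x, z + δ s x) := fun z => rfl
    simp only [e]
    rcases hδ with hδ | hδ
    · simp only [hδ, add_zero, ite_self]
      have := ih (letterOf (n / 3 ^ m) :: v) (by simpa using hR)
      rw [hδ] at this
      exact this
    · simp only [hδ]
      have e1 : (1 : Letter).val = 1 := rfl
      rw [e1, letterOf_succ_div]
      split_ifs with hd
      · have := ih ((letterOf (n / 3 ^ m) + 1) :: v) (by simpa using hR)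
        rw [hδ] at this
        exact this
      · have := ih (letterOf (n / 3 ^ m) :: v) (by simpa using hR)
        rw [hδ] at this
        rw [add_zero]
        exact this

/-- Exchange of the two letters for right arrows. -/
def swapRt : Equiv.Perm (Arrow × Letter × Letter) where
  toFun y := if y.1.isRt then (y.1, y.2.2, y.2.1) else y
  invFun y := if y.1.isRt then (y.1, y.2.2, y.2.1) else y
  left_inv y := by by_cases h : y.1.isRt <;> simp [h]
  right_inv y := by by_cases h : y.1.isRt <;> simp [h]

/-- For right arrows, the letter in cell `k` is brought to the head. -/
noncomputable def bring {ℓ : ℕ} : ℕ → Equiv.Perm (Conf Arrow ℓ)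
  | 0 => 1
  | k + 1 => gate2 (k + 1) (k + 1) 0 (k + 1) swapRt * bring k

lemma bring_conf_rt {ℓ : ℕ} [NeZero ℓ] {k : ℕ} (s : Arrow) (hs : s.isRt = true) (x : List Letter)
    (b : Letter) (v : List Letter) (p : ZMod ℓ) (hk : x.length = k)
    (hR : (x ++ b :: v).length = ℓ) :
    bring k (conf s (x ++ b :: v) p) = conf s (b :: (x ++ v)) p := by
  induction k generalizing x b v with
  | zero =>
    obtain rfl := List.length_eq_zero_iff.1 hk
    rfl
  | succ k ih =>
    obtain ⟨x, y, rfl⟩ := (List.eq_nil_or_concat x).resolve_left (by rintro rfl; simp at hk)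
    have hx : x.length = k := by simpa using hk
    rw [List.concat_eq_append, List.append_assoc, List.singleton_append] at hR ⊢
    rw [bring, Equiv.Perm.mul_apply, ih x y (b :: v) hx hR,
      gate2_univ_conf s y x b v p (by simp at hR ⊢; omega) (by omega)]
    simp [swapRt, hs]

lemma bring_conf_left {ℓ : ℕ} [NeZero ℓ] {k : ℕ} (s : Arrow) (hs : s.isRt = false) (x : Letter)
    (t : List Letter) (p : ZMod ℓ) (hk : k ≤ t.length) (hR : (x :: t).length = ℓ) :
    bring k (conf s (x :: t) p) = conf s (x :: t) p := by
  induction k with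
  | zero => rfl
  | succ k ih =>
    obtain ⟨u, y, v, rfl, hu⟩ : ∃ u y v, t = u ++ y :: v ∧ u.length = k :=
      ⟨t.take k, t[k], t.drop (k + 1), by simp, by simp; omega⟩
    rw [bring, Equiv.Perm.mul_apply, ih (by omega),
      gate2_univ_conf s x u y v p hR (by omega)]
    simp [swapRt, hs]

/-- Right arrows move over the counter and the following letter. -/
noncomputable def forward {ℓ : ℕ} (k : ℕ) : Equiv.Perm (Conf Arrow ℓ) := bring k * mvs Arrow.isRt

lemma forward_conf_rt {ℓ : ℕ} [NeZero ℓ] {k : ℕ} (s : Arrow) (hs : s.isRt = true) (a : Letter)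
    (x : List Letter) (b : Letter) (v : List Letter) (p : ZMod ℓ) (hk : x.length = k)
    (hR : (a :: (x ++ b :: v)).length = ℓ) :
    forward k (conf s (a :: (x ++ b :: v)) p) = conf s (b :: (x ++ (v ++ [a]))) (p + 1) := by
  rw [forward, Equiv.Perm.mul_apply, mvs_conf_cons _ _ _ _ _ hR hs]
  have := bring_conf_rt s hs x b (v ++ [a]) (p + 1) hk (by simp at hR ⊢; omega)
  simpa using this

lemma forward_conf_full {ℓ : ℕ} [NeZero ℓ] {k : ℕ} (s : Arrow) (hs : s.isRt = true) (a : Letter)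
    (x : List Letter) (p : ZMod ℓ) (hk : x.length = k) (hR : (a :: x).length = ℓ) :
    forward k (conf s (a :: x) p) = conf s (a :: x) (p + 1) := by
  rw [forward, Equiv.Perm.mul_apply, mvs_conf_cons _ _ _ _ _ hR hs]
  have := bring_conf_rt s hs x a [] (p + 1) hk (by simp at hR ⊢; omega)
  simpa using this

lemma forward_conf_left {ℓ : ℕ} [NeZero ℓ] {k : ℕ} (s : Arrow) (hs : s.isRt = false) (a : Letter)
    (t : List Letter) (p : ZMod ℓ) (hk : k ≤ t.length) (hR : (a :: t).length = ℓ) :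
    forward k (conf s (a :: t) p) = conf s (a :: t) p := by
  rw [forward, Equiv.Perm.mul_apply, mvs_conf_of_eq_false _ _ _ _ hs,
    bring_conf_left s hs a t p hk hR]

/-! ### One level of decoding -/

/-- The configuration with the given head state, word and head position. -/
def wconf {ℓ : ℕ} (w : WConf ℓ) : Conf Arrow ℓ := conf w.1 w.2.1 w.2.2

/-- Decoded heads on the second letter are recoded as right arrows, the others as left ones. -/
def recode : Equiv.Perm (Arrow × Letter) where
  toFun
    | (.lh, 0) => (.rf, 1)
    | (.lh, 1) => (.rf, 2)
    | (.lh, 2) => (.lh, 0)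
    | (.rf, 1) => (.lh, 1)
    | (.rf, 2) => (.lh, 2)
    | x => x
  invFun
    | (.rf, 1) => (.lh, 0)
    | (.rf, 2) => (.lh, 1)
    | (.lh, 0) => (.lh, 2)
    | (.lh, 1) => (.rf, 1)
    | (.lh, 2) => (.rf, 2)
    | x => x
  left_inv x := by revert x; decide
  right_inv x := by revert x; decide

/-- A decoded head is recoded. -/
def recodeDecoded : Arrow × Letter × Letter × Bool → Arrow × Letter × Letter
  | (s, a, b, true) => ((recode (s, b)).1, a, (recode (s, b)).2)
  | (s, a, b, false) => ((recode (s, a)).1, (recode (s, a)).2, b)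

/-- The permutation that decodes one digit. -/
noncomputable def decodeGate : Equiv.Perm (Arrow × Letter × Letter) :=
  Equiv.ofBijective (fun x => recodeDecoded (decode x.1 x.2.1 x.2.2))
    (Finite.injective_iff_bijective.1 (by unfold Function.Injective; decide +kernel))

/-- The permutation that decodes the last digit. -/
noncomputable def decodeLastGate : Equiv.Perm (Arrow × Letter) :=
  Equiv.ofBijective (fun x => recode ((decodeLast x.1 x.2).1, (decodeLast x.1 x.2).2.1))
    (Finite.injective_iff_bijective.1 (by unfold Function.Injective; decide +kernel))

lemma recode_isRt_of_decode (s : Arrow) (a d : Letter) :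
    (recodeDecoded (decode s a d)).1.isRt = (decode s a d).2.2.2 := by
  cases s <;> revert a d <;> decide

lemma recode_isRt_of_decodeLast (s : Arrow) (d : Letter) :
    (recode ((decodeLast s d).1, (decodeLast s d).2.1)).1.isRt = (decodeLast s d).2.2 := by
  cases s <;> revert d <;> decide

/-- The exchange of two head symbols when all `m` digits are `2`, and of two other ones when all
digits are `0`. -/
noncomputable def exchGate {ℓ : ℕ} (m : ℕ) : Equiv.Perm (Conf Arrow ℓ) :=
  gate1 1 (m + 1) 0 (Equiv.swap (.lh, 2) (.rf, 2)) *
    gate1 1 (m + 1) 2 (Equiv.swap (.lf, 0) (.rf, 1))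

lemma exch_eq (top bot : Prop) [Decidable top] [Decidable bot] (s : Arrow) (a : Letter) :
    exch top bot s a =
      if bot then Equiv.swap (.lh, 2) (.rf, 2)
        (if top then Equiv.swap (.lf, 0) (.rf, 1) (s, a) else (s, a))
      else (if top then Equiv.swap (.lf, 0) (.rf, 1) (s, a) else (s, a)) := by
  by_cases h1 : top <;> by_cases h2 : bot <;> simp only [exch, h1, h2, if_true, if_false] <;>
    cases s <;> rcases letter_cases a with rfl | rfl | rfl <;> decide

lemma dvd_iff_eq_zero_of_lt {N n : ℕ} (h : n < N) : N ∣ n ↔ n = 0 :=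
  ⟨fun hd => Nat.eq_zero_of_dvd_of_lt hd h, fun h => h ▸ dvd_zero N⟩

lemma dvd_succ_iff_of_lt {N n : ℕ} (h : n < N) : N ∣ n + 1 ↔ n = N - 1 := by
  constructor
  · intro hd
    have := Nat.le_of_dvd (Nat.succ_pos n) hd
    omega
  · rintro rfl
    rw [Nat.sub_add_cancel (by omega)]

lemma exchGate_conf {ℓ : ℕ} [NeZero ℓ] (m n : ℕ) (hn : n < 3 ^ m) (s : Arrow) (a : Letter)
    (t : List Letter) (p : ZMod ℓ) (hR : (a :: (digs m n ++ t)).length = ℓ) :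
    exchGate m (conf s (a :: (digs m n ++ t)) p) =
      conf (exch (n = 3 ^ m - 1) (n = 0) s a).1
        ((exch (n = 3 ^ m - 1) (n = 0) s a).2 :: (digs m n ++ t)) p := by
  have key : ∀ (c : Letter) (h : Equiv.Perm (Arrow × Letter)) (x : Arrow × Letter),
      gate1 1 (m + 1) c h (conf x.1 (x.2 :: (digs m n ++ t)) p) =
        conf (if ∀ z ∈ digs m n, z = c then h x else x).1
          ((if ∀ z ∈ digs m n, z = c then h x else x).2 :: (digs m n ++ t)) p := by
    intro c h x
    have := gate1_conf (a := 1) (b := m + 1) (c := c) (h := h) x.1 x.2 [] (digs m n) t p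
      (by simpa using hR) rfl (by simp)
    rw [List.nil_append] at this
    rw [this]
    split_ifs <;> rfl
  rw [exch_eq, exchGate, Equiv.Perm.mul_apply, key 2 _ (s, a), key 0]
  simp only [digs_eq_zero_iff, digs_eq_two_iff, dvd_iff_eq_zero_of_lt hn, dvd_succ_iff_of_lt hn]

/-- The counter shift depending on the head symbol, as a permutation. -/
noncomputable def shiftGate {ℓ : ℕ} (m : ℕ) : Equiv.Perm (Conf Arrow ℓ) :=
  (incr (fun s a => if s = .rf ∧ a = 2 then 1 else 0) 1 m)⁻¹ *
    incr (fun s a => if s = .rf ∧ a = 1 then 1 else 0) 1 m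

lemma shiftGate_conf {ℓ : ℕ} [NeZero ℓ] (m n : ℕ) (s : Arrow) (a : Letter)
    (t : List Letter) (p : ZMod ℓ) (hn : n < 3 ^ m) (hR : (a :: (digs m n ++ t)).length = ℓ) :
    shiftGate m (conf s (a :: (digs m n ++ t)) p) =
      conf s (a :: (digs m (shiftBy (3 ^ m) n (s, a)) ++ t)) p := by
  have h0 : 0 < 3 ^ m := by positivity
  have up := fun n' δ h => incr_conf (ℓ := ℓ) δ (a := 1) (m := m) s a [] n' t p
    (by simpa using hR) rfl h
  simp only [List.nil_append] at up
  rw [shiftGate, Equiv.Perm.mul_apply, up n _ (by split_ifs <;> simp), Equiv.Perm.inv_eq_iff_eq,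
    up _ _ (by split_ifs <;> simp)]
  congr 3
  rw [← digs_mod m (n + _), ← digs_mod m (shiftBy _ _ _ + _)]
  congr 1
  cases s <;> rcases letter_cases a with rfl | rfl | rfl <;> simp [shiftBy]
  rw [show n + 3 ^ m - 1 + 1 = n + 3 ^ m by omega, Nat.add_mod_right]

/-- One level of decoding: one digit of the counter is absorbed. -/
noncomputable def levelGate {ℓ : ℕ} (k : ℕ) : Equiv.Perm (Conf Arrow ℓ) :=
  gate1 1 1 0 recode⁻¹ * (forward k * (gate2 (k + 1) (k + 1) 0 (k + 1) decodeGate *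
    (shiftGate (k + 1) * exchGate (k + 1))))

/-- The configuration denoted by a decoded one. -/
def confDecoded {ℓ : ℕ} (u t : List Letter) (p : ZMod ℓ) :
    Arrow × Letter × Letter × Bool → Conf Arrow ℓ
  | (s, a, b, true) => conf s (b :: (u ++ (t ++ [a]))) (p + 1)
  | (s, a, b, false) => conf s (a :: (u ++ b :: t)) p

lemma decodeLevel_conf {ℓ : ℕ} [NeZero ℓ] (k : ℕ) (s : Arrow) (a : Letter) (u : List Letter)
    (d : Letter) (t : List Letter) (p : ZMod ℓ) (hu : u.length = k)
    (hR : (a :: (u ++ d :: t)).length = ℓ) :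
    (gate1 1 1 0 recode⁻¹ * (forward k * (gate2 (k + 1) (k + 1) 0 (k + 1) decodeGate)) :
      Equiv.Perm (Conf Arrow ℓ)) (conf s (a :: (u ++ d :: t)) p) = confDecoded u t p (decode s a d) := by
  rw [Equiv.Perm.mul_apply, Equiv.Perm.mul_apply, gate2_univ_conf s a u d t p hR (by omega)]
  have e : decodeGate (s, a, d) = recodeDecoded (decode s a d) := rfl
  rw [e]
  have hrt := recode_isRt_of_decode s a d
  generalize decode s a d = D at *
  obtain ⟨s', a', b', f⟩ := D
  cases f
  · rw [forward_conf_left _ hrt _ _ _ (by simp [hu]) (by simpa using hR),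
      gate1_univ_conf _ _ _ _ (by simpa using hR)]
    simp [recodeDecoded, confDecoded]
  · rw [forward_conf_rt _ hrt _ _ _ _ _ hu (by simpa using hR),
      gate1_univ_conf _ _ _ _ (by simp at hR ⊢; omega)]
    simp [recodeDecoded, confDecoded]

lemma shiftBy_lt {N n : ℕ} (hn : n < N) (x : Arrow × Letter) : shiftBy N n x < N := by
  unfold shiftBy
  split
  · exact Nat.mod_lt _ (by omega)
  · exact Nat.mod_lt _ (by omega)
  · exact hn

/-- The configuration denoted by a partially decoded one, up to a displacement of one
exceptional configuration. -/
def semShift {ℓ : ℕ} (k n : ℕ) (s : Arrow) (a : Letter) (t : List Letter) (p : ZMod ℓ) :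
    WConf ℓ :=
  sem k n s a t (p + if s = .rf ∧ a = 0 ∧ n = 0 ∧ ∀ z ∈ t, z = 0 then 1 else 0)

lemma decode_eq_true_iff (s : Arrow) (a d : Letter) :
    (decode s a d).1 = .rf ∧ (decode s a d).2.2.1 = 0 ∧ (decode s a d).2.1 = 0 ∧
      (decode s a d).2.2.2 = true ↔ s = .rf ∧ a = 0 ∧ d = 0 := by
  cases s <;> revert a d <;> decide

lemma decode_of_eq_false (s : Arrow) (a d : Letter) (h : (decode s a d).2.2.2 = false) :
    ¬ ((decode s a d).1 = .rf ∧ (decode s a d).2.1 = 0) ∧ ¬ (s = .rf ∧ a = 0 ∧ d = 0) := by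
  revert h; cases s <;> revert a d <;> decide

lemma exch_eq_iff (top bot : Prop) [Decidable top] [Decidable bot] (s : Arrow) (a : Letter) :
    ((exch top bot s a).1 = .rf ∧ (exch top bot s a).2 = 0) ↔ (s = .rf ∧ a = 0) := by
  by_cases h1 : top <;> by_cases h2 : bot <;> simp only [exch, h1, h2, if_true, if_false] <;>
    cases s <;> rcases letter_cases a with rfl | rfl | rfl <;> decide

/-- `semShift` of a decoded configuration. -/
def semShiftDecoded {ℓ : ℕ} (k n : ℕ) (t : List Letter) (p : ZMod ℓ) :
    Arrow × Letter × Letter × Bool → WConf ℓ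
  | (s, a, b, true) => semShift k n s b (t ++ [a]) (p + 1)
  | (s, a, b, false) => semShift k n s a (b :: t) p

lemma semDecoded_decode {ℓ : ℕ} (k n : ℕ) (t : List Letter) (p : ZMod ℓ) (s : Arrow)
    (a d : Letter) :
    semDecoded k n t (p + if s = .rf ∧ a = 0 ∧ d = 0 ∧ n = 0 ∧ ∀ z ∈ t, z = 0 then 1 else 0)
      (decode s a d) = semShiftDecoded k n t p (decode s a d) := by
  have h1 := decode_eq_true_iff s a d
  have h2 := decode_of_eq_false s a d
  generalize decode s a d = D at *
  obtain ⟨s', a', b', f⟩ := D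
  cases f
  · have h2 := h2 rfl
    simp only [semDecoded, semShiftDecoded, semShift]
    rw [if_neg (by tauto), if_neg (by simp only at h2; tauto)]
  · simp only [semDecoded, semShiftDecoded, semShift]
    have : (s' = .rf ∧ b' = 0 ∧ n = 0 ∧ ∀ z ∈ t ++ [a'], z = 0) ↔
        (s = .rf ∧ a = 0 ∧ d = 0 ∧ n = 0 ∧ ∀ z ∈ t, z = 0) := by
      simp only [List.mem_append, List.mem_singleton, or_imp, forall_and, forall_eq]
      simp only [and_true] at h1
      tauto
    simp only [this]
    congr 1
    ring

lemma levelGate_conf {ℓ : ℕ} [NeZero ℓ] (k n : ℕ) (hn : n < 3 ^ (k + 1)) (s : Arrow) (a : Letter)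
    (t : List Letter) (p : ZMod ℓ) (hR : (a :: (digs (k + 1) n ++ t)).length = ℓ) :
    ∃ m < 3 ^ k, ∃ x, levelGate k (conf s (a :: (digs (k + 1) n ++ t)) p) =
        confDecoded (digs k m) t p x ∧
      semShift (k + 1) n s a t p = semShiftDecoded k m t p x := by
  set y := exch (n = 3 ^ (k + 1) - 1) (n = 0) s a with hy
  set n' := shiftBy (3 ^ (k + 1)) n y with hn'
  have hlt : n' < 3 ^ (k + 1) := shiftBy_lt hn y
  have h0 : 0 < 3 ^ k := by positivity
  have hd : n' / 3 ^ k < 3 := by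
    rw [Nat.div_lt_iff_lt_mul h0]; rw [pow_succ] at hlt; omega
  obtain ⟨d, hdd⟩ : ∃ d : Letter, d.val = n' / 3 ^ k := ⟨⟨_, hd⟩, rfl⟩
  have hsplit : n' = n' % 3 ^ k + 3 ^ k * d := by rw [hdd, Nat.mod_add_div]
  have hdigs : digs (k + 1) n' = digs k (n' % 3 ^ k) ++ [d] := by
    rw [digs, digs_mod, ← hdd, letterOf_letter]
  refine ⟨n' % 3 ^ k, Nat.mod_lt _ h0, decode y.1 y.2 d, ?_, ?_⟩
  · have hlen : (y.2 :: (digs (k + 1) n' ++ t)).length = ℓ := by simpa using hR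
    have hlen' : (y.2 :: (digs (k + 1) n ++ t)).length = ℓ := by simpa using hR
    rw [levelGate, ← mul_assoc, ← mul_assoc, ← mul_assoc, Equiv.Perm.mul_apply,
      Equiv.Perm.mul_apply, exchGate_conf _ _ hn _ _ _ _ hR, ← hy,
      shiftGate_conf _ _ _ _ _ _ hn hlen', Prod.mk.eta, ← hn', hdigs, List.append_assoc,
      List.singleton_append, mul_assoc, decodeLevel_conf _ _ _ _ _ _ _ (by simp)
      (by rw [hdigs] at hlen; simpa using hlen)]
  · have hiff : (s = .rf ∧ a = 0 ∧ n = 0 ∧ ∀ z ∈ t, z = 0) ↔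
        (y.1 = .rf ∧ y.2 = 0 ∧ d = 0 ∧ n' % 3 ^ k = 0 ∧ ∀ z ∈ t, z = 0) := by
      have hex := exch_eq_iff (n = 3 ^ (k + 1) - 1) (n = 0) s a
      rw [← hy] at hex
      have hnn : y.1 = .rf ∧ y.2 = 0 → n' = n := by
        rintro ⟨h1, h2⟩
        rw [hn', show y = (.rf, 0) from Prod.ext h1 h2]
        rfl
      have hz : n' = 0 ↔ (d = 0 ∧ n' % 3 ^ k = 0) := by
        constructor
        · intro h
          rw [h, Nat.zero_div] at hdd
          exact ⟨Fin.ext hdd, by simp [h]⟩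
        · rintro ⟨h1, h2⟩
          rw [hsplit, h2, h1]; simp
      constructor
      · rintro ⟨h1, h2, h3, h4⟩
        have h5 := hex.2 ⟨h1, h2⟩
        have h6 := hz.1 ((hnn h5).trans h3)
        exact ⟨h5.1, h5.2, h6.1, h6.2, h4⟩
      · rintro ⟨h1, h2, h3, h4, h5⟩
        have h6 := hex.1 ⟨h1, h2⟩
        exact ⟨h6.1, h6.2, (hnn ⟨h1, h2⟩).symm.trans (hz.2 ⟨h3, h4⟩), h5⟩
    rw [← semDecoded_decode, semShift, ← semPre_exch k n hn, ← hy, ← hn', hsplit,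
      semPre_eq_semDecoded k _ (Nat.mod_lt _ h0), ← hsplit]
    simp only [hiff]

/-- If a permutation computes `semShift` at one level, it does so at the next one after
decoding. -/
lemma mul_levelGate_conf {ℓ : ℕ} [NeZero ℓ] (k : ℕ) (Ψ : Equiv.Perm (Conf Arrow ℓ))
    (hΨ : ∀ n < 3 ^ k, ∀ s a t (p : ZMod ℓ), (a :: (digs k n ++ t)).length = ℓ →
      Ψ (conf s (a :: (digs k n ++ t)) p) = wconf (semShift k n s a t p))
    (n : ℕ) (hn : n < 3 ^ (k + 1)) (s : Arrow) (a : Letter)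
    (t : List Letter) (p : ZMod ℓ) (hR : (a :: (digs (k + 1) n ++ t)).length = ℓ) :
    (Ψ * levelGate k : Equiv.Perm (Conf Arrow ℓ)) (conf s (a :: (digs (k + 1) n ++ t)) p) =
      wconf (semShift (k + 1) n s a t p) := by
  obtain ⟨m, hm, ⟨s', a', b', f⟩, h1, h2⟩ := levelGate_conf k n hn s a t p hR
  rw [Equiv.Perm.mul_apply, h1, h2]
  cases f
  · exact hΨ m hm _ _ _ _ (by simp at hR ⊢; omega)
  · exact hΨ m hm _ _ _ _ (by simp at hR ⊢; omega)

/-- The last level of decoding. -/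
noncomputable def lastGate {ℓ : ℕ} (k : ℕ) : Equiv.Perm (Conf Arrow ℓ) :=
  gate1 1 1 0 recode⁻¹ * (forward k * gate1 1 1 0 decodeLastGate)

lemma lastGate_conf {ℓ : ℕ} [NeZero ℓ] (k : ℕ) (s : Arrow) (d : Letter) (u : List Letter)
    (p : ZMod ℓ) (hu : u.length = k) (hR : (d :: u).length = ℓ) :
    lastGate k (conf s (d :: u) p) = conf (decodeLast s d).1 ((decodeLast s d).2.1 :: u)
      (if (decodeLast s d).2.2 then p + 1 else p) := by
  rw [lastGate, Equiv.Perm.mul_apply, Equiv.Perm.mul_apply, gate1_univ_conf _ _ _ _ hR]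
  have e : decodeLastGate (s, d) = recode ((decodeLast s d).1, (decodeLast s d).2.1) := rfl
  rw [e]
  have hrt := recode_isRt_of_decodeLast s d
  generalize decodeLast s d = D at *
  obtain ⟨s', a', f⟩ := D
  cases f
  · rw [forward_conf_left _ hrt _ _ _ hu.ge (by simpa using hR),
      gate1_univ_conf _ _ _ _ (by simpa using hR)]
    simp
  · rw [forward_conf_full _ hrt _ _ _ hu (by simpa using hR),
      gate1_univ_conf _ _ _ _ (by simpa using hR)]
    simp

lemma decodeLast_eq_iff (s : Arrow) (d : Letter) :
    ((decodeLast s d).1 = .rf ∧ (decodeLast s d).2.1 = 0) ↔ (s = .rf ∧ d = 0) := by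
  cases s <;> revert d <;> decide

lemma mul_lastGate_conf {ℓ : ℕ} [NeZero ℓ] (k : ℕ) (Ψ : Equiv.Perm (Conf Arrow ℓ))
    (hΨ : ∀ n < 3 ^ k, ∀ s a t (p : ZMod ℓ), (a :: (digs k n ++ t)).length = ℓ →
      Ψ (conf s (a :: (digs k n ++ t)) p) = wconf (semShift k n s a t p))
    (n : ℕ) (hn : n < 3 ^ k) (s : Arrow) (d : Letter) (p : ZMod ℓ) (hk : k + 1 = ℓ) :
    (Ψ * lastGate k : Equiv.Perm (Conf Arrow ℓ)) (conf s (d :: digs k n) p) =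
      wconf (smartTwo^[n + 3 ^ k * d] (inflate^[k + 1]
        (s, [], p + if s = .rf ∧ n + 3 ^ k * d.val = 0 then 1 else 0))) := by
  have h0 : 3 ^ k ≠ 0 := by positivity
  have := hΨ n hn (decodeLast s d).1 (decodeLast s d).2.1 []
    (if (decodeLast s d).2.2 then p + 1 else p) (by simpa using hk)
  rw [List.append_nil] at this
  rw [Equiv.Perm.mul_apply, lastGate_conf _ _ _ _ _ (by simp) (by simpa using hk), this,
    smartTwo_iterate_inflate_eq_sem k n hn, semShift]
  have hiff : ((decodeLast s d).1 = .rf ∧ (decodeLast s d).2.1 = 0 ∧ n = 0 ∧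
      ∀ z ∈ ([] : List Letter), z = 0) ↔ (s = .rf ∧ n + 3 ^ k * d.val = 0) := by
    have h1 := decodeLast_eq_iff s d
    have h2 : d = 0 ↔ d.val = 0 := Fin.ext_iff
    simp only [List.not_mem_nil, false_imp_iff, implies_true, and_true, Nat.add_eq_zero_iff,
      Nat.mul_eq_zero, h0, false_or, ← h2]
    tauto
  simp only [hiff]
  congr 2
  split_ifs <;> ring

/-! ### The jump of the head -/

/-- The head letter is nonzero and the `j` following letters are zero. -/
def ZerosAfter {ℓ : ℕ} (j : ℕ) (r : ZMod ℓ → Letter) : Prop :=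
  r 0 ≠ 0 ∧ ∀ i : ℕ, 1 ≤ i → i ≤ j → r i = 0

/-- The exchange of the two right arrows on a nonzero letter, when the other letter is zero. -/
def flipRt : Equiv.Perm (Arrow × Letter × Letter) where
  toFun y := if y.2.1 ≠ 0 ∧ y.2.2 = 0 then (Equiv.swap Arrow.rf Arrow.rh y.1, y.2) else y
  invFun y := if y.2.1 ≠ 0 ∧ y.2.2 = 0 then (Equiv.swap Arrow.rf Arrow.rh y.1, y.2) else y
  left_inv y := by by_cases h : y.2.1 ≠ 0 ∧ y.2.2 = 0 <;> simp [h]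
  right_inv y := by by_cases h : y.2.1 ≠ 0 ∧ y.2.2 = 0 <;> simp [h]

/-- The exchange of the two right arrows on a nonzero letter followed by `j` zeros. -/
noncomputable def flipGate {ℓ : ℕ} (j : ℕ) : Equiv.Perm (Conf Arrow ℓ) := gate2 1 j 0 j flipRt

open Classical in
lemma flipGate_apply {ℓ j : ℕ} (hj0 : 0 < j) (hj : j < ℓ) (s : Arrow) (r : ZMod ℓ → Letter)
    (p : ZMod ℓ) : flipGate j (s, r, p) =
      if ZerosAfter j r then (Equiv.swap Arrow.rf Arrow.rh s, r, p) else (s, r, p) := by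
  have hu : ∀ s' : Arrow, (s', Function.update (Function.update r 0 (r 0)) j (r j), p) =
      (s', r, p) := fun s' => by
    rw [Function.update_eq_self, Function.update_eq_self]
  have hA : ZerosAfter j r ↔ r ∈ cellsEq 1 j 0 ∧ (r 0 ≠ 0 ∧ r j = 0) := by
    constructor
    · rintro ⟨h0, h⟩
      exact ⟨fun i hi hi' => h i hi hi'.le, h0, h j hj0 le_rfl⟩
    · rintro ⟨h, h0, h1⟩
      refine ⟨h0, fun i hi hi' => ?_⟩
      rcases hi'.lt_or_eq with hi' | rfl
      · exact h i hi hi'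
      · exact h1
  rw [flipGate, gate2_apply le_rfl le_rfl hj0 hj]
  by_cases h1 : r ∈ cellsEq 1 j 0
  · by_cases h2 : r 0 ≠ 0 ∧ r j = 0
    · have e : flipRt (s, r 0, r j) = (Equiv.swap Arrow.rf Arrow.rh s, r 0, r j) := if_pos h2
      rw [if_pos h1, if_pos (hA.2 ⟨h1, h2⟩), e, hu]
    · have e : flipRt (s, r 0, r j) = (s, r 0, r j) := if_neg h2
      rw [if_pos h1, if_neg (fun h => h2 (hA.1 h).2), e, hu]
  · rw [if_neg h1, if_neg (fun h => h1 (hA.1 h).1)]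

/-- The exchange of the two right arrows after a nonzero letter followed by zeros. -/
noncomputable def flipBack {ℓ : ℕ} (j : ℕ) : Equiv.Perm (Conf Arrow ℓ) :=
  mvs (fun _ => true) ^ j * flipGate j * (mvs (fun _ => true) ^ j)⁻¹

/-- The exchange of `▶` at a nonzero letter followed by zeros with `▷` after these. -/
noncomputable def flipAcross {ℓ : ℕ} (j : ℕ) : Equiv.Perm (Conf Arrow ℓ) :=
  mvs (fun s => decide (s = Arrow.rh)) ^ j * flipGate j *
    (mvs (fun s => decide (s = Arrow.rh)) ^ j)⁻¹

/-- The exchange of `▶` at a nonzero letter followed by `j` zeros with `▶` at the last one of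
these. -/
noncomputable def slide {ℓ : ℕ} (j : ℕ) : Equiv.Perm (Conf Arrow ℓ) :=
  flipBack j * (flipAcross j * flipBack j)

open Classical in
lemma flipBack_apply {ℓ j : ℕ} (hj0 : 0 < j) (hj : j < ℓ) (s : Arrow) (r : ZMod ℓ → Letter)
    (p : ZMod ℓ) : flipBack j (s, r, p) = if ZerosAfter j (fun i : ZMod ℓ => r (i - j)) then
      (Equiv.swap Arrow.rf Arrow.rh s, r, p) else (s, r, p) := by
  rw [flipBack, Equiv.Perm.mul_apply, Equiv.Perm.mul_apply, mvs_pow_inv_apply, if_pos rfl,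
    flipGate_apply hj0 hj, mvs_pow_apply, if_pos rfl]
  split_ifs <;> simp

open Classical in
lemma flipAcross_apply_rf {ℓ j : ℕ} (hj0 : 0 < j) (hj : j < ℓ) (r : ZMod ℓ → Letter)
    (p : ZMod ℓ) : flipAcross j (.rf, r, p) = if ZerosAfter j r then
      (.rh, fun i => r (i + j), p + j) else (.rf, r, p) := by
  rw [flipAcross, Equiv.Perm.mul_apply, Equiv.Perm.mul_apply, mvs_pow_inv_apply,
    if_neg (by simp), flipGate_apply hj0 hj, mvs_pow_apply]
  split_ifs <;> simp_all

open Classical in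
lemma flipAcross_apply_rh {ℓ j : ℕ} (hj0 : 0 < j) (hj : j < ℓ) (r : ZMod ℓ → Letter)
    (p : ZMod ℓ) : flipAcross j (.rh, r, p) = if ZerosAfter j (fun i : ZMod ℓ => r (i - j)) then
      (.rf, fun i => r (i - j), p - j) else (.rh, r, p) := by
  rw [flipAcross, Equiv.Perm.mul_apply, Equiv.Perm.mul_apply, mvs_pow_inv_apply,
    if_pos (by simp), flipGate_apply hj0 hj, mvs_pow_apply]
  split_ifs <;> simp_all

lemma flipAcross_apply_left {ℓ j : ℕ} (hj0 : 0 < j) (hj : j < ℓ) (s : Arrow)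
    (hs : s.isRt = false) (r : ZMod ℓ → Letter) (p : ZMod ℓ) :
    flipAcross j (s, r, p) = (s, r, p) := by
  have h1 : s ≠ .rf := by rintro rfl; cases hs
  have h2 : s ≠ .rh := by rintro rfl; cases hs
  rw [flipAcross, Equiv.Perm.mul_apply, Equiv.Perm.mul_apply, mvs_pow_inv_apply,
    if_neg (by simpa using h2), flipGate_apply hj0 hj, Equiv.swap_apply_of_ne_of_ne h1 h2, ite_self,
    mvs_pow_apply, if_neg (by simpa using h2)]

lemma ZerosAfter.not_before {ℓ j : ℕ} (hj0 : 0 < j) {r : ZMod ℓ → Letter} (h : ZerosAfter j r) :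
    ¬ ZerosAfter j (fun i : ZMod ℓ => r (i - j)) := by
  intro h'
  have := h'.2 j hj0 le_rfl
  simp only [sub_self] at this
  exact h.1 this

lemma slide_of_zerosAfter {ℓ j : ℕ} (hj0 : 0 < j) (hj : j < ℓ) (r : ZMod ℓ → Letter)
    (p : ZMod ℓ) (h : ZerosAfter j r) :
    slide j (.rf, r, p) = (.rf, fun i => r (i + j), p + j) := by
  rw [slide, Equiv.Perm.mul_apply, Equiv.Perm.mul_apply, flipBack_apply hj0 hj _ r,
    if_neg (h.not_before hj0), flipAcross_apply_rf hj0 hj, if_pos h, flipBack_apply hj0 hj,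
    if_pos (by simpa using h)]
  simp

lemma slide_of_zerosBefore {ℓ j : ℕ} (hj0 : 0 < j) (hj : j < ℓ) (r : ZMod ℓ → Letter)
    (p : ZMod ℓ) (h : ZerosAfter j (fun i : ZMod ℓ => r (i - j))) :
    slide j (.rf, r, p) = (.rf, fun i => r (i - j), p - j) := by
  rw [slide, Equiv.Perm.mul_apply, Equiv.Perm.mul_apply, flipBack_apply hj0 hj _ r, if_pos h,
    Equiv.swap_apply_left, flipAcross_apply_rh hj0 hj, if_pos h, flipBack_apply hj0 hj,
    if_neg (h.not_before hj0)]

lemma slide_of_not {ℓ j : ℕ} (hj0 : 0 < j) (hj : j < ℓ) (r : ZMod ℓ → Letter)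
    (p : ZMod ℓ) (h : ¬ ZerosAfter j r) (h' : ¬ ZerosAfter j (fun i : ZMod ℓ => r (i - j))) :
    slide j (.rf, r, p) = (.rf, r, p) := by
  rw [slide, Equiv.Perm.mul_apply, Equiv.Perm.mul_apply, flipBack_apply hj0 hj _ r, if_neg h',
    flipAcross_apply_rf hj0 hj, if_neg h, flipBack_apply hj0 hj, if_neg h']

lemma slide_of_ne {ℓ j : ℕ} (hj0 : 0 < j) (hj : j < ℓ) (s : Arrow) (hs : s ≠ .rf)
    (r : ZMod ℓ → Letter) (p : ZMod ℓ) : slide j (s, r, p) = (s, r, p) := by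
  rw [slide, Equiv.Perm.mul_apply, Equiv.Perm.mul_apply, flipBack_apply hj0 hj _ r]
  by_cases hrh : s = .rh
  · subst hrh
    rw [Equiv.swap_apply_right]
    split_ifs with h
    · rw [flipAcross_apply_rf hj0 hj, if_neg (fun h' => h'.not_before hj0 h),
        flipBack_apply hj0 hj, if_pos h, Equiv.swap_apply_left]
    · rw [flipAcross_apply_rh hj0 hj, if_neg h, flipBack_apply hj0 hj, if_neg h]
  · rw [Equiv.swap_apply_of_ne_of_ne hs hrh, ite_self, flipAcross_apply_left hj0 hj _ _ _ _,
      flipBack_apply hj0 hj, Equiv.swap_apply_of_ne_of_ne hs hrh, ite_self]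
    cases s <;> simp_all [Arrow.isRt]

/-- The composition of all slides up to `n`, the longest one being applied first. -/
noncomputable def slides {ℓ : ℕ} : ℕ → Equiv.Perm (Conf Arrow ℓ)
  | 0 => 1
  | n + 1 => slides n * slide (n + 1)

lemma slides_of_ne {ℓ n : ℕ} (hn : n < ℓ) (s : Arrow) (hs : s ≠ .rf)
    (r : ZMod ℓ → Letter) (p : ZMod ℓ) : slides n (s, r, p) = (s, r, p) := by
  induction n with
  | zero => rfl
  | succ n ih => rw [slides, Equiv.Perm.mul_apply, slide_of_ne (by omega) hn _ hs, ih (by omega)]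

lemma slides_of_zeros {ℓ n : ℕ} (hn : n < ℓ) (r : ZMod ℓ → Letter) (p : ZMod ℓ)
    (h : ∀ i : ℕ, i ≤ n → r (-i) = 0) : slides n (.rf, r, p) = (.rf, r, p) := by
  induction n with
  | zero => rfl
  | succ n ih =>
    rw [slides, Equiv.Perm.mul_apply, slide_of_not (by omega) hn, ih (by omega)
      fun i hi => h i (by omega)]
    · intro h'
      exact h'.1 (by simpa using h 0 (by omega))
    · intro h'
      refine h'.1 ?_
      beta_reduce
      rw [zero_sub]
      exact h (n + 1) le_rfl

lemma slides_of_ne_zero {ℓ n : ℕ} (hn : n < ℓ) (r : ZMod ℓ → Letter) (p : ZMod ℓ) (j : ℕ)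
    (hj : j ≤ n) (h : ZerosAfter j r) (h' : r (j + 1 : ℕ) ≠ 0 ∨ j = n) :
    slides n (.rf, r, p) = (.rf, fun i => r (i + j), p + j) := by
  induction n with
  | zero =>
    obtain rfl : j = 0 := by omega
    simp [slides]
  | succ n ih =>
    rw [slides, Equiv.Perm.mul_apply]
    rcases hj.lt_or_eq with hj | rfl
    · have hne : r (j + 1 : ℕ) ≠ 0 := h'.resolve_right (by omega)
      rw [slide_of_not (by omega) hn, ih (by omega) (by omega) (Or.inl hne)]
      · exact fun hz => hne (hz.2 (j + 1) (by omega) (by omega))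
      · intro hz
        have := hz.2 (n + 1) (by omega) le_rfl
        simp only [sub_self] at this
        exact h.1 this
    · rw [slide_of_zerosAfter (by omega) hn _ _ h, slides_of_zeros (by omega)]
      intro i hi
      have := h.2 (n + 1 - i) (by omega) (by omega)
      rw [Nat.cast_sub (by omega)] at this
      rw [neg_add_eq_sub]
      exact this

lemma slides_of_zero {ℓ n : ℕ} (hn : n < ℓ) (r : ZMod ℓ → Letter) (p : ZMod ℓ) (i : ℕ)
    (hi0 : 0 < i) (hi : i ≤ n) (h : r (-i) ≠ 0) (h' : ∀ m : ℕ, m < i → r (-m) = 0) :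
    slides n (.rf, r, p) = (.rf, fun i => r (i - 1), p - 1) := by
  have h0 : r 0 = 0 := by simpa using h' 0 hi0
  induction n with
  | zero => omega
  | succ n ih =>
    rw [slides, Equiv.Perm.mul_apply]
    rcases hi.lt_or_eq with hi | rfl
    · rw [slide_of_not (by omega) hn _ _ (fun hz => hz.1 h0), ih (by omega) (by omega)]
      intro hz
      have := hz.2 (n + 1 - i) (by omega) (by omega)
      beta_reduce at this
      rw [Nat.cast_sub (by omega), sub_sub_cancel_left] at this
      exact h this
    · have hz : ZerosAfter (n + 1) (fun i : ZMod ℓ => r (i - (n + 1 : ℕ))) := by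
        refine ⟨by simpa using h, fun m hm hm' => ?_⟩
        have := h' (n + 1 - m) (by omega)
        rwa [Nat.cast_sub hm', neg_sub] at this
      rw [slide_of_zerosBefore (by omega) hn _ _ hz,
        slides_of_ne_zero (by omega) _ _ n le_rfl ⟨hz.1, fun m hm hm' => hz.2 m hm (by omega)⟩
          (Or.inr rfl)]
      refine Prod.ext rfl (Prod.ext (funext fun m => ?_) ?_)
      · change r _ = r _
        push_cast
        congr 1
        ring
      · change p - _ + _ = p - 1
        push_cast
        ring

/-- The base of the decoding: `▶` on a nonzero letter jumps. -/
noncomputable def jumpGate {ℓ : ℕ} : Equiv.Perm (Conf Arrow ℓ) :=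
  mvs (fun s => decide (s = Arrow.rf)) * slides (ℓ - 1)

lemma mvs_pow_conf {ℓ : ℕ} [NeZero ℓ] (F : Arrow → Bool) (s : Arrow) (u v : List Letter)
    (p : ZMod ℓ) (hR : (u ++ v).length = ℓ) (hs : F s = true) :
    (mvs F ^ u.length) (conf s (u ++ v) p) = conf s (v ++ u) (p + (u.length : ZMod ℓ)) := by
  induction u generalizing v p with
  | nil => simp
  | cons a u ih =>
    rw [List.length_cons, pow_succ, Equiv.Perm.mul_apply, List.cons_append,
      mvs_conf_cons F s a _ p (by simpa using hR) hs, List.append_assoc,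
      ih (v ++ [a]) (p + 1) (by simp at hR ⊢; omega)]
    simp only [List.append_assoc, List.singleton_append, Nat.cast_add, Nat.cast_one]
    congr 1
    ring

lemma jumpGate_conf_jump {ℓ : ℕ} [NeZero ℓ] (a : Letter) (ha : a ≠ 0) (t : List Letter)
    (p : ZMod ℓ) (hR : (a :: t).length = ℓ) :
    jumpGate (conf .rf (a :: t) p) = wconf (jump a t p) := by
  set u := t.takeWhile (· = 0) with hu
  set v := t.dropWhile (· = 0) with hv
  have ht : t = u ++ v := (List.takeWhile_append_dropWhile).symm
  have hlen : u.length + v.length + 1 = ℓ := by rw [← hR, ht]; simp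
  have hz : ZerosAfter u.length (conf .rf (a :: t) p).2.1 := by
    refine ⟨by rwa [conf_head], fun i hi hi' => ?_⟩
    rw [conf_tape _ _ _ (by omega)]
    obtain ⟨i, rfl⟩ : ∃ m, i = m + 1 := ⟨i - 1, by omega⟩
    have hi' : i < u.length := by omega
    rw [List.getD_cons_succ, ht, List.getD_eq_getElem?_getD, List.getElem?_append_left hi',
      List.getElem?_eq_getElem hi', Option.getD_some]
    simpa using List.mem_takeWhile_imp (List.getElem_mem hi' : u[i] ∈ u)
  have hz' : (conf (ℓ := ℓ) .rf (a :: t) p).2.1 (u.length + 1 : ℕ) ≠ 0 ∨ u.length = ℓ - 1 := by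
    rcases hcase : v with _ | ⟨y, v'⟩
    · right; rw [hcase] at hlen; simp at hlen; omega
    · left
      rw [hcase] at hlen; simp at hlen
      rw [conf_tape _ _ _ (by omega), List.getD_cons_succ, ht, hcase]
      have : y ≠ 0 := by
        have h := List.head_dropWhile_not (fun z : Letter => decide (z = 0)) (l := t)
          (by rw [← hv, hcase]; simp)
        simp only [← hv, hcase] at h
        exact of_decide_eq_false h
      simpa [List.getD_eq_getElem?_getD] using this
  have hs := slides_of_ne_zero (n := ℓ - 1) (by omega) _ p u.length (by omega) hz hz'
  have hp := mvs_pow_apply (ℓ := ℓ) (fun s => decide (s = Arrow.rf)) u.length (conf .rf (a :: t) p)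
  rw [if_pos (by simp [conf])] at hp
  rw [jumpGate, Equiv.Perm.mul_apply]
  have e : slides (ℓ - 1) (conf .rf (a :: t) p) =
      (mvs (fun s => decide (s = Arrow.rf)) ^ u.length) (conf .rf (a :: t) p) := by
    rw [hp]; exact hs
  have h1 := mvs_pow_conf (ℓ := ℓ) (fun s => decide (s = Arrow.rf)) .rf (a :: u) v p
    (by simp; omega) (by simp)
  rw [List.cons_append, ← ht] at h1
  rw [e, ← Equiv.Perm.mul_apply, ← pow_succ']
  rw [List.length_cons] at h1
  rw [h1, wconf, jump]
  simp only [← hu, ← hv]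
  push_cast
  rw [add_assoc]

lemma jumpGate_conf {ℓ : ℕ} [NeZero ℓ] (s : Arrow) (a : Letter) (t : List Letter) (p : ZMod ℓ)
    (hR : (a :: t).length = ℓ) :
    jumpGate (conf s (a :: t) p) = wconf (semShift 0 0 s a t p) := by
  by_cases hs : s = .rf
  · subst hs
    rcases letter_cases a with rfl | rfl | rfl
    · have e : semShift 0 0 .rf 0 t p = (.rf, 0 :: t, p + if ∀ z ∈ t, z = 0 then 1 else 0) := by
        simp [semShift, sem]
      rw [e, jumpGate, Equiv.Perm.mul_apply]
      by_cases hall : ∀ z ∈ t, z = 0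
      · have hrep : t = List.replicate (ℓ - 1) 0 := by
          have := List.eq_replicate_of_mem hall
          rwa [show t.length = ℓ - 1 by simp at hR; omega] at this
        have htape : ∀ i, (conf .rf (0 :: t) p).2.1 i = 0 := by
          intro i
          change (0 :: t).getD _ 0 = 0
          rw [hrep, ← List.replicate_succ]
          simp [List.getD_eq_getElem?_getD, List.getElem?_replicate]
          split_ifs <;> rfl
        have := slides_of_zeros (n := ℓ - 1) (by simp at hR; omega) _ p fun i _ => htape (-i)
        have e2 : slides (ℓ - 1) (conf .rf (0 :: t) p) = conf .rf (0 :: t) p := this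
        rw [e2, mvs_conf_cons _ _ _ _ _ hR (by simp), if_pos hall, wconf, hrep,
          ← List.replicate_succ', List.replicate_succ]
      · rw [if_neg hall, add_zero]
        have hex : ∃ i : ℕ, (conf .rf (0 :: t) p).2.1 (-i) ≠ 0 := by
          by_contra hcon
          push Not at hcon
          refine hall fun z hz => ?_
          obtain ⟨i, hi, rfl⟩ := List.getElem_of_mem hz
          have := hcon (ℓ - (i + 1))
          rw [Nat.cast_sub (by simp at hR; omega), ZMod.natCast_self, zero_sub, neg_neg,
            conf_tape _ _ _ (by simp at hR; omega), List.getD_cons_succ,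
            List.getD_eq_getElem?_getD, List.getElem?_eq_getElem hi] at this
          exact this
        classical
        obtain ⟨hi, hmin⟩ : (conf .rf (0 :: t) p).2.1 (-(Nat.find hex : ℕ)) ≠ 0 ∧
            ∀ m : ℕ, m < Nat.find hex → (conf .rf (0 :: t) p).2.1 (-m) = 0 :=
          ⟨Nat.find_spec hex, fun m hm => by simpa using Nat.find_min hex hm⟩
        generalize Nat.find hex = i at hi hmin
        have hi0 : 0 < i := by
          rcases Nat.eq_zero_or_pos i with rfl | h
          · simp [conf_head] at hi
          · exact h
        have hil : i ≤ ℓ - 1 := by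
          by_contra hcon
          push Not at hcon
          have := hmin (i - ℓ) (by simp at hR; omega)
          rw [Nat.cast_sub (by omega), ZMod.natCast_self, sub_zero] at this
          exact hi this
        have := slides_of_zero (n := ℓ - 1) (by simp at hR; omega) _ p i hi0 hil hi hmin
        have e2 : slides (ℓ - 1) (conf .rf (0 :: t) p) =
            (mvs (fun s => decide (s = Arrow.rf)))⁻¹ (conf .rf (0 :: t) p) := by
          rw [mvs_inv_apply, if_pos (by simp [conf])]
          exact this
        rw [e2, ← Equiv.Perm.mul_apply, mul_inv_cancel, wconf]
        rfl
    · rw [jumpGate_conf_jump _ (by decide) _ _ hR]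
      simp [semShift, sem]
    · rw [jumpGate_conf_jump _ (by decide) _ _ hR]
      simp [semShift, sem]
  · have e : semShift 0 0 s a t p = (s, a :: t, p) := by
      rw [semShift, if_neg (fun h => hs h.1), add_zero]
      cases s
      · exact absurd rfl hs
      all_goals rcases letter_cases a with rfl | rfl | rfl <;> simp [sem]
    have := slides_of_ne (ℓ := ℓ) (n := ℓ - 1) (by simp at hR; omega) s hs
      (conf s (a :: t) p).2.1 p
    have e2 : slides (ℓ - 1) (conf s (a :: t) p) = conf s (a :: t) p := this
    rw [e, jumpGate, Equiv.Perm.mul_apply, e2, mvs_conf_of_eq_false _ _ _ _ (by simpa using hs),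
      wconf]

/-! ### The counter that linearises the dynamics -/

/-- The decoding of the first `k` digits. -/
noncomputable def psi {ℓ : ℕ} : ℕ → Equiv.Perm (Conf Arrow ℓ)
  | 0 => jumpGate
  | k + 1 => psi k * levelGate k

lemma psi_conf {ℓ : ℕ} [NeZero ℓ] (k n : ℕ) (hn : n < 3 ^ k) (s : Arrow) (a : Letter)
    (t : List Letter) (p : ZMod ℓ) (hR : (a :: (digs k n ++ t)).length = ℓ) :
    psi k (conf s (a :: (digs k n ++ t)) p) = wconf (semShift k n s a t p) := by
  induction k generalizing n s a t p with
  | zero =>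
    obtain rfl : n = 0 := by simpa using hn
    exact jumpGate_conf s a t p hR
  | succ k ih => exact mul_levelGate_conf k (psi k) ih n hn s a t p hR

/-- The cells hold the counter value `N`, whose most significant digit is under the head. -/
def enc {ℓ : ℕ} (k N : ℕ) (s : Arrow) (p : ZMod ℓ) : Conf Arrow ℓ :=
  conf s (letterOf (N / 3 ^ k) :: digs k N) p

/-- The counter value `N`, where the head moves by one cell at each overflow. -/
def count {ℓ : ℕ} (k N : ℕ) (s : Arrow) (p : ZMod ℓ) : Conf Arrow ℓ :=
  enc k N s (p + ((N / 3 ^ (k + 1) : ℕ) : ZMod ℓ) * s.dir)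

lemma enc_mod {ℓ : ℕ} (k N : ℕ) (s : Arrow) (p : ZMod ℓ) :
    enc k (N % 3 ^ (k + 1)) s p = enc k N s p := by
  conv_rhs => rw [← Nat.mod_add_div N (3 ^ (k + 1))]
  generalize N % 3 ^ (k + 1) = m
  generalize N / 3 ^ (k + 1) = q
  have e : m + 3 ^ (k + 1) * q = m + 3 ^ k * (3 * q) := by ring
  rw [enc, enc, e, digs_add_mul, Nat.add_mul_div_left _ _ (by positivity), letterOf_add_mul]

lemma exists_count {ℓ : ℕ} [NeZero ℓ] (k : ℕ) (hk : k + 1 = ℓ) (x : Conf Arrow ℓ) :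
    ∃ N s p, x = count k N s p := by
  obtain ⟨s, R, p, hR, rfl⟩ := exists_conf x
  obtain ⟨a, t, rfl⟩ : ∃ a t, R = a :: t := List.exists_cons_of_length_pos (by omega)
  obtain ⟨n, hn, h⟩ := exists_digs t
  have ht : t.length = k := by simp at hR; omega
  rw [ht] at hn h
  have ha := a.isLt
  refine ⟨n + 3 ^ k * a, s, p, ?_⟩
  have h0 : 0 < 3 ^ k := by positivity
  rw [count, Nat.div_eq_of_lt (a := n + 3 ^ k * a), enc, digs_add_mul,
    Nat.add_mul_div_left _ _ h0, Nat.div_eq_of_lt hn, zero_add, letterOf_letter, ← h]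
  · simp
  · rw [pow_succ]; nlinarith

/-- Addition of `3 ^ j` to the counter in the states given by `δ`. -/
noncomputable def bump {ℓ : ℕ} (δ : Arrow → Letter) (k j : ℕ) : Equiv.Perm (Conf Arrow ℓ) :=
  incr (fun s _ => δ s) (j + 1) (k - j) * gate1 (j + 1) (k + 1) 2
    { toFun := fun y => (y.1, y.2 + δ y.1)
      invFun := fun y => (y.1, y.2 - δ y.1)
      left_inv := fun y => by simp
      right_inv := fun y => by simp }

lemma digs_split {k j : ℕ} (hj : j ≤ k) (N : ℕ) :
    digs k N = digs j N ++ digs (k - j) (N / 3 ^ j) := by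
  rw [← digs_add, Nat.add_sub_cancel' hj]

lemma div_pow_split {k j : ℕ} (hj : j ≤ k) (N : ℕ) :
    N / 3 ^ k = N / 3 ^ j / 3 ^ (k - j) := by
  rw [Nat.div_div_eq_div_mul, ← pow_add, Nat.add_sub_cancel' hj]

lemma bump_enc {ℓ : ℕ} [NeZero ℓ] (δ : Arrow → Letter) {k j : ℕ} (hk : k + 1 = ℓ) (hj : j ≤ k)
    (N : ℕ) (s : Arrow) (p : ZMod ℓ) (hδ : δ s = 0 ∨ δ s = 1) :
    bump δ k j (enc k N s p) = enc k (N + 3 ^ j * (δ s).val) s p := by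
  have hR : ∀ x, (x :: (digs j N ++ (digs (k - j) (N / 3 ^ j) ++ []))).length = ℓ := by
    intro x; simp; omega
  have key := gate1_conf (ℓ := ℓ) (a := j + 1) (b := k + 1) (c := 2)
    (h := { toFun := fun y => (y.1, y.2 + δ y.1)
            invFun := fun y => (y.1, y.2 - δ y.1)
            left_inv := fun y => by simp
            right_inv := fun y => by simp })
    s (letterOf (N / 3 ^ k)) (digs j N) (digs (k - j) (N / 3 ^ j)) [] p (hR _) (by simp)
    (by simp; omega)
  have up := fun x => incr_conf (ℓ := ℓ) (fun s _ => δ s) (a := j + 1) (m := k - j) s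
    x (digs j N) (N / 3 ^ j) [] p (hR _) (by simp) hδ
  simp only [digs_eq_two_iff] at key
  rw [List.append_nil] at up
  simp only [List.append_nil] at key up
  have e0 : (N + 3 ^ j * (δ s).val) / 3 ^ j = N / 3 ^ j + (δ s).val :=
    Nat.add_mul_div_left _ _ (by positivity)
  have e : enc k (N + 3 ^ j * (δ s).val) s p =
      conf s (letterOf ((N / 3 ^ j + (δ s).val) / 3 ^ (k - j)) ::
        (digs j N ++ digs (k - j) (N / 3 ^ j + (δ s).val))) p := by
    rw [enc, digs_split hj, digs_add_mul, div_pow_split hj, e0]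
  rw [e, bump, Equiv.Perm.mul_apply, enc, digs_split hj, key, div_pow_split hj]
  rcases hδ with h | h
  · simp [h] at up
    simp [h, up]
  · simp [h] at up
    simp only [h, Fin.val_one]
    rw [letterOf_succ_div]
    split_ifs with hd
    · simp [h, up]
    · simp [up]

/-- The reversal of arrows. -/
def Arrow.flip : Arrow → Arrow
  | .rf => .lf
  | .lf => .rf
  | .rh => .lh
  | .lh => .rh

@[simp] lemma Arrow.flip_flip (s : Arrow) : s.flip.flip = s := by cases s <;> rfl

@[simp] lemma Arrow.flip_isRt (s : Arrow) : s.flip.isRt = !s.isRt := by cases s <;> rfl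

/-- The reversal of arrows on the given letters. -/
def flipOn (P : Letter → Bool) : Equiv.Perm (Arrow × Letter) where
  toFun y := if P y.2 then (y.1.flip, y.2) else y
  invFun y := if P y.2 then (y.1.flip, y.2) else y
  left_inv y := by by_cases h : P y.2 <;> simp [h]
  right_inv y := by by_cases h : P y.2 <;> simp [h]

/-- The displacement of the head in the direction of its arrow, when `O` reverses the arrow. -/
noncomputable def carry {ℓ : ℕ} (k : ℕ) (O : Equiv.Perm (Conf Arrow ℓ)) :
    Equiv.Perm (Conf Arrow ℓ) :=
  O * (forward k)⁻¹ * O⁻¹ * forward k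

lemma forward_enc {ℓ : ℕ} [NeZero ℓ] {k : ℕ} (hk : k + 1 = ℓ) (N : ℕ) (s : Arrow) (p : ZMod ℓ) :
    forward k (enc k N s p) = enc k N s (p + if s.isRt then 1 else 0) := by
  by_cases hs : s.isRt
  · rw [if_pos hs]
    exact forward_conf_full s hs _ _ p (by simp) (by simp [hk])
  · rw [if_neg hs, add_zero]
    exact forward_conf_left s (by simpa using hs) _ _ p (by simp) (by simp [hk])

lemma forward_inv_enc {ℓ : ℕ} [NeZero ℓ] {k : ℕ} (hk : k + 1 = ℓ) (N : ℕ) (s : Arrow)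
    (p : ZMod ℓ) : (forward k)⁻¹ (enc k N s p) = enc k N s (p - if s.isRt then 1 else 0) := by
  rw [Equiv.Perm.inv_eq_iff_eq, forward_enc hk, sub_add_cancel]

lemma carry_enc {ℓ : ℕ} [NeZero ℓ] {k : ℕ} (hk : k + 1 = ℓ) (N : ℕ)
    (O : Equiv.Perm (Conf Arrow ℓ)) (P : Prop) [Decidable P]
    (hO : ∀ s p, O (enc k N s p) = enc k N (if P then s.flip else s) p) (s : Arrow) (p : ZMod ℓ) :
    carry k O (enc k N s p) = enc k N s (p + if P then s.dir else 0) := by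
  have hO' : ∀ s p, O⁻¹ (enc k N s p) = enc k N (if P then s.flip else s) p := by
    intro s p
    rw [Equiv.Perm.inv_eq_iff_eq, hO]
    split_ifs <;> simp
  rw [carry, Equiv.Perm.mul_apply, Equiv.Perm.mul_apply, Equiv.Perm.mul_apply, forward_enc hk, hO',
    forward_inv_enc hk, hO]
  by_cases hP : P
  · cases h : s.isRt <;> simp [hP, Arrow.dir, h, sub_eq_add_neg]
  · simp [hP]

/-- The addition of `3 ^ j` to the counter, with overflow. -/
noncomputable def addGate {ℓ : ℕ} (k j : ℕ) : Equiv.Perm (Conf Arrow ℓ) :=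
  bump (fun _ => 1) k j * carry k (gate1 (j + 1) (k + 1) 2 (flipOn (fun a => decide (a = 2))))

lemma addGate_count {ℓ : ℕ} [NeZero ℓ] {k j : ℕ} (hk : k + 1 = ℓ) (hj : j ≤ k)
    (N : ℕ) (s : Arrow) (p : ZMod ℓ) :
    addGate k j (count k N s p) = count k (N + 3 ^ j) s p := by
  have hO : ∀ s (p : ZMod ℓ), gate1 (j + 1) (k + 1) 2 (flipOn (fun a => decide (a = 2)))
      (enc k N s p) = enc k N (if 3 ^ (k + 1 - j) ∣ N / 3 ^ j + 1 then s.flip else s) p := by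
    intro s p
    have key := gate1_conf (ℓ := ℓ) (a := j + 1) (b := k + 1) (c := 2)
      (h := flipOn (fun a => decide (a = 2)))
      s (letterOf (N / 3 ^ k)) (digs j N) (digs (k - j) (N / 3 ^ j)) [] p (by simp; omega)
      (by simp) (by simp; omega)
    rw [List.append_nil, ← digs_split hj] at key
    have hiff : 3 ^ (k + 1 - j) ∣ N / 3 ^ j + 1 ↔
        (∀ z ∈ digs (k - j) (N / 3 ^ j), z = 2) ∧ letterOf (N / 3 ^ k) = 2 := by
      rw [← digs_eq_two_iff, Nat.sub_add_comm hj, digs, ← div_pow_split hj]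
      simp [or_imp, forall_and]
    rw [enc, key]
    simp only [hiff]
    by_cases h1 : ∀ z ∈ digs (k - j) (N / 3 ^ j), z = 2
    · by_cases h2 : letterOf (N / 3 ^ k) = 2
      · rw [if_pos h1, if_pos ⟨h1, h2⟩, enc]
        simp [flipOn, h2]
      · rw [if_pos h1, if_neg (by tauto), enc]
        simp [flipOn, h2]
    · rw [if_neg h1, if_neg (by tauto), enc]
  have e : (N + 3 ^ j) / 3 ^ (k + 1) =
      N / 3 ^ (k + 1) + if 3 ^ (k + 1 - j) ∣ N / 3 ^ j + 1 then 1 else 0 := by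
    rw [div_pow_split (k := k + 1) (j := j) (by omega), Nat.add_div_right _ (by positivity),
      Nat.succ_div, ← div_pow_split (by omega)]
  rw [addGate, Equiv.Perm.mul_apply, count, carry_enc hk N _ _ hO, bump_enc _ hk hj _ _ _ (by simp),
    count, e]
  simp only [Fin.val_one, mul_one]
  congr 1
  split_ifs <;> push_cast <;> ring

/-- The addition of `3 ^ (k + 1)` to the counter. -/
noncomputable def turnGate {ℓ : ℕ} (k : ℕ) : Equiv.Perm (Conf Arrow ℓ) :=
  carry k (gate1 1 1 0 (flipOn (fun _ => true)))

lemma turnGate_count {ℓ : ℕ} [NeZero ℓ] {k : ℕ} (hk : k + 1 = ℓ)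
    (N : ℕ) (s : Arrow) (p : ZMod ℓ) :
    turnGate k (count k N s p) = count k (N + 3 ^ (k + 1)) s p := by
  rw [turnGate, count, carry_enc hk N _ True, if_pos trivial, count, ← enc_mod k (N + _),
    Nat.add_mod_right, enc_mod, Nat.add_div_right _ (by positivity)]
  · congr 1
    push_cast
    ring
  · intro s p
    rw [if_pos trivial, enc, gate1_univ_conf _ _ _ _ (by simp [hk])]
    simp [flipOn, enc]

/-- The decoding of the counter into the configuration reached after as many double steps. -/
noncomputable def decodeAll {ℓ : ℕ} (k : ℕ) : Equiv.Perm (Conf Arrow ℓ) :=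
  psi k * lastGate k * bump (fun s => if s = .rf then 1 else 0) k 0

lemma smartTwo_iterate_mul {ℓ : ℕ} (k q : ℕ) (s : Arrow) (p : ZMod ℓ) :
    smartTwo^[3 ^ (k + 1) * q] (inflate^[k + 1] (s, [], p)) =
      inflate^[k + 1] (s, [], p + (q : ZMod ℓ) * s.dir) := by
  induction q with
  | zero => simp
  | succ q ih =>
    rw [Nat.mul_succ, add_comm, Function.iterate_add_apply, ih, smartTwo_iterate_inflate_nil]
    congr 3
    push_cast
    ring

lemma psi_mul_lastGate_enc {ℓ : ℕ} [NeZero ℓ] {k : ℕ} (hk : k + 1 = ℓ) (N : ℕ)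
    (hN : N < 3 ^ (k + 1)) (s : Arrow) (p : ZMod ℓ) :
    (psi k * lastGate k : Equiv.Perm (Conf Arrow ℓ)) (enc k N s p) =
      wconf (smartTwo^[N] (inflate^[k + 1] (s, [], p + if s = .rf ∧ N = 0 then 1 else 0))) := by
  have h0 : 0 < 3 ^ k := by positivity
  have hd : N / 3 ^ k < 3 := by
    rw [Nat.div_lt_iff_lt_mul h0]; rw [pow_succ] at hN; omega
  have hv : (letterOf (N / 3 ^ k)).val = N / 3 ^ k := Nat.mod_eq_of_lt hd
  have := mul_lastGate_conf k (psi k) (psi_conf k) (N % 3 ^ k) (Nat.mod_lt _ h0) s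
    (letterOf (N / 3 ^ k)) p hk
  rw [digs_mod, hv, Nat.mod_add_div] at this
  exact this

lemma decodeAll_count {ℓ : ℕ} [NeZero ℓ] {k : ℕ} (hk : k + 1 = ℓ) (N : ℕ) (s : Arrow)
    (p : ZMod ℓ) : decodeAll k (count k N s p) =
      wconf (smartTwo^[N + if s = .rf then 1 else 0] (inflate^[k + 1] (s, [], p))) := by
  have h0 : 0 < 3 ^ (k + 1) := by positivity
  rw [decodeAll, Equiv.Perm.mul_apply, count, bump_enc _ hk (Nat.zero_le _) _ _ _
    (by split_ifs <;> simp), ← enc_mod, psi_mul_lastGate_enc hk _ (Nat.mod_lt _ h0)]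
  by_cases hs : s = .rf
  · subst hs
    simp only [if_true, true_and, pow_zero, one_mul, Fin.val_one]
    have hd : (Arrow.rf.dir : ZMod ℓ) = 1 := rfl
    conv_rhs => rw [← Nat.mod_add_div (N + 1) (3 ^ (k + 1)), Function.iterate_add_apply,
      smartTwo_iterate_mul]
    simp only [Nat.succ_div, Nat.dvd_iff_mod_eq_zero, hd]
    congr 5
    split_ifs <;> push_cast <;> ring
  · simp only [hs, if_false, false_and, pow_zero, one_mul, Fin.val_zero, add_zero]
    conv_rhs => rw [← Nat.mod_add_div N (3 ^ (k + 1)), Function.iterate_add_apply,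
      smartTwo_iterate_mul]

/-! ### The double step as a permutation -/

/-- The rewriting rule of SMART as a permutation. -/
noncomputable def smartPerm : Equiv.Perm (Arrow × Letter) :=
  Equiv.ofBijective (fun y => smartRule y.1 y.2)
    (Finite.injective_iff_bijective.1 (by unfold Function.Injective; decide +kernel))

/-- The double step of SMART from a matching state. -/
noncomputable def coreStep {ℓ : ℕ} : Equiv.Perm (Conf Arrow ℓ) :=
  (mvs (fun s => !s.isRt))⁻¹ * mvs Arrow.isRt * uni smartPerm

lemma uni_conf {ℓ : ℕ} [NeZero ℓ] (g : Equiv.Perm (Arrow × Letter)) (s : Arrow) (a : Letter)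
    (t : List Letter) (p : ZMod ℓ) :
    uni g (conf s (a :: t) p) = conf (g (s, a)).1 ((g (s, a)).2 :: t) p := by
  rw [uni_apply, conf_head]
  refine Prod.ext rfl (Prod.ext (funext fun i => ?_) rfl)
  obtain ⟨m, hm, rfl⟩ := exists_natCast i
  rcases m with _ | m
  · simp [conf]
  · have : ((m + 1 : ℕ) : ZMod ℓ) ≠ 0 := natCast_ne_zero_of_lt (by omega) hm
    simp only [Function.update_of_ne this]
    rw [conf_tape _ _ _ hm, conf_tape _ _ _ hm]
    simp

lemma coreStep_wconf {ℓ : ℕ} [NeZero ℓ] (w : WConf ℓ) (hw : w.2.1.length = ℓ) :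
    coreStep (wconf w) = wconf (smartTwo w) := by
  obtain ⟨s, R, p⟩ := w
  obtain ⟨a, t, rfl⟩ : ∃ a t, R = a :: t :=
    List.exists_cons_of_length_pos (by have := NeZero.pos ℓ; simp at hw; omega)
  rw [coreStep, Equiv.Perm.mul_apply, Equiv.Perm.mul_apply, wconf, uni_conf]
  have e : smartPerm (s, a) = smartRule s a := rfl
  simp only [e, smartTwo]
  generalize smartRule s a = y
  obtain ⟨s', b⟩ := y
  cases hs : s'.isRt
  · rw [mvs_conf_of_eq_false _ _ _ _ hs, if_neg (by simp [hs]), Equiv.Perm.inv_eq_iff_eq]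
    rcases List.eq_nil_or_concat t with rfl | ⟨u, z, rfl⟩
    · rw [wconf, rotR_singleton, mvs_conf_cons _ _ _ _ _ (by simpa using hw) (by simp [hs])]
      simp
    · rw [wconf, List.concat_eq_append, rotR_cons_concat,
        mvs_conf_cons _ _ _ _ _ (by simpa using hw) (by simp [hs])]
      simp
  · rw [mvs_conf_cons _ _ _ _ _ (by simpa using hw) hs, Equiv.Perm.inv_eq_iff_eq, if_pos rfl, wconf,
      mvs_conf_of_eq_false _ _ _ _ (by simp [hs])]

lemma length_smartTwo {ℓ : ℕ} (w : WConf ℓ) : (smartTwo w).2.1.length = w.2.1.length := by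
  obtain ⟨s, R, p⟩ := w
  rcases R with _ | ⟨a, t⟩
  · rfl
  · simp only [smartTwo]
    split_ifs
    · simp
    · simp [rotR]

lemma length_smartTwo_iterate {ℓ : ℕ} (n : ℕ) (w : WConf ℓ) :
    (smartTwo^[n] w).2.1.length = w.2.1.length := by
  induction n generalizing w with
  | zero => rfl
  | succ n ih => rw [Function.iterate_succ_apply, ih, length_smartTwo]

lemma length_inflate {ℓ : ℕ} (w : WConf ℓ) : (inflate w).2.1.length = w.2.1.length + 1 := by
  obtain ⟨s, R, p⟩ := w
  cases s <;> rcases R with _ | ⟨a, t⟩ <;> simp [inflate]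

lemma length_inflate_iterate {ℓ : ℕ} (n : ℕ) (w : WConf ℓ) :
    (inflate^[n] w).2.1.length = w.2.1.length + n := by
  induction n generalizing w with
  | zero => rfl
  | succ n ih => rw [Function.iterate_succ_apply, ih, length_inflate]; omega

/-- The double step in the coordinates of the counter. -/
noncomputable def counterStep {ℓ : ℕ} (k : ℕ) : Equiv.Perm (Conf Arrow ℓ) :=
  (decodeAll k)⁻¹ * coreStep * decodeAll k

lemma counterStep_count {ℓ : ℕ} [NeZero ℓ] {k : ℕ} (hk : k + 1 = ℓ) (N : ℕ) (s : Arrow)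
    (p : ZMod ℓ) : counterStep k (count k N s p) = count k (N + 1) s p := by
  rw [counterStep, Equiv.Perm.mul_apply, Equiv.Perm.mul_apply, decodeAll_count hk, coreStep_wconf _
    (by rw [length_smartTwo_iterate, length_inflate_iterate]; simpa using hk),
    Equiv.Perm.inv_eq_iff_eq, decodeAll_count hk, ← Function.iterate_succ_apply' smartTwo]
  congr 2
  omega

lemma counterStep_pow_count {ℓ : ℕ} [NeZero ℓ] {k : ℕ} (hk : k + 1 = ℓ) (m N : ℕ) (s : Arrow)
    (p : ZMod ℓ) : (counterStep k ^ m) (count k N s p) = count k (N + m) s p := by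
  induction m with
  | zero => rfl
  | succ m ih => rw [pow_succ', Equiv.Perm.mul_apply, ih, counterStep_count hk, add_assoc]

lemma perm_eq_of_count {ℓ : ℕ} [NeZero ℓ] {k : ℕ} (hk : k + 1 = ℓ)
    {f g : Equiv.Perm (Conf Arrow ℓ)} (h : ∀ N s p, f (count k N s p) = g (count k N s p)) :
    f = g := by
  refine Equiv.ext fun x => ?_
  obtain ⟨N, s, p, rfl⟩ := exists_count k hk x
  exact h N s p

lemma counterStep_pow_pow {ℓ : ℕ} [NeZero ℓ] {k j : ℕ} (hk : k + 1 = ℓ) (hj : j ≤ k) :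
    counterStep (ℓ := ℓ) k ^ 3 ^ j = addGate k j :=
  perm_eq_of_count hk fun N s p => by rw [counterStep_pow_count hk, addGate_count hk hj]

lemma counterStep_pow_full {ℓ : ℕ} [NeZero ℓ] {k : ℕ} (hk : k + 1 = ℓ) :
    counterStep (ℓ := ℓ) k ^ 3 ^ (k + 1) = turnGate k :=
  perm_eq_of_count hk fun N s p => by rw [counterStep_pow_count hk, turnGate_count hk]

lemma counterStep_pow_period {ℓ : ℕ} [NeZero ℓ] {k : ℕ} (hk : k + 1 = ℓ) :
    counterStep (ℓ := ℓ) k ^ (3 ^ (k + 1) * ℓ) = 1 :=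
  perm_eq_of_count hk fun N s p => by
    rw [counterStep_pow_count hk, Equiv.Perm.one_apply, count, count, ← enc_mod,
      Nat.add_mul_mod_self_left, enc_mod, Nat.add_mul_div_left _ _ (by positivity)]
    simp

lemma coreStep_pow {ℓ : ℕ} (k m : ℕ) : (coreStep ^ m : Equiv.Perm (Conf Arrow ℓ)) =
    decodeAll k * counterStep k ^ m * (decodeAll k)⁻¹ := by
  have : (counterStep k : Equiv.Perm (Conf Arrow ℓ)) =
      (decodeAll k)⁻¹ * coreStep * ((decodeAll k)⁻¹)⁻¹ := by rw [inv_inv, counterStep]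
  rw [this, conj_pow]
  group

/-! ### Costs -/

lemma sq_le_cube {ℓ : ℕ} (hℓ : 1 < ℓ) (C : ℕ) : C * ℓ ^ 2 ≤ C * ℓ ^ 3 :=
  Nat.mul_le_mul_left _ (Nat.pow_le_pow_right (by omega) (by omega))

lemma le_mul_cube {ℓ : ℕ} (hℓ : 1 < ℓ) (C : ℕ) : C ≤ C * ℓ ^ 3 :=
  Nat.le_mul_of_pos_right _ (by positivity)

lemma mul_mul_sq_le_cube {ℓ m : ℕ} (hm : m ≤ ℓ) (C : ℕ) : m * (C * ℓ ^ 2) ≤ C * ℓ ^ 3 := by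
  calc m * (C * ℓ ^ 2) ≤ ℓ * (C * ℓ ^ 2) := Nat.mul_le_mul_right _ hm
    _ = C * ℓ ^ 3 := by ring

lemma exists_coreCost_incr : ∃ C : ℕ, ∀ (ℓ : ℕ) [Fact (1 < ℓ)] (δ : Arrow → Letter → Letter)
    (a m : ℕ), a ≤ ℓ → m ≤ ℓ → CoreCost (ℓ := ℓ) (incr δ a m) (C * ℓ ^ 3) := by
  obtain ⟨C, hC⟩ := exists_coreCost_gate2
  refine ⟨C, fun ℓ hℓ δ a m ha hm => ?_⟩
  have : ∀ m, CoreCost (ℓ := ℓ) (incr δ a m) (m * (C * ℓ ^ 2)) := by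
    intro m
    induction m with
    | zero => exact CoreCost.one.mono (by simp)
    | succ m ih => exact (ih.mul (hC ℓ _ _ _ _ _ ha)).mono (by rw [Nat.succ_mul])
  exact (this m).mono (mul_mul_sq_le_cube hm C)

lemma exists_coreCost_forward : ∃ C : ℕ, ∀ (ℓ : ℕ) [Fact (1 < ℓ)] (k : ℕ), k ≤ ℓ →
    CoreCost (ℓ := ℓ) (forward k) (C * ℓ ^ 3) := by
  obtain ⟨C, hC⟩ := exists_coreCost_gate2
  refine ⟨C + 96, fun ℓ hℓ k hk => ?_⟩
  have : ∀ m ≤ ℓ, CoreCost (ℓ := ℓ) (bring m) (m * (C * ℓ ^ 2)) := by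
    intro m hm
    induction m with
    | zero => exact CoreCost.one.mono (by simp)
    | succ m ih =>
      exact ((hC ℓ _ _ _ _ _ hm).mul (ih (by omega))).mono (by rw [Nat.succ_mul, add_comm])
  refine (((this k hk).mono (mul_mul_sq_le_cube hk C)).mul (CoreCost.mvs _)).mono ?_
  rw [add_mul]
  exact Nat.add_le_add_left (le_mul_cube hℓ.1 _) _

lemma exists_coreCost_gate1_cube : ∃ C : ℕ, ∀ (ℓ : ℕ) [Fact (1 < ℓ)] (a b : ℕ) (c : Letter)
    (h : Equiv.Perm (Arrow × Letter)), a ≤ ℓ →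
    CoreCost (ℓ := ℓ) (gate1 a b c h) (C * ℓ ^ 3) := by
  obtain ⟨C, hC⟩ := exists_coreCost_gate1
  exact ⟨C, fun ℓ hℓ a b c h ha => (hC ℓ a b c h ha).mono (sq_le_cube hℓ.1 C)⟩

lemma exists_coreCost_levelGate : ∃ C : ℕ, ∀ (ℓ : ℕ) [Fact (1 < ℓ)] (k : ℕ), k < ℓ →
    CoreCost (ℓ := ℓ) (levelGate k) (C * ℓ ^ 3) := by
  obtain ⟨C₁, h₁⟩ := exists_coreCost_gate1_cube
  obtain ⟨C₂, h₂⟩ := exists_coreCost_gate2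
  obtain ⟨C₃, h₃⟩ := exists_coreCost_incr
  obtain ⟨C₄, h₄⟩ := exists_coreCost_forward
  refine ⟨3 * C₁ + C₂ + 2 * C₃ + C₄, fun ℓ hℓ k hk => ?_⟩
  have h1 : 1 ≤ ℓ := hℓ.1.le
  refine ((h₁ ℓ _ _ _ _ h1).mul ((h₄ ℓ k hk.le).mul
    (((h₂ ℓ _ _ _ _ _ hk).mono (sq_le_cube hℓ.1 C₂)).mul
      (((h₃ ℓ _ _ _ h1 hk).inv.mul (h₃ ℓ _ _ _ h1 hk)).mul
        ((h₁ ℓ _ _ _ _ h1).mul (h₁ ℓ _ _ _ _ h1)))))).mono (le_of_eq ?_)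
  ring

lemma exists_coreCost_lastGate : ∃ C : ℕ, ∀ (ℓ : ℕ) [Fact (1 < ℓ)] (k : ℕ), k < ℓ →
    CoreCost (ℓ := ℓ) (lastGate k) (C * ℓ ^ 3) := by
  obtain ⟨C₁, h₁⟩ := exists_coreCost_gate1_cube
  obtain ⟨C₂, h₂⟩ := exists_coreCost_forward
  refine ⟨2 * C₁ + C₂, fun ℓ hℓ k hk => ?_⟩
  have h1 : 1 ≤ ℓ := hℓ.1.le
  refine ((h₁ ℓ _ _ _ _ h1).mul ((h₂ ℓ k hk.le).mul (h₁ ℓ _ _ _ _ h1))).mono (le_of_eq ?_)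
  ring

lemma exists_coreCost_bump : ∃ C : ℕ, ∀ (ℓ : ℕ) [Fact (1 < ℓ)] (δ : Arrow → Letter) (k j : ℕ),
    k < ℓ → j ≤ k → CoreCost (ℓ := ℓ) (bump δ k j) (C * ℓ ^ 3) := by
  obtain ⟨C₁, h₁⟩ := exists_coreCost_gate1_cube
  obtain ⟨C₂, h₂⟩ := exists_coreCost_incr
  refine ⟨C₁ + C₂, fun ℓ hℓ δ k j hk hj => ?_⟩
  refine ((h₂ ℓ _ _ _ (by omega) (by omega)).mul (h₁ ℓ _ _ _ _ (by omega))).mono (le_of_eq ?_)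
  ring

lemma exists_coreCost_slide : ∃ C : ℕ, ∀ (ℓ : ℕ) [Fact (1 < ℓ)] (j : ℕ), j ≤ ℓ →
    CoreCost (ℓ := ℓ) (slide j) (C * ℓ ^ 2) := by
  obtain ⟨C, hC⟩ := exists_coreCost_gate2
  refine ⟨3 * (C + 192), fun ℓ hℓ j hj => ?_⟩
  have key : ∀ F, CoreCost (ℓ := ℓ) (mvs F ^ j * flipGate j * (mvs F ^ j)⁻¹)
      ((C + 192) * ℓ ^ 2) := by
    intro F
    refine (((CoreCost.mvs F).pow j).conj (hC ℓ 1 j 0 j flipRt hℓ.1.le)).mono ?_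
    nlinarith [hℓ.1]
  exact ((key _).mul ((key _).mul (key _))).mono (le_of_eq (by ring))

lemma exists_coreCost_jumpGate : ∃ C : ℕ, ∀ (ℓ : ℕ) [Fact (1 < ℓ)],
    CoreCost (ℓ := ℓ) jumpGate (C * ℓ ^ 3) := by
  obtain ⟨C, hC⟩ := exists_coreCost_slide
  refine ⟨96 + C, fun ℓ hℓ => ?_⟩
  have : ∀ m ≤ ℓ, CoreCost (ℓ := ℓ) (slides m) (m * (C * ℓ ^ 2)) := by
    intro m hm
    induction m with
    | zero => exact CoreCost.one.mono (by simp)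
    | succ m ih => exact ((ih (by omega)).mul (hC ℓ _ hm)).mono (by rw [Nat.succ_mul])
  refine ((CoreCost.mvs _).mul
    ((this (ℓ - 1) (by omega)).mono (mul_mul_sq_le_cube (by omega) C))).mono ?_
  rw [add_mul]
  exact Nat.add_le_add_right (le_mul_cube hℓ.1 _) _

lemma exists_coreCost_decodeAll : ∃ C : ℕ, ∀ (ℓ : ℕ) [Fact (1 < ℓ)] (k : ℕ), k < ℓ →
    CoreCost (ℓ := ℓ) (decodeAll k) (C * ℓ ^ 4) := by
  obtain ⟨C₁, h₁⟩ := exists_coreCost_jumpGate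
  obtain ⟨C₂, h₂⟩ := exists_coreCost_levelGate
  obtain ⟨C₃, h₃⟩ := exists_coreCost_lastGate
  obtain ⟨C₄, h₄⟩ := exists_coreCost_bump
  refine ⟨C₁ + C₂ + C₃ + C₄, fun ℓ hℓ k hk => ?_⟩
  have key : ∀ k ≤ ℓ, CoreCost (ℓ := ℓ) (psi k) (C₁ * ℓ ^ 3 + k * (C₂ * ℓ ^ 3)) := by
    intro k hk
    induction k with
    | zero => exact (h₁ ℓ).mono (by simp)
    | succ k ih =>
      exact ((ih (by omega)).mul (h₂ ℓ k hk)).mono (by rw [Nat.succ_mul, add_assoc])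
  refine (((key k hk.le).mul (h₃ ℓ k hk)).mul (h₄ ℓ _ k 0 hk (Nat.zero_le _))).mono ?_
  have h3 : ∀ C : ℕ, C * ℓ ^ 3 ≤ C * ℓ ^ 4 := fun C =>
    Nat.mul_le_mul_left _ (Nat.pow_le_pow_right (by have := hℓ.1; omega) (by omega))
  have h4 : k * (C₂ * ℓ ^ 3) ≤ C₂ * ℓ ^ 4 :=
    calc k * (C₂ * ℓ ^ 3) ≤ ℓ * (C₂ * ℓ ^ 3) := Nat.mul_le_mul_right _ hk.le
      _ = C₂ * ℓ ^ 4 := by ring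
  have := h3 C₁
  have := h3 C₃
  have := h3 C₄
  simp only [add_mul]
  omega

lemma exists_coreCost_addGate : ∃ C : ℕ, ∀ (ℓ : ℕ) [Fact (1 < ℓ)] (k : ℕ), k < ℓ →
    (∀ j ≤ k, CoreCost (ℓ := ℓ) (addGate k j) (C * ℓ ^ 3)) ∧
      CoreCost (ℓ := ℓ) (turnGate k) (C * ℓ ^ 3) := by
  obtain ⟨C₁, h₁⟩ := exists_coreCost_gate1_cube
  obtain ⟨C₂, h₂⟩ := exists_coreCost_forward
  obtain ⟨C₃, h₃⟩ := exists_coreCost_bump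
  refine ⟨2 * C₁ + 2 * C₂ + C₃, fun ℓ hℓ k hk => ?_⟩
  have key : ∀ O : Equiv.Perm (Conf Arrow ℓ), CoreCost O (C₁ * ℓ ^ 3) →
      CoreCost (carry k O) ((2 * C₁ + 2 * C₂) * ℓ ^ 3) := by
    intro O hO
    have hf := h₂ ℓ k hk.le
    exact (((hO.mul hf.inv).mul hO.inv).mul hf).mono (le_of_eq (by ring))
  refine ⟨fun j hj => ?_, ?_⟩
  · exact ((h₃ ℓ _ k j hk hj).mul (key _ (h₁ ℓ _ _ _ _ (by omega)))).mono (le_of_eq (by ring))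
  · exact (key _ (h₁ ℓ _ _ _ _ hℓ.1.le)).mono (Nat.mul_le_mul_right _ (by omega))

lemma CoreCost.pow_of_lt {ℓ c k : ℕ} {f : Equiv.Perm (Conf Arrow ℓ)}
    (h : ∀ j < k, CoreCost (f ^ 3 ^ j) c) {m : ℕ} (hm : m < 3 ^ k) :
    CoreCost (f ^ m) (2 * k * c) := by
  induction k generalizing m with
  | zero =>
    obtain rfl : m = 0 := by simpa using hm
    rw [pow_zero]
    exact CoreCost.one.mono (by simp)
  | succ k ih =>
    have h0 : 0 < 3 ^ k := by positivity
    have hd : m / 3 ^ k < 3 := by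
      rw [Nat.div_lt_iff_lt_mul h0]; rw [pow_succ] at hm; omega
    have h1 := ih (fun j hj => h j (by omega)) (Nat.mod_lt m h0)
    have h2 := (h k (by omega)).pow (m / 3 ^ k)
    have e : f ^ m = f ^ (m % 3 ^ k) * (f ^ 3 ^ k) ^ (m / 3 ^ k) := by
      rw [← pow_mul, ← pow_add, Nat.mod_add_div]
    rw [e]
    refine (h1.mul h2).mono ?_
    have : m / 3 ^ k * c ≤ 2 * c := Nat.mul_le_mul_right _ (by omega)
    calc 2 * k * c + m / 3 ^ k * c ≤ 2 * k * c + 2 * c := by omega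
      _ = 2 * (k + 1) * c := by ring

/-- All powers of the double step have cost `O(ℓ ^ 4)`. -/
lemma exists_coreCost_coreStep_pow : ∃ C : ℕ, ∀ (ℓ : ℕ) [Fact (1 < ℓ)] (m : ℕ),
    CoreCost (ℓ := ℓ) (coreStep ^ m) (C * ℓ ^ 4) := by
  obtain ⟨C₁, h₁⟩ := exists_coreCost_decodeAll
  obtain ⟨C₂, h₂⟩ := exists_coreCost_addGate
  refine ⟨2 * C₁ + 3 * C₂, fun ℓ hℓ m => ?_⟩
  obtain ⟨k, rfl⟩ : ∃ k, ℓ = k + 1 := ⟨ℓ - 1, by have := hℓ.1; omega⟩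
  obtain ⟨hadd, hturn⟩ := h₂ (k + 1) k (by omega)
  have hlow : ∀ m < 3 ^ (k + 1), CoreCost (ℓ := k + 1) (counterStep k ^ m)
      (2 * (k + 1) * (C₂ * (k + 1) ^ 3)) := fun m hm =>
    CoreCost.pow_of_lt (fun j hj => by
      rw [counterStep_pow_pow rfl (by omega)]
      exact hadd j (by omega)) hm
  have hpow : CoreCost (ℓ := k + 1) (counterStep k ^ m) (3 * C₂ * (k + 1) ^ 4) := by
    have e : (counterStep k : Equiv.Perm (Conf Arrow (k + 1))) ^ m =
        counterStep k ^ (m % 3 ^ (k + 1)) * turnGate k ^ (m / 3 ^ (k + 1) % (k + 1)) := by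
      rw [← counterStep_pow_full rfl, ← pow_mul, ← pow_add]
      conv_lhs => rw [← Nat.mod_add_div m (3 ^ (k + 1)),
        ← Nat.mod_add_div (m / 3 ^ (k + 1)) (k + 1), mul_add, ← add_assoc, pow_add, ← mul_assoc,
        pow_mul _ (_ * _), counterStep_pow_period rfl, one_pow, mul_one]
    rw [e]
    refine ((hlow _ (Nat.mod_lt _ (by positivity))).mul (hturn.pow _)).mono ?_
    have : m / 3 ^ (k + 1) % (k + 1) * (C₂ * (k + 1) ^ 3) ≤ (k + 1) * (C₂ * (k + 1) ^ 3) :=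
      Nat.mul_le_mul_right _ (Nat.mod_lt _ (by omega)).le
    calc _ ≤ 2 * (k + 1) * (C₂ * (k + 1) ^ 3) + (k + 1) * (C₂ * (k + 1) ^ 3) :=
          Nat.add_le_add_left this _
      _ = _ := by ring
  rw [coreStep_pow k]
  exact ((h₁ (k + 1) k (by omega)).conj hpow).mono (le_of_eq (by ring))

/-! ### The machine on configurations with duck zero -/

/-- The change of the head symbol in a step with duck zero, after the move. -/
noncomputable def stepRule : Equiv.Perm (DQ × Letter) where
  toFun y :=
    if y.1.2.1 = 0 then
      if y.1.1.2 = 0 then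
        ((((smartPerm (y.1.1.1, y.2)).1, 1), 0, y.1.2.2), (smartPerm (y.1.1.1, y.2)).2)
      else (((y.1.1.1, 0), 0, y.1.2.2), y.2)
    else y
  invFun y :=
    if y.1.2.1 = 0 then
      if y.1.1.2 = 1 then
        ((((smartPerm⁻¹ (y.1.1.1, y.2)).1, 0), 0, y.1.2.2), (smartPerm⁻¹ (y.1.1.1, y.2)).2)
      else (((y.1.1.1, 1), 0, y.1.2.2), y.2)
    else y
  left_inv := by
    rintro ⟨⟨⟨s, i⟩, d, g⟩, a⟩
    by_cases hd : d = 0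
    · subst hd
      fin_cases i <;> simp
    · simp [hd]
  right_inv := by
    rintro ⟨⟨⟨s, i⟩, d, g⟩, a⟩
    by_cases hd : d = 0
    · subst hd
      fin_cases i <;> simp
    · simp [hd]

/-- One step of the machine restricted to duck zero. -/
noncomputable def duckStep {ℓ : ℕ} : Equiv.Perm (Conf DQ ℓ) :=
  uni stepRule * ((mvs fun q => decide (q.1.2 = 1 ∧ q.2.1 = 0) && !q.1.1.isRt)⁻¹ *
    mvs fun q => decide (q.1.2 = 1 ∧ q.2.1 = 0) && q.1.1.isRt)

lemma duckStep_matching {ℓ : ℕ} (s : Arrow) (g : Fin 6) (r : ZMod ℓ → Letter) (p : ZMod ℓ) :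
    duckStep (((s, 0), 0, g), r, p) =
      ((((smartRule s (r 0)).1, 1), 0, g), Function.update r 0 (smartRule s (r 0)).2, p) := by
  rw [duckStep, Equiv.Perm.mul_apply, Equiv.Perm.mul_apply, mvs_apply, if_neg (by simp),
    mvs_inv_apply, if_neg (by simp), uni_apply]
  simp [stepRule, smartPerm]

lemma duckStep_move {ℓ : ℕ} (s : Arrow) (g : Fin 6) (r : ZMod ℓ → Letter) (p : ZMod ℓ) :
    duckStep (((s, 1), 0, g), r, p) =
      (((s, 0), 0, g), (fun i => r (i + s.dir)), p + s.dir) := by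
  rw [duckStep, Equiv.Perm.mul_apply, Equiv.Perm.mul_apply, mvs_apply]
  cases hs : s.isRt
  · rw [if_neg (by simp [hs]), mvs_inv_apply, if_pos (by simp [hs]), uni_apply]
    simp [stepRule, Arrow.dir, hs, sub_eq_add_neg]
  · rw [if_pos (by simp [hs]), mvs_inv_apply, if_neg (by simp [hs]), uni_apply]
    simp [stepRule, Arrow.dir, hs]

lemma duckStep_of_ne {ℓ : ℕ} (x : Conf DQ ℓ) (hx : x.1.2.1 ≠ 0) : duckStep x = x := by
  rw [duckStep, Equiv.Perm.mul_apply, Equiv.Perm.mul_apply, mvs_apply, if_neg (by simp [hx]),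
    mvs_inv_apply, if_neg (by simp [hx]), uni_apply]
  simp [stepRule, hx]

lemma duckStep_duck {ℓ : ℕ} (x : Conf DQ ℓ) (hx : x.1.2.1 = 0) : (duckStep x).1.2.1 = 0 := by
  obtain ⟨⟨⟨s, i⟩, d, g⟩, r, p⟩ := x
  obtain rfl : d = 0 := hx
  fin_cases i
  · exact congrArg (fun x => x.1.2.1) (duckStep_matching s g r p)
  · exact congrArg (fun x => x.1.2.1) (duckStep_move s g r p)

lemma duckStep_sub_ne {ℓ : ℕ} (x : Conf DQ ℓ) (hx : x.1.2.1 = 0) :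
    (duckStep x).1.1.2 ≠ x.1.1.2 := by
  obtain ⟨⟨⟨s, i⟩, d, g⟩, r, p⟩ := x
  obtain rfl : d = 0 := hx
  fin_cases i
  · exact fun h => one_ne_zero
      ((congrArg (fun x => x.1.1.2) (duckStep_matching s g r p)).symm.trans h)
  · exact fun h => zero_ne_one
      ((congrArg (fun x => x.1.1.2) (duckStep_move s g r p)).symm.trans h)

lemma duckStep_sq_apply {ℓ : ℕ} (x : Conf DQ ℓ) (hd : x.1.2.1 = 0) (hx : x.1.1.2 = 0) :
    (duckStep ^ 2) x = deco coreStep x := by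
  obtain ⟨⟨⟨s, i⟩, d, g⟩, r, p⟩ := x
  obtain rfl : d = 0 := hd
  obtain rfl : i = 0 := hx
  rw [pow_two, Equiv.Perm.mul_apply, duckStep_matching, duckStep_move, deco_apply,
    if_pos ⟨rfl, rfl⟩]
  have e : smartPerm (s, r 0) = smartRule s (r 0) := rfl
  have key : coreStep (s, r, p) = ((smartRule s (r 0)).1,
      (fun i : ZMod ℓ => Function.update r 0 (smartRule s (r 0)).2
        (i + (smartRule s (r 0)).1.dir)), p + (smartRule s (r 0)).1.dir) := by
    rw [coreStep, Equiv.Perm.mul_apply, Equiv.Perm.mul_apply, uni_apply, mvs_apply]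
    simp only [e]
    cases hs : (smartRule s (r 0)).1.isRt
    · rw [if_neg (by simp), mvs_inv_apply, if_pos (by simp [hs])]
      simp [Arrow.dir, hs, sub_eq_add_neg]
    · rw [if_pos rfl, mvs_inv_apply, if_neg (by simp [hs])]
      simp [Arrow.dir, hs]
  rw [key]

lemma deco_of_ne {ℓ : ℕ} (f : Equiv.Perm (Conf Arrow ℓ)) (x : Conf DQ ℓ)
    (h : x.1.1.2 ≠ 0 ∨ x.1.2.1 ≠ 0) : deco f x = x := by
  rw [deco_apply, if_neg (by tauto)]

lemma duckStep_pow_apply {ℓ : ℕ} (m : ℕ) (x : Conf DQ ℓ) (hd : x.1.2.1 = 0)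
    (hx : x.1.1.2 = 0) : (duckStep ^ (2 * m)) x = deco (coreStep ^ m) x ∧
      (deco (coreStep ^ m) x).1.2.1 = 0 ∧ (deco (coreStep ^ m) x).1.1.2 = 0 := by
  have h2 : ∀ f : Equiv.Perm (Conf Arrow ℓ),
      (deco f x).1.2.1 = 0 ∧ (deco f x).1.1.2 = 0 := by
    intro f
    rw [deco_apply, if_pos ⟨hx, hd⟩]
    exact ⟨rfl, rfl⟩
  refine ⟨?_, h2 _⟩
  induction m with
  | zero => simp
  | succ m ih =>
    rw [Nat.mul_succ, add_comm, pow_add, Equiv.Perm.mul_apply, ih,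
      duckStep_sq_apply _ (h2 _).1 (h2 _).2, pow_succ', map_mul, Equiv.Perm.mul_apply]

lemma duckStep_pow_two_mul {ℓ : ℕ} (m : ℕ) : (duckStep ^ (2 * m) : Equiv.Perm (Conf DQ ℓ)) =
    deco (coreStep ^ m) * (duckStep * deco (coreStep ^ m) * duckStep⁻¹) := by
  refine Equiv.ext fun x => ?_
  obtain ⟨y, rfl⟩ := duckStep.surjective x
  have hinv : (duckStep⁻¹ : Equiv.Perm (Conf DQ ℓ)) (duckStep y) = y := by
    rw [Equiv.Perm.inv_eq_iff_eq]
  simp only [Equiv.Perm.mul_apply]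
  rw [hinv]
  by_cases hd : y.1.2.1 = 0
  · have hd' := duckStep_duck y hd
    have hs := duckStep_sub_ne y hd
    by_cases hy : y.1.1.2 = 0
    · obtain ⟨h1, h2, h3⟩ := duckStep_pow_apply m y hd hy
      have hs' := duckStep_sub_ne _ h2
      rw [h3] at hs'
      rw [deco_of_ne _ (duckStep _) (Or.inl hs'), ← h1, ← Equiv.Perm.mul_apply,
        ← Equiv.Perm.mul_apply, (Commute.refl duckStep).pow_left (2 * m)]
    · rw [deco_of_ne _ y (Or.inl hy)]
      exact (duckStep_pow_apply m _ hd' (by omega)).1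
  · have h1 := duckStep_of_ne y hd
    rw [deco_of_ne _ y (Or.inr hd), h1, deco_of_ne _ y (Or.inr hd)]
    exact Equiv.Perm.pow_apply_eq_self_of_apply_eq_self h1 _

lemma cost_duckStep {ℓ : ℕ} [Fact (1 < ℓ)] : Cost (confGens ℓ) duckStep 193 :=
  (cost_uni _).mul ((cost_mvs _).inv.mul (cost_mvs _))

lemma exists_cost_duckStep_pow : ∃ C : ℕ, ∀ (ℓ : ℕ) [Fact (1 < ℓ)] (n : ℕ),
    Cost (confGens ℓ) (duckStep ^ n) (C * ℓ ^ 4) := by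
  obtain ⟨C, hC⟩ := exists_coreCost_coreStep_pow
  refine ⟨2 * C + 579, fun ℓ hℓ n => ?_⟩
  have h : Cost (confGens ℓ) (deco (coreStep ^ (n / 2))) (C * ℓ ^ 4) := hC ℓ (n / 2)
  have hpar : Cost (confGens ℓ) (duckStep ^ (n % 2)) 193 := by
    rcases Nat.mod_two_eq_zero_or_one n with h | h
    · rw [h, pow_zero]; exact Cost.one.mono (by omega)
    · rw [h, pow_one]; exact cost_duckStep
  rw [← Nat.div_add_mod n 2, pow_add, duckStep_pow_two_mul]
  refine ((h.mul ((cost_duckStep.mul h).mul cost_duckStep.inv)).mul hpar).mono ?_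
  have : 1 ≤ ℓ ^ 4 := Nat.one_le_pow _ _ (by have := hℓ.1; omega)
  nlinarith

lemma toC_duckStep {ℓ : ℕ} [Fact (1 < ℓ)] (x : Conf DQ ℓ) (hx : x.1.2.1 = 0) :
    (Conf.toC (duckStep x)).1 = stepC decStep ℓ (Conf.toC x).1 := by
  obtain ⟨⟨⟨s, i⟩, d, g⟩, r, p⟩ := x
  obtain rfl : d = 0 := hx
  funext j
  rcases (show i = 0 ∨ i = 1 by omega) with rfl | rfl
  · have hstep : decStep ((s, 0), 0, g) (r 0) =
        Sum.inl ((((smartRule s (r 0)).1, 1), 0, g), (smartRule s (r 0)).2) := by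
      generalize r 0 = a
      cases s <;> rcases letter_cases a with rfl | rfl | rfl <;> rfl
    have harr : ∀ (k : ZMod ℓ) (e : ℤ),
        arrivesAs decStep ((Conf.toC (((s, 0), 0, g), r, p)).1 k) e = none := by
      intro k e
      rw [Conf.toC_apply]
      split_ifs with hk
      · simp only [arrivesAs, hstep]
      · rfl
    rw [duckStep_matching, stepC]
    by_cases hj : j = p
    · subst hj
      simp [Conf.toC_apply, localStep, hstep]
    · have hc : ∀ y : Conf DQ ℓ, y.2.2 = p → (Conf.toC y).1 j = Sum.inl (y.2.1 (j - p)) := by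
        rintro y rfl
        rw [Conf.toC_apply, if_neg hj]
      rw [hc _ rfl, hc (((s, 0), 0, g), r, p) rfl]
      simp [localStep, harr, sub_ne_zero.2 hj]
  · have hstep : ∀ a, decStep ((s, 1), 0, g) a =
        Sum.inr (if s.isRt then 1 else -1, ((s, 0), 0, g)) := by
      intro a
      cases s <;> rfl
    have harr : ∀ (k : ZMod ℓ) (e : ℤ),
        arrivesAs decStep ((Conf.toC (((s, 1), 0, g), r, p)).1 k) e =
          if k = p ∧ (if s.isRt then 1 else -1) = e then some ((s, 0), 0, g) else none := by
      intro k e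
      rw [Conf.toC_apply]
      by_cases hk : k = p
      · simp only [arrivesAs, hstep, hk, if_true, true_and]
      · simp [arrivesAs, hk]
    rw [duckStep_move, stepC]
    by_cases hj : j = p
    · subst hj
      cases hs : s.isRt <;> simp [Conf.toC_apply, localStep, hstep, Arrow.dir, hs]
    · have hc : (Conf.toC (((s, 1), 0, g), r, p)).1 j = Sum.inl (r (j - p)) := by
        rw [Conf.toC_apply, if_neg hj]
      rw [hc]
      simp only [localStep, harr]
      rw [Conf.toC_apply]
      cases hs : s.isRt
      · by_cases hj' : j = p - 1
        · subst hj'; simp [Arrow.dir, hs, sub_eq_add_neg]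
        · have : j + 1 ≠ p := fun h => hj' (by rw [← h]; ring)
          have h2 : j ≠ p + -1 := by rwa [← sub_eq_add_neg]
          simp [Arrow.dir, hs, this, h2]
          congr 1; ring
      · by_cases hj' : j = p + 1
        · subst hj'; simp [Arrow.dir, hs]
        · have : j - 1 ≠ p := fun h => hj' (by rw [← h]; ring)
          simp [Arrow.dir, hs, this, hj']
          congr 1; ring

lemma toC_duckStep_pow {ℓ : ℕ} [Fact (1 < ℓ)] (n : ℕ) (x : Conf DQ ℓ) (hx : x.1.2.1 = 0) :
    (Conf.toC ((duckStep ^ n) x)).1 = (stepC decStep ℓ)^[n] (Conf.toC x).1 := by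
  induction n generalizing x with
  | zero => rfl
  | succ n ih =>
    rw [pow_succ, Equiv.Perm.mul_apply, ih _ (duckStep_duck x hx), toC_duckStep x hx,
      Function.iterate_succ_apply]

/-- **Lemma.** There is a constant `K > 0` such that for every `ℓ ≥ 2` and every `n`, the
`n`-th power of `T_ℓ↾d₀` — the permutation of `C_ℓ` applying the decorated SMART machine to
configurations whose head has duck `d₀` and fixing all other configurations — belongs to
`G_ℓ` with word norm at most `K·ℓ⁴`. -/
theorem decorated_smart_duck_restricted_distortion :
    ∃ K : ℝ, 0 < K ∧ ∀ ℓ : ℕ, 2 ≤ ℓ → ∀ n : ℕ,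
      ∃ π : Equiv.Perm (CConf DQ Letter ℓ),
        π ∈ Subgroup.closure (TMGens DQ Letter ℓ) ∧
        (∀ w : CConf DQ Letter ℓ,
          ((∃ (i : ZMod ℓ) (sq : SQ) (x : Fin 6) (a : Letter),
              w.1 i = Sum.inr ((sq, (0 : Fin 2), x), a)) →
            (π w).1 = (stepC decStep ℓ)^[n] w.1) ∧
          ((∀ (i : ZMod ℓ) (sq : SQ) (x : Fin 6) (a : Letter),
              w.1 i ≠ Sum.inr ((sq, (0 : Fin 2), x), a)) → π w = w)) ∧
        (wordNorm (TMGens DQ Letter ℓ) π : ℝ) ≤ K * (ℓ : ℝ) ^ 4 := by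
  obtain ⟨C, hC⟩ := exists_cost_duckStep_pow
  refine ⟨C + 1, by positivity, fun ℓ hℓ n => ?_⟩
  have : Fact (1 < ℓ) := ⟨hℓ⟩
  have hcost := (hC ℓ n).liftC
  refine ⟨liftC (duckStep ^ n), hcost.mem_closure, fun w => ⟨?_, fun h => ?_⟩, ?_⟩
  · rintro ⟨i, sq, x, a, h⟩
    have hw := Conf.toC_eq_of_apply_eq_inr w i _ a h
    rw [← hw, liftC_toC]
    exact toC_duckStep_pow n _ rfl
  · rcases headless_or_toC w with hw | ⟨x, rfl⟩
    · exact liftC_of_forall_ne _ _ hw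
    · have hx : x.1.2.1 ≠ 0 := by
        obtain ⟨⟨sq, d, g⟩, r, p⟩ := x
        rintro rfl
        exact h p sq g (r 0) (by simp [Conf.toC_apply])
      rw [liftC_toC, Equiv.Perm.pow_apply_eq_self_of_apply_eq_self (duckStep_of_ne x hx)]
  · have h1 : (wordNorm (TMGens DQ Letter ℓ) (liftC (duckStep ^ n)) : ℝ) ≤ (C * ℓ ^ 4 : ℕ) := by
      exact_mod_cast hcost.wordNorm_le
    push_cast at h1
    nlinarith [pow_nonneg (Nat.cast_nonneg (α := ℝ) ℓ) 4]
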